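/- Let d ≥ 4 and r > 0. Then: (i) E^0[cap(X[0,T], rT)] = (1+o(1))·ε_d·T·(1 + log T·1_{d=4})^{-1} as T → ∞; (ii) for every δ > 0 there exists C = C(d,δ,r) < ∞ such that for all sufficiently large T, P^0[ |cap(X[0,T], rT) − E^0[cap(X[0,T])]| > δ·E^0[cap(X[0,T])] ] < C·log^{-1/2}T when d = 4, and < C·T^{-1/4} when d ≥ 5. -/

import Mathlib

open MeasureTheory ProbabilityTheory Filter Topology
open scoped ENNReal NNReal Classical

noncomputable section

namespace FRIPaper

/-- The lattice `ℤ^d`. -/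
abbrev Zd (d : ℕ) := Fin d → ℤ

/-- `x` and `y` are nearest neighbours in `ℤ^d` (`ℓ¹`-distance one). -/
def IsNN {d : ℕ} (x y : Zd d) : Prop := (∑ i, (x i - y i).natAbs) = 1

/-- Event that a one-sided path never visits `A` at a positive time
(i.e. `H̃_A = ∞` for the path started anywhere). -/
def NoReturn {d : ℕ} (A : Set (Zd d)) : Set (ℕ → Zd d) := {ω | ∀ t : ℕ, 0 < t → ω t ∉ A}

/-- Event that a one-sided path does not visit `A` at a positive time `t ≤ s`
(i.e. `H̃_A > s`). -/
def NoReturnUpTo {d : ℕ} (A : Set (Zd d)) (s : ℝ) : Set (ℕ → Zd d) :=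
  {ω | ∀ t : ℕ, 0 < t → (t : ℝ) ≤ s → ω t ∉ A}

/-- Specification of the law `P^x` of the discrete-time simple random walk on `ℤ^d`
started at `x`, as a measure on the path space `ℕ → ℤ^d`: it is the unique probability
measure giving each nearest-neighbour cylinder of length `T` based at `x`
probability `(2d)^{-T}`. -/
def IsSRW (d : ℕ) (x : Zd d) (P : Measure (ℕ → Zd d)) : Prop :=
  IsProbabilityMeasure P ∧
    ∀ (T : ℕ) (w : ℕ → Zd d),
      P {ω | ∀ t ≤ T, ω t = w t} =
        if w 0 = x ∧ ∀ t < T, IsNN (w t) (w (t + 1)) then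
          (((2 * d : ℕ) : ℝ≥0∞))⁻¹ ^ T else 0

/-- A family `P x`, `x ∈ ℤ^d`, of simple random walk laws. -/
def IsSRWFamily (d : ℕ) (P : Zd d → Measure (ℕ → Zd d)) : Prop := ∀ x, IsSRW d x (P x)

/-- Equilibrium measure `e_A(x) = P^x[H̃_A = ∞] 1_{x ∈ A}`. -/
def equil {d : ℕ} (P : Zd d → Measure (ℕ → Zd d)) (A : Set (Zd d)) (x : Zd d) : ℝ :=
  if x ∈ A then (P x (NoReturn A)).toReal else 0

/-- Capacity `cap(A) = Σ_{x∈A} e_A(x)`. -/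
def capacity {d : ℕ} (P : Zd d → Measure (ℕ → Zd d)) (A : Finset (Zd d)) : ℝ :=
  ∑ x ∈ A, equil P (↑A) x

/-- Truncated capacity `cap(A,T) = Σ_{x∈A} P^x[H̃_A > T·(log T)^{-10}]`. -/
def capTrunc {d : ℕ} (P : Zd d → Measure (ℕ → Zd d)) (A : Finset (Zd d)) (T : ℝ) : ℝ :=
  ∑ x ∈ A, (P x (NoReturnUpTo (↑A) (T / (Real.log T) ^ (10 : ℕ)))).toReal

/-- `X[a,b]`, the set of points visited by the path between times `a` and `b`. -/
def walkRange {d : ℕ} (ω : ℕ → Zd d) (a b : ℕ) : Finset (Zd d) := (Finset.Icc a b).image ω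

/-- `E^0[cap(X[0,T])]`. -/
def capExpect {d : ℕ} (P : Zd d → Measure (ℕ → Zd d)) (T : ℕ) : ℝ :=
  ∫ ω, capacity P (walkRange ω 0 T) ∂ (P 0)

/-- `1 + log x · 1_{d = 4}`. -/
def logFour (d : ℕ) (x : ℝ) : ℝ := 1 + if d = 4 then Real.log x else 0

/-- `ε` is the constant `ε_d = lim_{T→∞} E^0[cap(X[0,T])]·T^{-1}·(1 + log T·1_{d=4})`,
which lies in `(0,∞)`. -/
def IsCapLimit (d : ℕ) (P : Zd d → Measure (ℕ → Zd d)) (ε : ℝ) : Prop :=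
  0 < ε ∧ Tendsto (fun T : ℕ => capExpect P T * logFour d T / (T : ℝ)) atTop (𝓝 ε)

/-! ### Distributions on `ℕ` -/

/-- `ρ` is a probability distribution on `ℕ`. -/
def IsDist (ρ : ℕ → ℝ) : Prop := (∀ k, 0 ≤ ρ k) ∧ HasSum ρ 1

/-- `k`-th moment `μ_k(ρ)`. -/
def mu (k : ℕ) (ρ : ℕ → ℝ) : ℝ := ∑' l : ℕ, (l : ℝ) ^ k * ρ l

/-- Tail `μ_k^{(m)}(ρ) = Σ_{l ≥ m} l^k ρ(l)`. -/
def muTail (k m : ℕ) (ρ : ℕ → ℝ) : ℝ := ∑' l : ℕ, if m ≤ l then (l : ℝ) ^ k * ρ l else 0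

/-- An appropriate family of distributions on `ℕ`. -/
def Appropriate (ρ : ℕ → ℕ → ℝ) : Prop :=
  (∀ n, IsDist (ρ n)) ∧
  (∀ n, Summable fun l : ℕ => (l : ℝ) ^ 2 * ρ n l) ∧
  Tendsto (fun n => mu 1 (ρ n)) atTop atTop ∧
  ∀ ε : ℝ, 0 < ε → ∃ C : ℝ,
    ∀ n, (∑' L : ℕ, if C * mu 1 (ρ n) ≤ (L : ℝ) then (L : ℝ) ^ 2 * ρ n L / mu 2 (ρ n) else 0) ≤ ε

/-- Geometric distribution `Geo(λ)(k) = λ (1-λ)^k`. -/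
def geo (lam : ℝ) (k : ℕ) : ℝ := lam * (1 - lam) ^ k

/-! ### Trajectories and finitary random interlacements -/

/-- A finite trajectory in `ℤ^d`, recorded as the list of its positions. -/
abbrev Traj (d : ℕ) := List (Zd d)

/-- A point configuration: the multiplicity of each trajectory. -/
abbrev Config (d : ℕ) := Traj d → ℕ

/-- A valid trajectory: a nonempty nearest-neighbour path. -/
def ValidTraj {d : ℕ} (η : Traj d) : Prop := η ≠ [] ∧ η.Chain' IsNN

/-- The time length `T(η)` of a trajectory. -/
def len {d : ℕ} (η : Traj d) : ℕ := η.length - 1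

/-- The range of a trajectory, as a set. -/
def rangeSet {d : ℕ} (η : Traj d) : Set (Zd d) := {y | y ∈ η}

/-- The trajectory `η` visits the set `A`. -/
def hits {d : ℕ} (η : Traj d) (A : Set (Zd d)) : Prop := ∃ y ∈ η, y ∈ A

/-- Poisson probability mass `e^{-r} r^n / n!`. -/
def poissonProb (r : ℝ) (n : ℕ) : ℝ≥0∞ :=
  ENNReal.ofReal (Real.exp (-r) * r ^ n / n.factorial)

/-- The intensity `u·π({η})` that FRI with parameters `(u,ρ)` puts on a single
trajectory `η`: trajectories of length `l` from each starting point carry mass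
`u·ρ(l)/(μ₁(ρ)+1)·(2d)^{-l}` each. -/
def friIntensity (d : ℕ) (u : ℝ) (ρ : ℕ → ℝ) (η : Traj d) : ℝ :=
  if ValidTraj η then u * ρ (len η) / (mu 1 ρ + 1) * (1 / (2 * (d : ℝ))) ^ (len η) else 0

/-- `P` is the law of a Poisson point process on the countable set of trajectories
with intensity function `ι`: the multiplicities of distinct trajectories are
independent Poisson random variables. -/
def IsPoissonPP (d : ℕ) (ι : Traj d → ℝ) (P : Measure (Config d)) : Prop :=
  IsProbabilityMeasure P ∧
    ∀ (F : Finset (Traj d)) (k : Traj d → ℕ),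
      P {ω | ∀ η ∈ F, ω η = k η} = ∏ η ∈ F, poissonProb (ι η) (k η)

/-- `P` is the law of the finitary random interlacements point process `𝒳^{u,ρ}`. -/
def IsFRI (d : ℕ) (u : ℝ) (ρ : ℕ → ℝ) (P : Measure (Config d)) : Prop :=
  IsPoissonPP d (friIntensity d u ρ) P

/-- `J` is the law of an i.i.d. sequence of copies of `𝒳^{u,ρ}`. -/
def IsFRIseq (d : ℕ) (u : ℝ) (ρ : ℕ → ℝ) (J : Measure (ℕ → Config d)) : Prop :=
  IsProbabilityMeasure J ∧
    ∀ (F : Finset (ℕ × Traj d)) (k : ℕ × Traj d → ℕ),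
      J {j | ∀ p ∈ F, j p.1 p.2 = k p} = ∏ p ∈ F, poissonProb (friIntensity d u ρ p.2) (k p)

/-! ### Percolation -/

/-- The edge `{x,y}` is traversed by some trajectory of the configuration `ω`. -/
def EdgeOpen {d : ℕ} (ω : Config d) (x y : Zd d) : Prop :=
  ∃ η : Traj d, 0 < ω η ∧ ∃ i : ℕ,
    (η[i]? = some x ∧ η[i + 1]? = some y) ∨ (η[i]? = some y ∧ η[i + 1]? = some x)

/-- The cluster of `x` in the subgraph `ℐ` induced by the configuration `ω`. -/
def Cluster {d : ℕ} (ω : Config d) (x : Zd d) : Set (Zd d) :=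
  {y | Relation.ReflTransGen (EdgeOpen ω) x y}

/-- The origin lies in an infinite cluster. -/
def PercEvent (d : ℕ) : Set (Config d) := {ω | (Cluster ω 0).Infinite}

/-- The critical intensity `u_*(ρ)`, given the family `u ↦ 𝒳^{u,ρ}`. -/
def uStar (d : ℕ) (X : ℝ → Measure (Config d)) : ℝ :=
  sInf {u : ℝ | 0 ≤ u ∧ 0 < X u (PercEvent d)}

/-- The order `u_n = μ₁(ρ)·(1 + log μ₁(ρ)·1_{d=4}) / (ε_d·μ₂(ρ))` of the
critical intensity. -/
def uN (d : ℕ) (εd : ℝ) (ρ : ℕ → ℝ) : ℝ :=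
  mu 1 ρ * logFour d (mu 1 ρ) / (εd * mu 2 ρ)

/-! ### `ρ`-capacity, Green function, `κ` and `φ` -/

/-- `e_A^{(ρ)}(x) = Σ_m (μ₀^{(m)}(ρ)/(μ₁(ρ)+1))·P^x[H̃_A > m]`. -/
def equilRho {d : ℕ} (P : Zd d → Measure (ℕ → Zd d)) (ρ : ℕ → ℝ) (A : Set (Zd d))
    (x : Zd d) : ℝ :=
  ∑' m : ℕ, (muTail 0 m ρ / (mu 1 ρ + 1)) * (P x (NoReturnUpTo A (m : ℝ))).toReal

/-- `cap^{(ρ)}(A) = Σ_{x∈A} e_A^{(ρ)}(x)`. -/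
def capRho {d : ℕ} (P : Zd d → Measure (ℕ → Zd d)) (ρ : ℕ → ℝ) (A : Finset (Zd d)) : ℝ :=
  ∑ x ∈ A, equilRho P ρ (↑A) x

/-- Green's function `g(x,y) = Σ_t P^x[X_t = y]`. -/
def green {d : ℕ} (P : Zd d → Measure (ℕ → Zd d)) (x y : Zd d) : ℝ :=
  ∑' t : ℕ, (P x {ω | ω t = y}).toReal

/-- `φ^{(ρ)}(A,B) = Σ_{x∈A} Σ_{y∈B} e_A^{(ρ)}(x) e_B^{(ρ)}(y) g(x,y)`. -/
def phiRho {d : ℕ} (P : Zd d → Measure (ℕ → Zd d)) (ρ : ℕ → ℝ) (A B : Finset (Zd d)) : ℝ :=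
  ∑ x ∈ A, ∑ y ∈ B, equilRho P ρ (↑A) x * equilRho P ρ (↑B) y * green P x y

/-- `κ^{(ρ)}(A) = Σ_{x∈A} Σ_m (μ₁^{(m)}(ρ)/μ₂(ρ))·P^x[H̃_A > m]` (real-valued,
for finite `A`). -/
def kappa {d : ℕ} (P : Zd d → Measure (ℕ → Zd d)) (ρ : ℕ → ℝ) (A : Finset (Zd d)) : ℝ :=
  ∑ x ∈ A, ∑' m : ℕ, (muTail 1 m ρ / mu 2 ρ) * (P x (NoReturnUpTo (↑A) (m : ℝ))).toReal

/-- `κ^{(ρ)}(A)` as an extended-real valued quantity, for arbitrary `A`. -/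
def kappaE {d : ℕ} (P : Zd d → Measure (ℕ → Zd d)) (ρ : ℕ → ℝ) (A : Set (Zd d)) : ℝ≥0∞ :=
  ∑' x : Zd d,
    A.indicator (fun x => ∑' m : ℕ,
      ENNReal.ofReal (muTail 1 m ρ / mu 2 ρ) * P x (NoReturnUpTo A (m : ℝ))) x

/-! ### Exploration processes -/

/-- First components: the `k`-th layer `L_k` of vertices; second components:
`∪_{i<k} L_i`.  Layer `L_{k+1}` is spanned by the trajectories of `ω` meeting `L_k`
but not `∪_{i<k} L_i`. -/
def exploreSets {d : ℕ} (ω : Config d) : ℕ → Set (Zd d) × Set (Zd d)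
  | 0 => ({0}, ∅)
  | k + 1 =>
    ({y | ∃ η : Traj d, 0 < ω η ∧ hits η (exploreSets ω k).1 ∧
        ¬ hits η (exploreSets ω k).2 ∧ y ∈ η},
      (exploreSets ω k).1 ∪ (exploreSets ω k).2)

/-- The `i`-th layer `𝓛_i` of trajectories of the exploration of the cluster of the
origin, as a sub-configuration of `ω`. -/
def exploreLayer {d : ℕ} (ω : Config d) : ℕ → Config d
  | 0 => fun _ => 0
  | k + 1 => fun η =>
      if hits η (exploreSets ω k).1 ∧ ¬ hits η (exploreSets ω k).2 then ω η else 0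

/-- The vertex sets `L'_k` of the dominating exploration driven by the i.i.d.
sequence `j`. -/
def exploreSets' {d : ℕ} (j : ℕ → Config d) : ℕ → Set (Zd d)
  | 0 => {0}
  | k + 1 => {y | ∃ η : Traj d, 0 < j (k + 1) η ∧ hits η (exploreSets' j k) ∧ y ∈ η}

/-- The trajectory layers `𝓛'_i` of the dominating exploration. -/
def exploreLayer' {d : ℕ} (j : ℕ → Config d) : ℕ → Config d
  | 0 => fun _ => 0
  | k + 1 => fun η => if hits η (exploreSets' j k) then j (k + 1) η else 0

/-- `W_k = 𝔼[κ^{(ρ)}(L'_k)]`. -/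
def Wexp {d : ℕ} (P : Zd d → Measure (ℕ → Zd d)) (ρ : ℕ → ℝ)
    (J : Measure (ℕ → Config d)) (k : ℕ) : ℝ≥0∞ :=
  ∫⁻ j, kappaE P ρ (exploreSets' j k) ∂ J

/-- `V_k = 𝔼[|L'_k|]`, multiplied by `(log μ₁(ρ))⁻¹` when `d = 4`. -/
def Vexp (d : ℕ) (ρ : ℕ → ℝ) (J : Measure (ℕ → Config d)) (k : ℕ) : ℝ≥0∞ :=
  (if d = 4 then ENNReal.ofReal (1 / Real.log (mu 1 ρ)) else 1) *
    ∫⁻ j, ENat.toENNReal (exploreSets' j k).encard ∂ J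

/-! ### Two-sided finite random walk trajectories -/

/-- `μ(x,m,l)({η})`: the two-sided path `(X_{-m},…,X_l)` of a doubly infinite walk
with `X_0 = x` equals the list `η` (of length `m+l+1`, with `η[m] = x`)
with probability `(2d)^{-(m+l)}` for every admissible nearest-neighbour list. -/
def twoSidedProb (d : ℕ) (x : Zd d) (m l : ℕ) (η : Traj d) : ℝ :=
  if η.length = m + l + 1 ∧ η.Chain' IsNN ∧ η[m]? = some x then
    (1 / (2 * (d : ℝ))) ^ (m + l) else 0

/-- The `ℓ^∞`-diameter of the range of `η` is at most `R`. -/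
def DiamLE {d : ℕ} (η : Traj d) (R : ℝ) : Prop :=
  ∀ a ∈ η, ∀ b ∈ η, ∀ i, |((a i - b i : ℤ) : ℝ)| ≤ R

/-- `P^x[X[-m,-1] ∩ A = ∅]`: the probability that an `m`-step walk from `x`
avoids `A` at all positive times, written combinatorially. -/
def backAvoidProb (d : ℕ) (A : Set (Zd d)) (x : Zd d) (m : ℕ) : ℝ :=
  ∑' w : Traj d,
    if w.length = m + 1 ∧ w.Chain' IsNN ∧ w[0]? = some x ∧
        (∀ i : ℕ, 0 < i → ∀ y, w[i]? = some y → y ∉ A) then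
      (1 / (2 * (d : ℝ))) ^ m else 0

/-- `μ(x,m,l;A)({η}) = P^x[X[-m,l] = η | X[-m,-1] ∩ A = ∅]`. -/
def condTwoSidedProb (d : ℕ) (A : Set (Zd d)) (x : Zd d) (m l : ℕ) (η : Traj d) : ℝ :=
  (if ∀ i < m, ∀ y, η[i]? = some y → y ∉ A then twoSidedProb d x m l η else 0) /
    backAvoidProb d A x m

/-- `π_A({η}) = Σ_{x∈A} Σ_{m,l} (ρ(m+l)/(μ₁(ρ)+1))·P^x[H̃_A > m]·μ(x,m,l;A)({η})`. -/
def piA (d : ℕ) (P : Zd d → Measure (ℕ → Zd d)) (ρ : ℕ → ℝ) (A : Finset (Zd d))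
    (η : Traj d) : ℝ :=
  ∑ x ∈ A, ∑' m : ℕ, ∑' l : ℕ,
    ρ (m + l) / (mu 1 ρ + 1) * (P x (NoReturnUpTo (↑A) (m : ℝ))).toReal *
      condTwoSidedProb d (↑A) x m l η

/-- The sub-configuration of trajectories meeting `A`, i.e. `𝒳[A]`. -/
def restrictConfig {d : ℕ} (A : Finset (Zd d)) (ω : Config d) : Config d :=
  fun η => if hits η (↑A) then ω η else 0

/-! ### Products and geometric laws -/

/-- The geometric measure `Geo(1/(T+1))` on `ℕ`. -/
def geoMeasure (T : ℕ) : Measure ℕ :=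
  Measure.sum fun k : ℕ => (ENNReal.ofReal (geo (1 / ((T : ℝ) + 1)) k)) • Measure.dirac k

/-- `Q` is the product (independent coupling) of `μ` and `ν`. -/
def IsProdOf {α β : Type*} [MeasurableSpace α] [MeasurableSpace β]
    (Q : Measure (α × β)) (μ : Measure α) (ν : Measure β) : Prop :=
  IsProbabilityMeasure Q ∧
    ∀ (A : Set α) (B : Set β), MeasurableSet A → MeasurableSet B → Q (A ×ˢ B) = μ A * ν B

/-! ### Coarse graining quantities -/

/-- The constant `c = 0.01`. -/
def cConst : ℝ := 0.01

/-- `R_n = ⌊√(μ₁(ρ_n))⌋`. -/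
def Rn (ρ : ℕ → ℕ → ℝ) (n : ℕ) : ℕ := ⌊Real.sqrt (mu 1 (ρ n))⌋₊

/-- The mesoscopic scale `L_n`. -/
def Ln (d : ℕ) (ρ : ℕ → ℕ → ℝ) (n : ℕ) : ℝ :=
  if d = 4 then (Rn ρ n : ℝ) * (Real.log (Rn ρ n)) ^ (-cConst)
  else (Rn ρ n : ℝ) ^ ((2 + cConst) / ((d : ℝ) - 2))

/-- The slowly growing factor `I_n`. -/
def In (d : ℕ) (ρ : ℕ → ℕ → ℝ) (n : ℕ) : ℝ :=
  if d = 4 then (Real.log (Rn ρ n)) ^ cConst else (Rn ρ n : ℝ) ^ cConst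

/-- The scale `T'_n`. -/
def Tn' (d : ℕ) (ρ : ℕ → ℕ → ℝ) (n : ℕ) : ℕ :=
  if d = 4 then ⌊(Rn ρ n : ℝ) ^ (2 : ℕ) / Real.log (mu 1 (ρ n))⌋₊
  else ⌊(Rn ρ n : ℝ) ^ ((2 : ℝ) - cConst / 4)⌋₊

/-- The scale `l_n`. -/
def lnPar (d : ℕ) (ρ : ℕ → ℕ → ℝ) (n : ℕ) : ℕ :=
  if d = 4 then ⌊(Rn ρ n : ℝ) * (Real.log (Rn ρ n)) ^ (-(2 * cConst))⌋₊
  else ⌊(Rn ρ n : ℝ) ^ ((1 : ℝ) - cConst / 4)⌋₊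

/-- The scale `t_n`. -/
def tnPar (d : ℕ) (ρ : ℕ → ℕ → ℝ) (n : ℕ) : ℕ :=
  if d = 4 then ⌊(Rn ρ n : ℝ) ^ (2 : ℕ) / (Real.log (Rn ρ n)) ^ (10 : ℕ)⌋₊
  else ⌊(Rn ρ n : ℝ) ^ ((2 : ℝ) - cConst)⌋₊

/-- `y` is within `ℓ^∞`-distance `r` of `z`. -/
def InBall {d : ℕ} (y z : Zd d) (r : ℝ) : Prop := ∀ i, |((y i - z i : ℤ) : ℝ)| ≤ r

/-- The `ℓ^∞` `r`-neighbourhood `B(A,r)`. -/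
def nbhd {d : ℕ} (A : Set (Zd d)) (r : ℝ) : Set (Zd d) := {y | ∃ z ∈ A, InBall y z r}

/-- The sub-path `η[a, b]` of a trajectory. -/
def segment {d : ℕ} (η : Traj d) (a b : ℕ) : Traj d := (η.drop a).take (b - a + 1)

/-- `η` is a typical trajectory (the event `𝒯_n = ℰ₁ ∩ ℰ₂ ∩ ℰ₃ ∩ ℰ₄`). -/
def Typical (d : ℕ) (P : Zd d → Measure (ℕ → Zd d)) (εd : ℝ) (ρ : ℕ → ℕ → ℝ)
    (kk KK M θ1 : ℝ) (n : ℕ) (η : Traj d) : Prop :=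
  ValidTraj η ∧
  -- ℰ₁
  (kk * (Rn ρ n : ℝ) ^ 2 ≤ (len η : ℝ) ∧ (len η : ℝ) ≤ KK * (Rn ρ n : ℝ) ^ 2 ∧
    ∀ y ∈ η, InBall y η.headI (M * (Rn ρ n : ℝ))) ∧
  -- ℰ₂
  (if d = 4 then
    (1 - θ1 ^ 2) * (Real.pi ^ 2 / 8) * (len η : ℝ) / Real.log (mu 1 (ρ n)) <
        capacity P η.toFinset ∧
      capTrunc P η.toFinset ((Rn ρ n : ℝ) ^ 2) <
        (1 + θ1 ^ 2) * (Real.pi ^ 2 / 8) * (len η : ℝ) / Real.log (mu 1 (ρ n))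
  else
    (1 - θ1 ^ 2) * εd * (len η : ℝ) < capacity P η.toFinset ∧
      capacity P η.toFinset < (1 + θ1 ^ 2) * εd * (len η : ℝ)) ∧
  -- ℰ₃
  ((Set.ncard (nbhd (rangeSet η) (Ln d ρ n)) : ℝ) <
    (Rn ρ n : ℝ) ^ 2 * (Ln d ρ n) ^ (d - 2) * (In d ρ n) ^ ((1 : ℝ) / 3)) ∧
  -- ℰ₄
  (∀ j : ℕ, j * Tn' d ρ n ≤ len η →
    if d = 4 then
      capacity P (segment η (j * Tn' d ρ n) (min ((j + 1) * Tn' d ρ n) (len η))).toFinset ≤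
          (1 + θ1 ^ 2) * (Real.pi ^ 2 / 8) * (Tn' d ρ n : ℝ) / Real.log (mu 1 (ρ n)) ∧
        ∀ a ∈ segment η (j * Tn' d ρ n) (min ((j + 1) * Tn' d ρ n) (len η)),
          ∀ b ∈ segment η (j * Tn' d ρ n) (min ((j + 1) * Tn' d ρ n) (len η)),
            ∀ i, |((a i - b i : ℤ) : ℝ)| <
              (1 / 2) * Real.sqrt (len η : ℝ) * (Real.log (mu 1 (ρ n))) ^ (-cConst)
    else
      capacity P (segment η (j * Tn' d ρ n) (min ((j + 1) * Tn' d ρ n) (len η))).toFinset ≤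
        (1 + θ1 ^ 2) * εd * (Tn' d ρ n : ℝ))

/-- `x` belongs to the `*`-proper part `η̂` of the trajectory `η`. -/
def ProperStar (d : ℕ) (P : Zd d → Measure (ℕ → Zd d)) (ρ : ℕ → ℕ → ℝ)
    (θ1 θ2 : ℝ) (n : ℕ) (η : Traj d) (x : Zd d) : Prop :=
  x ∈ rangeSet η ∧
    (if d = 4 then
      θ2 / Real.log (mu 1 (ρ n)) ≤ equil P (rangeSet η) x ∧
        (P x (NoReturnUpTo (rangeSet η)
            ((Rn ρ n : ℝ) ^ 2 / (Real.log (Rn ρ n)) ^ (10 : ℕ)))).toReal ≤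
          (1 + θ1) * equil P (rangeSet η) x
    else θ2 ≤ equil P (rangeSet η) x)

/-! ### Canonical construction of the walk -/

/-- The alphabet of steps. -/
abbrev Stp (d : ℕ) := Fin d × Bool

/-- The displacement of a step. -/
def stp {d : ℕ} (e : Stp d) : Zd d := Pi.single e.1 (if e.2 then 1 else -1)

/-- The uniform law on steps. -/
def stepLaw (d : ℕ) : Measure (Stp d) := ((2 * d : ℕ) : ℝ≥0∞)⁻¹ • Measure.count

instance stepLaw_prob (d : ℕ) [NeZero d] : IsProbabilityMeasure (stepLaw d) := by
  constructor
  have hd : d ≠ 0 := NeZero.ne d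
  rw [stepLaw, Measure.smul_apply, Measure.count_univ, smul_eq_mul]
  simp only [ENat.card_eq_coe_fintype_card, Fintype.card_prod, Fintype.card_fin, Fintype.card_bool]
  rw [mul_comm d 2]
  exact ENNReal.inv_mul_cancel (by simpa using hd) (by simp [ENNReal.mul_eq_top])

/-- The law of an i.i.d. sequence of steps. -/
def walkLaw (d : ℕ) [NeZero d] : Measure (ℕ → Stp d) := Measure.infinitePi (fun _ => stepLaw d)

instance walkLaw_prob (d : ℕ) [NeZero d] : IsProbabilityMeasure (walkLaw d) := by
  unfold walkLaw; infer_instance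

/-- The path started at `x` with steps `u`. -/
def path {d : ℕ} (x : Zd d) (u : ℕ → Stp d) (t : ℕ) : Zd d :=
  x + ∑ k ∈ Finset.range t, stp (u k)

/-- Concatenation of step sequences. -/
def conc {d : ℕ} (n : ℕ) (p : (ℕ → Stp d) × (ℕ → Stp d)) : ℕ → Stp d :=
  fun k => if k < n then p.1 k else p.2 (k - n)

lemma measurable_conc {d : ℕ} (n : ℕ) : Measurable (conc (d := d) n) := by
  refine measurable_pi_lambda _ fun k => ?_
  unfold conc
  by_cases h : k < n <;> simp only [h, if_true, if_false] <;> fun_prop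

lemma measurable_path {d : ℕ} (x : Zd d) : Measurable (path x) := by
  refine measurable_pi_lambda _ fun t => ?_
  unfold path
  refine measurable_const.add (Finset.measurable_sum _ fun k _ => ?_)
  exact (Measurable.of_discrete (f := stp)).comp (measurable_pi_apply k)

lemma measurable_path_at {d : ℕ} (x : Zd d) (t : ℕ) : Measurable (fun u => path x u t) :=
  (measurable_pi_apply t).comp (measurable_path x)

lemma mp_conc (d : ℕ) [NeZero d] (n : ℕ) :
    MeasurePreserving (conc (d := d) n) ((walkLaw d).prod (walkLaw d)) (walkLaw d) := by
  refine ⟨measurable_conc n, ?_⟩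
  apply Measure.eq_infinitePi
  intro s t ht
  rw [Measure.map_apply (measurable_conc n)
    (MeasurableSet.pi s.countable_toSet fun i _ => ht i)]
  have hset : conc n ⁻¹' (Set.pi s t) =
      (Set.pi (s.filter (· < n) : Finset ℕ) t) ×ˢ
      (Set.pi (((s.filter (fun k => ¬ k < n)).image (fun k => k - n) : Finset ℕ))
        (fun k => t (k + n))) := by
    ext p
    simp only [Set.mem_preimage, Set.mem_pi, Finset.mem_coe, Set.mem_prod, Finset.mem_filter,
      Finset.mem_image, conc]
    constructor
    · intro h
      refine ⟨fun i hi => by simpa [hi.2] using h i hi.1, ?_⟩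
      rintro i ⟨k, ⟨hk, hkn⟩, rfl⟩
      have := h k hk
      simp only [hkn, if_false] at this
      rwa [Nat.sub_add_cancel (not_lt.mp hkn)]
    · rintro ⟨h1, h2⟩ i hi
      by_cases hin : i < n
      · simpa [hin] using h1 i ⟨hi, hin⟩
      · have := h2 (i - n) ⟨i, ⟨hi, hin⟩, rfl⟩
        rw [Nat.sub_add_cancel (not_lt.mp hin)] at this
        simpa [hin] using this
  rw [hset, Measure.prod_prod, walkLaw, Measure.infinitePi_pi _ (fun i _ => ht i),
    Measure.infinitePi_pi _ (fun i _ => ht (i + n)), Finset.prod_image]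
  · rw [← Finset.prod_filter_mul_prod_filter_not s (· < n)]
    congr 1
    refine Finset.prod_congr rfl fun k hk => ?_
    rw [Nat.sub_add_cancel (not_lt.mp (Finset.mem_filter.mp hk).2)]
  · intro a ha b hb hab
    have h1 := not_lt.mp (Finset.mem_filter.mp ha).2
    have h2 := not_lt.mp (Finset.mem_filter.mp hb).2
    simp only at hab
    omega

lemma path_conc_le {d : ℕ} (x : Zd d) (n : ℕ) (v u : ℕ → Stp d) {t : ℕ} (ht : t ≤ n) :
    path x (conc n (v, u)) t = path x v t := by
  unfold path conc
  congr 1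
  refine Finset.sum_congr rfl fun k hk => ?_
  simp [(Finset.mem_range.mp hk).trans_le ht]

lemma path_conc_add {d : ℕ} (x : Zd d) (n : ℕ) (v u : ℕ → Stp d) (t : ℕ) :
    path x (conc n (v, u)) (n + t) = path (path x v n) u t := by
  unfold path conc
  rw [Finset.sum_range_add, ← add_assoc]
  congr 1
  · congr 1
    refine Finset.sum_congr rfl fun k hk => ?_
    simp [(Finset.mem_range.mp hk)]
  · refine Finset.sum_congr rfl fun k hk => ?_
    simp

lemma path_add {d : ℕ} (x y : Zd d) (u : ℕ → Stp d) (t : ℕ) :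
    path (x + y) u t = path x u t + y := by
  unfold path; abel

lemma path_zero' {d : ℕ} (x : Zd d) (u : ℕ → Stp d) : path x u 0 = x := by simp [path]

lemma path_succ {d : ℕ} (x : Zd d) (u : ℕ → Stp d) (t : ℕ) :
    path x u (t + 1) = path x u t + stp (u t) := by
  simp [path, Finset.sum_range_succ, add_assoc]

/-! ### Identification of `P^x` -/

lemma stp_injective {d : ℕ} : Function.Injective (stp (d := d)) := by
  rintro ⟨i, b⟩ ⟨j, c⟩ h
  unfold stp at h
  simp only at h
  have hij : i = j := by
    by_contra hne
    have := congrFun h i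
    rw [Pi.single_eq_same, Pi.single_eq_of_ne hne] at this
    split_ifs at this <;> omega
  subst hij
  have := congrFun h i
  rw [Pi.single_eq_same, Pi.single_eq_same] at this
  cases b <;> cases c <;> simp_all

lemma isNN_iff {d : ℕ} (x y : Zd d) : IsNN x y ↔ ∃ e : Stp d, y = x + stp e := by
  constructor
  · intro h
    unfold IsNN at h
    have h1 : ∃ i, (x i - y i).natAbs ≠ 0 := by
      by_contra hcon
      push Not at hcon
      simp [hcon] at h
    obtain ⟨i, hi⟩ := h1
    rw [← Finset.add_sum_erase _ _ (Finset.mem_univ i)] at h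
    have hi1 : (x i - y i).natAbs = 1 := by omega
    have h0 : ∑ j ∈ Finset.univ.erase i, (x j - y j).natAbs = 0 := by omega
    rw [Finset.sum_eq_zero_iff] at h0
    refine ⟨(i, decide (y i = x i + 1)), ?_⟩
    ext j
    unfold stp
    by_cases hj : j = i
    · subst hj
      simp only [Pi.add_apply, Pi.single_eq_same]
      by_cases h2 : y j = x j + 1
      · simp [h2]
      · simp [h2]; omega
    · have := h0 j (by simp [hj])
      simp only [Pi.add_apply, Pi.single_eq_of_ne hj]
      omega
  · rintro ⟨⟨i, b⟩, rfl⟩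
    unfold IsNN stp
    rw [Finset.sum_eq_single i]
    · cases b <;> simp
    · intro j _ hj
      simp [Pi.single_eq_of_ne hj]
    · simp

/-- Cylinder sets. -/
def cyl {d : ℕ} (T : ℕ) (w : ℕ → Zd d) : Set (ℕ → Zd d) := {ω | ∀ t ≤ T, ω t = w t}

lemma measurableSet_cyl {d : ℕ} (T : ℕ) (w : ℕ → Zd d) : MeasurableSet (cyl T w) := by
  have : cyl T w = ⋂ t ∈ Finset.range (T + 1), {ω | ω t = w t} := by
    ext ω; simp [cyl, Nat.lt_succ_iff]
  rw [this]
  refine Finset.measurableSet_biInter _ fun t _ => ?_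
  have h2 : {ω : ℕ → Zd d | ω t = w t} = (fun ω => ω t) ⁻¹' {w t} := by ext; simp
  rw [h2]
  exact measurable_pi_apply t (measurableSet_singleton (w t))

lemma generate_cyl (d : ℕ) : (MeasurableSpace.pi : MeasurableSpace (ℕ → Zd d)) =
    MeasurableSpace.generateFrom {s | ∃ T w, s = cyl T w} := by
  apply le_antisymm
  · refine iSup_le fun t => ?_
    rw [← measurable_iff_comap_le]
    refine @measurable_to_countable' _ _ _ _ (MeasurableSpace.generateFrom _) _ fun y => ?_
    have : (fun ω : ℕ → Zd d => ω t) ⁻¹' {y} =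
        ⋃ v ∈ {v : Fin (t + 1) → Zd d | v (Fin.last t) = y},
          cyl t (fun k => if h : k < t + 1 then v ⟨k, h⟩ else 0) := by
      ext ω
      simp only [Set.mem_preimage, Set.mem_singleton_iff, Set.mem_iUnion, cyl, Set.mem_ofPred_eq,
        exists_prop]
      constructor
      · intro h
        refine ⟨fun k => ω k, by simpa using h, fun k hk => ?_⟩
        simp [Nat.lt_succ_iff.mpr hk]
      · rintro ⟨v, hv, h⟩
        rw [h t le_rfl, dif_pos (Nat.lt_succ_self t)]
        exact hv
    rw [this]
    refine MeasurableSet.biUnion (Set.to_countable _) fun v _ => ?_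
    exact MeasurableSpace.measurableSet_generateFrom ⟨_, _, rfl⟩
  · refine MeasurableSpace.generateFrom_le ?_
    rintro s ⟨T, w, rfl⟩
    exact measurableSet_cyl T w

lemma piSystem_cyl (d : ℕ) : IsPiSystem {s : Set (ℕ → Zd d) | ∃ T w, s = cyl T w} := by
  rintro _ ⟨T, w, rfl⟩ _ ⟨T', w', rfl⟩ ⟨ω0, h1, h2⟩
  refine ⟨max T T', ω0, ?_⟩
  ext ω
  simp only [cyl, Set.mem_inter_iff, Set.mem_ofPred_eq] at *
  constructor
  · rintro ⟨h3, h4⟩ t ht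
    rcases le_max_iff.mp ht with h | h
    · rw [h3 t h, h1 t h]
    · rw [h4 t h, h2 t h]
  · intro h
    exact ⟨fun t ht => by rw [h t (le_max_of_le_left ht), h1 t ht],
      fun t ht => by rw [h t (le_max_of_le_right ht), h2 t ht]⟩

lemma srw_eq_map {d : ℕ} [NeZero d] {x : Zd d} {P : Measure (ℕ → Zd d)} (h : IsSRW d x P) :
    P = (walkLaw d).map (path x) := by
  haveI := h.1
  haveI : IsProbabilityMeasure ((walkLaw d).map (path x)) :=
    Measure.isProbabilityMeasure_map (measurable_path x).aemeasurable
  refine ext_of_generate_finite _ (generate_cyl d) (piSystem_cyl d) ?_ (by simp)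
  rintro _ ⟨T, w, rfl⟩
  rw [Measure.map_apply (measurable_path x) (measurableSet_cyl T w)]
  have h2 := h.2 T w
  rw [cyl, h2]
  split_ifs with hw
  · obtain ⟨h0, hnn⟩ := hw
    have : ∀ t : ℕ, ∃ e : Stp d, t < T → w (t + 1) = w t + stp e := by
      intro t
      by_cases ht : t < T
      · obtain ⟨e, he⟩ := (isNN_iff _ _).mp (hnn t ht)
        exact ⟨e, fun _ => he⟩
      · exact ⟨(0, true), fun h => absurd h ht⟩
    choose e he using this
    have hset : path x ⁻¹' {ω | ∀ t ≤ T, ω t = w t} =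
        Set.pi (Finset.range T : Finset ℕ) (fun k => {e k}) := by
      ext u
      simp only [Set.mem_preimage, Set.mem_ofPred_eq, Set.mem_pi, Finset.mem_coe, Finset.mem_range,
        Set.mem_singleton_iff]
      constructor
      · intro hu k hk
        have h1 := hu (k + 1) hk
        rw [path_succ, hu k hk.le, he k hk] at h1
        exact stp_injective (add_left_cancel h1)
      · intro hu t
        induction t with
        | zero => intro _; rw [path_zero', h0]
        | succ t ih =>
          intro ht
          rw [path_succ, ih (by omega), hu t ht, he t ht]
    rw [hset, walkLaw, Measure.infinitePi_pi _ (fun i _ => measurableSet_singleton _)]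
    simp [stepLaw]
  · symm
    convert measure_empty (μ := walkLaw d)
    rw [Set.eq_empty_iff_forall_notMem]
    intro u hu
    simp only [Set.mem_preimage, Set.mem_ofPred_eq] at hu
    refine hw ⟨?_, fun t ht => ?_⟩
    · rw [← hu 0 (Nat.zero_le _), path_zero']
    · rw [isNN_iff, ← hu t ht.le, ← hu (t + 1) ht, path_succ]
      exact ⟨_, rfl⟩

/-! ### Kernel, Green function, equilibrium measure and last-exit decomposition -/

/-- Heat kernel. -/
def pk {d : ℕ} [NeZero d] (t : ℕ) (x y : Zd d) : ℝ≥0∞ := walkLaw d {u | path x u t = y}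

/-- Green function. -/
def gE {d : ℕ} [NeZero d] (x y : Zd d) : ℝ≥0∞ := ∑' t, pk t x y

/-- Escape probability. -/
def eE {d : ℕ} [NeZero d] (A : Set (Zd d)) (x : Zd d) : ℝ≥0∞ :=
  walkLaw d {u | ∀ t : ℕ, 0 < t → path x u t ∉ A}

/-- Capacity in `ℝ≥0∞`. -/
def capE {d : ℕ} [NeZero d] (A : Finset (Zd d)) : ℝ≥0∞ := ∑ x ∈ A, eE (↑A) x

lemma measurableSet_pathmem {d : ℕ} (x : Zd d) (t : ℕ) (A : Set (Zd d)) :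
    MeasurableSet {u | path x u t ∈ A} :=
  measurable_path_at x t (MeasurableSet.of_discrete (s := A))

lemma measurableSet_patheq {d : ℕ} (x : Zd d) (t : ℕ) (y : Zd d) :
    MeasurableSet {u | path x u t = y} := measurableSet_pathmem x t {y}

lemma measurableSet_noret {d : ℕ} (x : Zd d) (s : ℕ) (A : Set (Zd d)) :
    MeasurableSet {u | ∀ t : ℕ, 0 < t → path x u (s + t) ∉ A} := by
  have : {u | ∀ t : ℕ, 0 < t → path x u (s + t) ∉ A} =
      ⋂ (t : ℕ) (_ : 0 < t), {u | path x u (s + t) ∈ Aᶜ} := by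
    ext u; simp
  rw [this]
  exact MeasurableSet.iInter fun t => MeasurableSet.iInter fun _ => measurableSet_pathmem _ _ _

lemma lint_conc {d : ℕ} [NeZero d] (n : ℕ) {F : (ℕ → Stp d) → ℝ≥0∞} (hF : Measurable F) :
    ∫⁻ u, F u ∂(walkLaw d) = ∫⁻ v, ∫⁻ u, F (conc n (v, u)) ∂(walkLaw d) ∂(walkLaw d) := by
  rw [← (mp_conc d n).lintegral_comp hF,
    lintegral_prod (fun p => F (conc n p)) (hF.comp (measurable_conc n)).aemeasurable]

lemma meas_conc {d : ℕ} [NeZero d] (n : ℕ) {S : Set (ℕ → Stp d)} (hS : MeasurableSet S) :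
    walkLaw d S = ∫⁻ v, walkLaw d {u | conc n (v, u) ∈ S} ∂(walkLaw d) := by
  rw [← (mp_conc d n).measure_preimage hS.nullMeasurableSet,
    Measure.prod_apply (measurable_conc n hS)]
  rfl

lemma pk_add {d : ℕ} [NeZero d] (s t : ℕ) (x y : Zd d) :
    pk (s + t) x y = ∫⁻ v, pk t (path x v s) y ∂(walkLaw d) := by
  unfold pk
  rw [meas_conc s (measurableSet_patheq x (s + t) y)]
  refine lintegral_congr fun v => ?_
  congr 1
  ext u
  simp only [Set.mem_ofPred_eq, path_conc_add]

lemma path_translate {d : ℕ} (x z : Zd d) (u : ℕ → Stp d) (t : ℕ) :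
    path (x + z) u t = path x u t + z := path_add x z u t

lemma pk_translate {d : ℕ} [NeZero d] (t : ℕ) (x y z : Zd d) :
    pk t (x + z) (y + z) = pk t x y := by
  unfold pk; simp only [path_add, add_left_inj]

lemma gE_translate {d : ℕ} [NeZero d] (x y z : Zd d) : gE (x + z) (y + z) = gE x y := by
  unfold gE; simp only [pk_translate]

/-- Reversal of a step. -/
def flipS {d : ℕ} (e : Stp d) : Stp d := (e.1, !e.2)

lemma stp_flip {d : ℕ} (e : Stp d) : stp (flipS e) = - stp e := by
  unfold stp flipS
  rcases e with ⟨i, b⟩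
  cases b <;> simp [← Pi.single_neg]

lemma stepLaw_flip (d : ℕ) [NeZero d] : (stepLaw d).map flipS = stepLaw d := by
  refine Measure.ext_of_singleton fun e => ?_
  rw [Measure.map_apply Measurable.of_discrete (measurableSet_singleton e)]
  have : (flipS ⁻¹' {e} : Set (Stp d)) = {flipS e} := by
    ext ⟨i, b⟩
    rcases e with ⟨j, c⟩
    simp only [flipS, Set.mem_preimage, Set.mem_singleton_iff, Prod.mk.injEq]
    cases b <;> cases c <;> simp
  rw [this]
  simp [stepLaw]

lemma mp_flip (d : ℕ) [NeZero d] :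
    MeasurePreserving (fun (u : ℕ → Stp d) k => flipS (u k)) (walkLaw d) (walkLaw d) := by
  refine ⟨by
    refine measurable_pi_lambda _ fun k => ?_
    exact (Measurable.of_discrete (f := flipS)).comp (measurable_pi_apply k), ?_⟩
  unfold walkLaw
  rw [Measure.infinitePi_map_pi (fun _ => stepLaw d) (f := fun _ => flipS)
    (fun _ => Measurable.of_discrete)]
  simp only [stepLaw_flip]

lemma pk_symm {d : ℕ} [NeZero d] (t : ℕ) (x y : Zd d) : pk t x y = pk t y x := by
  unfold pk
  rw [← (mp_flip d).measure_preimage (measurableSet_patheq x t y).nullMeasurableSet]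
  congr 1
  ext u
  simp only [Set.mem_preimage, Set.mem_ofPred_eq, path, stp_flip, Finset.sum_neg_distrib]
  constructor <;> intro h
  · rw [← h]; abel
  · rw [← h]; abel

lemma gE_symm {d : ℕ} [NeZero d] (x y : Zd d) : gE x y = gE y x := by
  unfold gE; simp only [pk_symm _ x y]

lemma eE_le_one {d : ℕ} [NeZero d] (A : Set (Zd d)) (x : Zd d) : eE A x ≤ 1 := prob_le_one

lemma eE_anti {d : ℕ} [NeZero d] {A B : Set (Zd d)} (h : A ⊆ B) (x : Zd d) : eE B x ≤ eE A x :=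
  measure_mono fun _ hu t ht hA => hu t ht (h hA)

lemma capE_le_card {d : ℕ} [NeZero d] (A : Finset (Zd d)) : capE A ≤ A.card := by
  unfold capE
  calc ∑ x ∈ A, eE (↑A) x ≤ ∑ x ∈ A, 1 := Finset.sum_le_sum fun x _ => eE_le_one _ x
    _ = A.card := by simp

/-- The last-exit event. -/
def lastExit {d : ℕ} (A : Set (Zd d)) (y : Zd d) (t : ℕ) (x : Zd d) : Set (ℕ → Stp d) :=
  {u | path y u t = x} ∩ {u | ∀ k : ℕ, 0 < k → path y u (t + k) ∉ A}

lemma measurableSet_lastExit {d : ℕ} (A : Set (Zd d)) (y : Zd d) (t : ℕ) (x : Zd d) :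
    MeasurableSet (lastExit A y t x) :=
  (measurableSet_patheq y t x).inter (measurableSet_noret y t A)

lemma meas_lastExit {d : ℕ} [NeZero d] (A : Set (Zd d)) (y : Zd d) (t : ℕ) (x : Zd d) :
    walkLaw d (lastExit A y t x) = pk t y x * eE A x := by
  rw [meas_conc t (measurableSet_lastExit A y t x)]
  have : ∀ v, walkLaw d {u | conc t (v, u) ∈ lastExit A y t x} =
      {v | path y v t = x}.indicator (fun _ => eE A x) v := by
    intro v
    by_cases hv : path y v t = x
    · rw [Set.indicator_of_mem (by exact hv), eE]
      congr 1
      ext u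
      simp only [lastExit, Set.mem_inter_iff, Set.mem_ofPred_eq, path_conc_add,
        path_conc_le _ _ _ _ le_rfl, hv, true_and]
    · rw [Set.indicator_of_notMem (by exact hv)]
      convert measure_empty (μ := walkLaw d)
      rw [Set.eq_empty_iff_forall_notMem]
      intro u hu
      simp only [lastExit, Set.mem_inter_iff, Set.mem_ofPred_eq,
        path_conc_le _ _ _ _ le_rfl] at hu
      exact hv hu.1
  simp only [this]
  rw [lintegral_indicator (measurableSet_patheq y t x), setLIntegral_const, mul_comm]
  rfl

lemma lastExit_disjoint {d : ℕ} (A : Finset (Zd d)) (y : Zd d) :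
    Pairwise (Function.onFun Disjoint
      (fun p : ℕ × (A : Set (Zd d)) => lastExit (↑A) y p.1 (p.2 : Zd d))) := by
  rintro ⟨t, ⟨x, hx⟩⟩ ⟨t', ⟨x', hx'⟩⟩ hne
  rw [Function.onFun, Set.disjoint_left]
  rintro u ⟨h1, h2⟩ ⟨h3, h4⟩
  simp only [Set.mem_ofPred_eq] at h1 h2 h3 h4
  rcases lt_trichotomy t t' with h | h | h
  · refine h2 (t' - t) (by omega) ?_
    rw [Nat.add_sub_cancel' h.le, h3]; exact hx'
  · subst h
    apply hne
    simp only [Prod.mk.injEq, Subtype.mk.injEq, true_and]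
    rw [← h1, ← h3]
  · refine h4 (t - t') (by omega) ?_
    rw [Nat.add_sub_cancel' h.le, h1]; exact hx

lemma lastExit_sum {d : ℕ} [NeZero d] (A : Finset (Zd d)) (y : Zd d) :
    ∑ x ∈ A, gE y x * eE (↑A) x =
      walkLaw d (⋃ p : ℕ × (A : Set (Zd d)), lastExit (↑A) y p.1 (p.2 : Zd d)) := by
  rw [measure_iUnion (lastExit_disjoint A y) (fun p => measurableSet_lastExit _ _ _ _)]
  simp only [meas_lastExit]
  rw [ENNReal.tsum_prod (f := fun (t : ℕ) (x : (A : Set (Zd d))) => pk t y (x : Zd d) * eE (↑A) (x : Zd d)),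
    ENNReal.tsum_comm]
  simp only [ENNReal.tsum_mul_right]
  rw [Finset.tsum_subtype' A (fun x => (∑' t, pk t y x) * eE (↑A) x)]
  rfl

lemma lastExit_le_one {d : ℕ} [NeZero d] (A : Finset (Zd d)) (y : Zd d) :
    ∑ x ∈ A, gE y x * eE (↑A) x ≤ 1 := by
  rw [lastExit_sum]; exact prob_le_one

lemma lastExit_eq_one {d : ℕ} [NeZero d] (hg : ∀ x y : Zd d, gE x y ≠ ⊤)
    (A : Finset (Zd d)) {y : Zd d} (hy : y ∈ A) :
    ∑ x ∈ A, gE y x * eE (↑A) x = 1 := by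
  rw [lastExit_sum]
  refine le_antisymm prob_le_one ?_
  have hsum : ∑' t, walkLaw d {u | path y u t ∈ A} ≠ ⊤ := by
    have h1 : ∀ t, walkLaw d {u | path y u t ∈ A} ≤ ∑ x ∈ A, pk t y x := by
      intro t
      have : {u | path y u t ∈ A} ⊆ ⋃ x ∈ A, {u | path y u t = x} := by
        intro u hu
        simpa using hu
      exact (measure_mono this).trans (measure_biUnion_finset_le _ _)
    refine ne_top_of_le_ne_top ?_ (ENNReal.tsum_le_tsum h1)
    rw [Summable.tsum_finsetSum (fun _ _ => ENNReal.summable)]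
    exact (ENNReal.sum_lt_top.mpr fun x _ => (hg y x).lt_top).ne
  have h0 := measure_setOf_frequently_eq_zero hsum
  calc (1 : ℝ≥0∞) = walkLaw d Set.univ := measure_univ.symm
    _ ≤ walkLaw d ((⋃ p : ℕ × (A : Set (Zd d)), lastExit (↑A) y p.1 (p.2 : Zd d)) ∪
        {u | ∃ᶠ n in atTop, path y u n ∈ A}) := by
      refine measure_mono fun u _ => ?_
      by_cases hu : ∃ᶠ n in atTop, path y u n ∈ A
      · exact Or.inr hu
      · left
        rw [not_frequently, eventually_atTop] at hu
        obtain ⟨N, hN⟩ := hu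
        have hex : path y u 0 ∈ A := by rwa [path_zero']
        have hgs := Nat.findGreatest_spec (P := fun t => path y u t ∈ A) (Nat.zero_le N) hex
        set t := Nat.findGreatest (fun t => path y u t ∈ A) N with ht
        simp only [Set.mem_iUnion]
        refine ⟨(t, ⟨path y u t, hgs⟩), rfl, fun k hk hmem => ?_⟩
        by_cases hkN : t + k ≤ N
        · exact Nat.findGreatest_is_greatest (P := fun t => path y u t ∈ A)
            (show t < t + k by omega) hkN hmem
        · exact hN (t + k) (by omega) hmem
    _ ≤ _ := by
      refine (measure_union_le _ _).trans ?_
      rw [h0, add_zero]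

/-- Balayage. -/
lemma capE_balayage {d : ℕ} [NeZero d] (hg : ∀ x y : Zd d, gE x y ≠ ⊤)
    {A B : Finset (Zd d)} (h : A ⊆ B) :
    capE A = ∑ y ∈ B, eE (↑B) y * ∑ x ∈ A, gE y x * eE (↑A) x := by
  calc capE A = ∑ x ∈ A, eE (↑A) x * ∑ y ∈ B, gE x y * eE (↑B) y := by
        refine Finset.sum_congr rfl fun x hx => ?_
        rw [lastExit_eq_one hg B (h hx), mul_one]
    _ = _ := by
        simp only [Finset.mul_sum]
        rw [Finset.sum_comm]
        refine Finset.sum_congr rfl fun y _ => Finset.sum_congr rfl fun x _ => ?_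
        rw [gE_symm x y]; ring

lemma capE_mono {d : ℕ} [NeZero d] (hg : ∀ x y : Zd d, gE x y ≠ ⊤)
    {A B : Finset (Zd d)} (h : A ⊆ B) : capE A ≤ capE B := by
  rw [capE_balayage hg h]
  refine Finset.sum_le_sum fun y _ => ?_
  exact mul_le_of_le_one_right' (lastExit_le_one A y)

/-- Mutual energy. -/
def IE {d : ℕ} [NeZero d] (A B : Finset (Zd d)) : ℝ≥0∞ :=
  ∑ x ∈ A, ∑ y ∈ B, eE (↑A) x * (gE x y * eE (↑B) y)

lemma IE_symm {d : ℕ} [NeZero d] (A B : Finset (Zd d)) : IE A B = IE B A := by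
  unfold IE
  rw [Finset.sum_comm]
  refine Finset.sum_congr rfl fun y _ => Finset.sum_congr rfl fun x _ => ?_
  rw [gE_symm x y]; ring

lemma IE_le_capE {d : ℕ} [NeZero d] (A B : Finset (Zd d)) : IE A B ≤ capE A := by
  unfold IE capE
  refine Finset.sum_le_sum fun x _ => ?_
  rw [← Finset.mul_sum]
  exact mul_le_of_le_one_right' (lastExit_le_one B x)

/-- Approximate superadditivity of the capacity. -/
lemma capE_super {d : ℕ} [NeZero d] (hg : ∀ x y : Zd d, gE x y ≠ ⊤) (K : ℕ)
    (B : ℕ → Finset (Zd d)) :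
    ∑ i ∈ Finset.range K, capE (B i) ≤ capE ((Finset.range K).biUnion B) +
      ∑ j ∈ Finset.range K, ∑ i ∈ (Finset.range K).erase j, IE (B j) (B i) := by
  set A := (Finset.range K).biUnion B with hA
  have hsub : ∀ i ∈ Finset.range K, B i ⊆ A := fun i hi => Finset.subset_biUnion_of_mem B hi
  have hex : ∀ y : Zd d, ∃ j, y ∈ A → j ∈ Finset.range K ∧ y ∈ B j := by
    intro y
    by_cases hy : y ∈ A
    · obtain ⟨j, hj, hyj⟩ := Finset.mem_biUnion.mp hy
      exact ⟨j, fun _ => ⟨hj, hyj⟩⟩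
    · exact ⟨0, fun h => absurd h hy⟩
  choose J hJ using hex
  set h : ℕ → Zd d → ℝ≥0∞ := fun i y => ∑ x ∈ B i, gE y x * eE (↑(B i)) x with hh
  calc ∑ i ∈ Finset.range K, capE (B i)
      = ∑ y ∈ A, eE (↑A) y * ∑ i ∈ Finset.range K, h i y := by
        rw [Finset.sum_congr rfl fun i hi => capE_balayage hg (hsub i hi), Finset.sum_comm]
        simp only [Finset.mul_sum, hh]
    _ ≤ ∑ y ∈ A, (eE (↑A) y + eE (↑A) y * ∑ i ∈ (Finset.range K).erase (J y), h i y) := by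
        refine Finset.sum_le_sum fun y hy => ?_
        rw [← Finset.add_sum_erase _ _ (hJ y hy).1, mul_add]
        gcongr
        exact mul_le_of_le_one_right' (lastExit_le_one _ y)
    _ = capE A + ∑ y ∈ A, eE (↑A) y * ∑ i ∈ (Finset.range K).erase (J y), h i y := by
        rw [Finset.sum_add_distrib]; rfl
    _ ≤ capE A + ∑ y ∈ A, ∑ j ∈ Finset.range K, if y ∈ B j then
          eE (↑(B j)) y * ∑ i ∈ (Finset.range K).erase j, h i y else 0 := by
        gcongr with y hy
        refine le_trans ?_ (Finset.single_le_sum (fun _ _ => zero_le) (hJ y hy).1)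
        rw [if_pos (hJ y hy).2]
        gcongr
        exact eE_anti (by exact_mod_cast hsub _ (hJ y hy).1) y
    _ = _ := by
        congr 1
        rw [Finset.sum_comm]
        refine Finset.sum_congr rfl fun j hj => ?_
        rw [← Finset.sum_filter, Finset.filter_mem_eq_inter, Finset.inter_eq_right.mpr (hsub j hj)]
        simp only [IE, hh, Finset.mul_sum]
        rw [Finset.sum_comm]

lemma eE_translate {d : ℕ} [NeZero d] (A : Finset (Zd d)) (x z : Zd d) :
    eE (↑(A.image (· + z))) (x + z) = eE (↑A) x := by
  unfold eE
  congr 1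
  ext u
  simp only [Set.mem_ofPred_eq, path_add, Finset.coe_image, Set.mem_image, Finset.mem_coe,
    add_left_inj, exists_eq_right]

lemma capE_translate {d : ℕ} [NeZero d] (A : Finset (Zd d)) (z : Zd d) :
    capE (A.image (· + z)) = capE A := by
  conv_lhs => unfold capE
  rw [Finset.sum_image (fun a _ b _ h => add_right_cancel h)]
  exact Finset.sum_congr rfl fun x _ => eE_translate A x z

/-! ### Expectations over the range -/

/-- The discrete measurable structure on finite sets of points. -/
instance instMSFinsetZd (d : ℕ) : MeasurableSpace (Finset (Zd d)) := ⊤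

instance instDMSFinsetZd (d : ℕ) : DiscreteMeasurableSpace (Finset (Zd d)) :=
  ⟨fun _ => MeasurableSpace.measurableSet_top⟩

lemma measurable_walkRange {d : ℕ} (a b : ℕ) :
    Measurable (fun ω : ℕ → Zd d => walkRange ω a b) := by
  refine measurable_to_countable' fun s => ?_
  have : (fun ω : ℕ → Zd d => walkRange ω a b) ⁻¹' {s} =
      (⋂ t ∈ Finset.Icc a b, (fun ω : ℕ → Zd d => ω t) ⁻¹' (↑s)) ∩
      (⋂ z ∈ s, ⋃ t ∈ Finset.Icc a b, (fun ω : ℕ → Zd d => ω t) ⁻¹' {z}) := by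
    ext ω
    simp only [Set.mem_preimage, Set.mem_singleton_iff, Set.mem_inter_iff, Set.mem_iInter,
      Set.mem_iUnion, walkRange, Finset.mem_coe, exists_prop]
    constructor
    · rintro rfl
      exact ⟨fun t ht => Finset.mem_image_of_mem _ ht, fun z hz => Finset.mem_image.mp hz⟩
    · rintro ⟨h1, h2⟩
      ext z
      rw [Finset.mem_image]
      constructor
      · rintro ⟨t, ht, rfl⟩
        exact h1 t ht
      · exact h2 z
  rw [this]
  refine MeasurableSet.inter ?_ ?_
  · exact Finset.measurableSet_biInter _ fun t _ =>
      measurable_pi_apply t (MeasurableSet.of_discrete)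
  · exact Finset.measurableSet_biInter _ fun z _ => Finset.measurableSet_biUnion _ fun t _ =>
      measurable_pi_apply t (MeasurableSet.of_discrete)

/-- The range of the path started at `x`. -/
def wr {d : ℕ} (x : Zd d) (u : ℕ → Stp d) (a b : ℕ) : Finset (Zd d) := walkRange (path x u) a b

lemma measurable_wr {d : ℕ} (x : Zd d) (a b : ℕ) : Measurable (fun u => wr x u a b) :=
  (measurable_walkRange a b).comp (measurable_path x)

lemma wr_conc_le {d : ℕ} (x : Zd d) (n : ℕ) (v u : ℕ → Stp d) {a b : ℕ} (hb : b ≤ n) :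
    wr x (conc n (v, u)) a b = wr x v a b := by
  unfold wr walkRange
  refine Finset.image_congr fun t ht => ?_
  exact path_conc_le x n v u ((Finset.mem_Icc.mp ht).2.trans hb)

lemma wr_conc_add {d : ℕ} (x : Zd d) (n : ℕ) (v u : ℕ → Stp d) (a b : ℕ) :
    wr x (conc n (v, u)) (n + a) (n + b) = wr (path x v n) u a b := by
  unfold wr walkRange
  ext z
  simp only [Finset.mem_image, Finset.mem_Icc]
  constructor
  · rintro ⟨t, ⟨h1, h2⟩, rfl⟩
    refine ⟨t - n, ⟨by omega, by omega⟩, ?_⟩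
    rw [← path_conc_add, Nat.add_sub_cancel' (by omega)]
  · rintro ⟨t, ⟨h1, h2⟩, rfl⟩
    exact ⟨n + t, ⟨by omega, by omega⟩, path_conc_add _ _ _ _ _⟩

lemma wr_translate {d : ℕ} (x z : Zd d) (u : ℕ → Stp d) (a b : ℕ) :
    wr (x + z) u a b = (wr x u a b).image (· + z) := by
  unfold wr walkRange
  rw [Finset.image_image]
  refine Finset.image_congr fun t _ => ?_
  exact path_add x z u t

lemma wr_eq_image {d : ℕ} (z : Zd d) (u : ℕ → Stp d) (a b : ℕ) :
    wr z u a b = (wr 0 u a b).image (· + z) := by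
  rw [← wr_translate, zero_add]

lemma card_wr_le {d : ℕ} (x : Zd d) (u : ℕ → Stp d) (a m : ℕ) :
    (wr x u a (a + m)).card ≤ m + 1 := by
  refine Finset.card_image_le.trans ?_
  simp only [Nat.card_Icc]; omega

/-- Expected capacity of the range. -/
def expE (d : ℕ) [NeZero d] (m : ℕ) : ℝ≥0∞ := ∫⁻ u, capE (wr (0 : Zd d) u 0 m) ∂(walkLaw d)

lemma capE_wr {d : ℕ} [NeZero d] (x : Zd d) (u : ℕ → Stp d) (a b : ℕ) :
    capE (wr x u a b) = capE (wr 0 u a b) := by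
  rw [wr_eq_image, capE_translate]

lemma lint_block {d : ℕ} [NeZero d] (x : Zd d) (a m : ℕ) :
    ∫⁻ u, capE (wr x u a (a + m)) ∂(walkLaw d) = expE d m := by
  have hmeas : Measurable (fun u => capE (wr x u a (a + m))) :=
    (Measurable.of_discrete (f := capE)).comp (measurable_wr x a (a + m))
  rw [lint_conc a hmeas]
  have : ∀ v u, capE (wr x (conc a (v, u)) a (a + m)) = capE (wr 0 u 0 m) := by
    intro v u
    have := wr_conc_add x a v u 0 m
    rw [add_zero] at this
    rw [this, capE_wr]
  simp only [this, lintegral_const, measure_univ, mul_one]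
  rfl

lemma expE_le {d : ℕ} [NeZero d] (m : ℕ) : expE d m ≤ m + 1 := by
  calc expE d m ≤ ∫⁻ _, ((m : ℝ≥0∞) + 1) ∂(walkLaw d) := by
        refine lintegral_mono fun u => (capE_le_card _).trans ?_
        have := card_wr_le (0 : Zd d) u 0 m
        rw [zero_add] at this
        exact_mod_cast this
    _ = m + 1 := by simp

lemma lint_gE {d : ℕ} [NeZero d] {G : ℕ → ℝ≥0∞}
    (hG : ∀ n (x y : Zd d), ∑' t, pk (n + t) x y ≤ G n) (n : ℕ) (x z : Zd d) :
    ∫⁻ v, gE x (path z v n) ∂(walkLaw d) ≤ G n := by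
  refine le_trans (le_of_eq ?_) (hG n z x)
  simp only [gE_symm x]
  unfold gE
  rw [lintegral_tsum]
  · simp only [pk_add]
  · intro t
    exact ((Measurable.of_discrete (f := fun w => pk t w x)).comp
      (measurable_path_at z n)).aemeasurable

/-- Expected mutual energy of separated pieces, inner estimate. -/
lemma lint_IE_inner {d : ℕ} [NeZero d] {G : ℕ → ℝ≥0∞}
    (hG : ∀ n (x y : Zd d), ∑' t, pk (n + t) x y ≤ G n) (m n : ℕ) (z : Zd d)
    (A : Finset (Zd d)) :
    ∫⁻ u, IE A (wr z u n (n + m)) ∂(walkLaw d) ≤ capE A * (expE d m * G n) := by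
  have hmeas : Measurable (fun u => IE A (wr z u n (n + m))) :=
    (Measurable.of_discrete (f := IE A)).comp (measurable_wr z n (n + m))
  rw [lint_conc n hmeas]
  have h1 : ∀ v u, IE A (wr z (conc n (v, u)) n (n + m)) =
      ∑ x ∈ A, eE (↑A) x *
        ∑ y ∈ wr 0 u 0 m, eE (↑(wr 0 u 0 m)) y * gE x (path (y + z) v n) := by
    intro v u
    have := wr_conc_add z n v u 0 m
    rw [add_zero] at this
    rw [this, wr_eq_image, IE]
    refine Finset.sum_congr rfl fun x _ => ?_
    rw [Finset.sum_image (fun a _ b _ h => add_right_cancel h), Finset.mul_sum]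
    refine Finset.sum_congr rfl fun y _ => ?_
    rw [eE_translate, mul_comm (gE _ _), add_comm y z, path_add, add_comm y]
  simp only [h1]
  rw [lintegral_lintegral_swap]
  · have hm1 : ∀ (x y : Zd d) , Measurable (fun v => gE x (path (y + z) v n)) := fun x y =>
      (Measurable.of_discrete (f := gE x)).comp (measurable_path_at (y + z) n)
    calc ∫⁻ u, ∫⁻ v, ∑ x ∈ A, eE (↑A) x *
        ∑ y ∈ wr 0 u 0 m, eE (↑(wr 0 u 0 m)) y * gE x (path (y + z) v n) ∂(walkLaw d) ∂(walkLaw d)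
        ≤ ∫⁻ u, capE A * (capE (wr (0 : Zd d) u 0 m) * G n) ∂(walkLaw d) := by
          refine lintegral_mono fun u => ?_
          rw [lintegral_finset_sum _ (fun x _ => (Finset.measurable_sum _ fun y _ =>
            (hm1 x y).const_mul _).const_mul _)]
          simp only [capE, Finset.sum_mul]
          refine Finset.sum_le_sum fun x _ => ?_
          rw [lintegral_const_mul _ (Finset.measurable_sum _ fun y _ => (hm1 x y).const_mul _)]
          gcongr
          rw [lintegral_finset_sum _ (fun y _ => (hm1 x y).const_mul _)]
          refine Finset.sum_le_sum fun y _ => ?_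
          rw [lintegral_const_mul _ (hm1 x y)]
          gcongr
          exact lint_gE hG n x (y + z)
      _ = capE A * (expE d m * G n) := by
          have hm2 : Measurable (fun u => capE (wr (0 : Zd d) u 0 m)) :=
            (Measurable.of_discrete (f := capE)).comp (measurable_wr 0 0 m)
          rw [lintegral_const_mul _ (hm2.mul_const _), lintegral_mul_const _ hm2]
          rfl
  · have hpair : Measurable (fun p : (ℕ → Stp d) × (ℕ → Stp d) =>
        (wr (0 : Zd d) p.2 0 m, path (0 : Zd d) p.1 n)) :=
      ((measurable_wr 0 0 m).comp measurable_snd).prodMk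
        ((measurable_path_at 0 n).comp measurable_fst)
    have h2 : Measurable (fun p : (ℕ → Stp d) × (ℕ → Stp d) =>
      (fun q : Finset (Zd d) × Zd d => ∑ x ∈ A, eE (↑A) x *
        ∑ y ∈ q.1, eE (↑q.1) y * gE x (q.2 + (y + z)))
          (wr (0 : Zd d) p.2 0 m, path (0 : Zd d) p.1 n)) :=
      (Measurable.of_discrete (f := fun q : Finset (Zd d) × Zd d => ∑ x ∈ A, eE (↑A) x *
        ∑ y ∈ q.1, eE (↑q.1) y * gE x (q.2 + (y + z)))).comp hpair
    have h3 : (Function.uncurry fun v u => ∑ x ∈ A, eE (↑A) x *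
        ∑ y ∈ wr 0 u 0 m, eE (↑(wr 0 u 0 m)) y * gE x (path (y + z) v n)) =
        (fun p : (ℕ → Stp d) × (ℕ → Stp d) =>
      (fun q : Finset (Zd d) × Zd d => ∑ x ∈ A, eE (↑A) x *
        ∑ y ∈ q.1, eE (↑q.1) y * gE x (q.2 + (y + z)))
          (wr (0 : Zd d) p.2 0 m, path (0 : Zd d) p.1 n)) := by
      funext p
      refine Finset.sum_congr rfl fun x _ => ?_
      refine congrArg (eE (↑A) x * ·) (Finset.sum_congr rfl fun y _ => ?_)
      rw [← path_add, zero_add]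
    rw [h3]
    exact h2.aemeasurable

lemma measurable_disc2 {Ω α β γ : Type*} [MeasurableSpace Ω] [MeasurableSpace α]
    [MeasurableSpace β] [MeasurableSpace γ] [Countable α] [Countable β]
    [MeasurableSingletonClass α] [MeasurableSingletonClass β]
    (F : α → β → γ) {f : Ω → α} {g : Ω → β} (hf : Measurable f) (hg : Measurable g) :
    Measurable (fun u => F (f u) (g u)) := by
  have h : Measurable (fun q : α × β => F q.1 q.2) := measurable_of_countable _
  exact h.comp (hf.prodMk hg)

lemma lint_IE {d : ℕ} [NeZero d] {G : ℕ → ℝ≥0∞}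
    (hG : ∀ n (x y : Zd d), ∑' t, pk (n + t) x y ≤ G n) (s m n : ℕ) (x : Zd d) :
    ∫⁻ u, IE (wr x u s (s + m)) (wr x u (s + m + n) (s + m + n + m)) ∂(walkLaw d) ≤
      expE d m * (expE d m * G n) := by
  have hmeas : Measurable (fun u => IE (wr x u s (s + m)) (wr x u (s + m + n) (s + m + n + m))) :=
    measurable_disc2 IE (measurable_wr x _ _) (measurable_wr x _ _)
  rw [lint_conc (s + m) hmeas]
  calc _ ≤ ∫⁻ v, capE (wr x v s (s + m)) * (expE d m * G n) ∂(walkLaw d) := by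
        refine lintegral_mono fun v => ?_
        have : ∀ u, IE (wr x (conc (s + m) (v, u)) s (s + m))
            (wr x (conc (s + m) (v, u)) (s + m + n) (s + m + n + m)) =
            IE (wr x v s (s + m)) (wr (path x v (s + m)) u n (n + m)) := by
          intro u
          rw [wr_conc_le _ _ _ _ le_rfl, add_assoc (s + m) n m, wr_conc_add]
        simp only [this]
        exact lint_IE_inner hG m n _ _
    _ = _ := by
        have hmc : Measurable (fun v => capE (wr x v s (s + m))) :=
          (Measurable.of_discrete (f := capE)).comp (measurable_wr x s (s + m))
        rw [lintegral_mul_const _ hmc, lint_block]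

lemma IE_biUnion_left {d : ℕ} [NeZero d] (S : Finset ℕ) (C : ℕ → Finset (Zd d))
    (B : Finset (Zd d)) : IE (S.biUnion C) B ≤ ∑ a ∈ S, IE (C a) B := by
  have hex : ∀ y : Zd d, ∃ j, y ∈ S.biUnion C → j ∈ S ∧ y ∈ C j := by
    intro y
    by_cases hy : y ∈ S.biUnion C
    · obtain ⟨j, hj, hyj⟩ := Finset.mem_biUnion.mp hy
      exact ⟨j, fun _ => ⟨hj, hyj⟩⟩
    · exact ⟨0, fun h => absurd h hy⟩
  choose J hJ using hex
  set A := S.biUnion C with hA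
  set F : Zd d → ℝ≥0∞ := fun x => ∑ y ∈ B, gE x y * eE (↑B) y with hF
  calc IE A B = ∑ x ∈ A, eE (↑A) x * F x := by
        simp only [IE, hF, Finset.mul_sum]
    _ ≤ ∑ x ∈ A, ∑ a ∈ S, if x ∈ C a then eE (↑(C a)) x * F x else 0 := by
        refine Finset.sum_le_sum fun x hx => ?_
        refine le_trans ?_ (Finset.single_le_sum (fun _ _ => zero_le) (hJ x hx).1)
        rw [if_pos (hJ x hx).2]
        gcongr
        exact eE_anti (by exact_mod_cast Finset.subset_biUnion_of_mem C (hJ x hx).1) x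
    _ = ∑ a ∈ S, IE (C a) B := by
        rw [Finset.sum_comm]
        refine Finset.sum_congr rfl fun a ha => ?_
        rw [← Finset.sum_filter, Finset.filter_mem_eq_inter,
          Finset.inter_eq_right.mpr (Finset.subset_biUnion_of_mem C ha)]
        simp only [IE, hF, Finset.mul_sum]

lemma IE_biUnion {d : ℕ} [NeZero d] (S S' : Finset ℕ) (C : ℕ → Finset (Zd d)) :
    IE (S.biUnion C) (S'.biUnion C) ≤ ∑ a ∈ S, ∑ b ∈ S', IE (C a) (C b) := by
  refine (IE_biUnion_left S C _).trans (Finset.sum_le_sum fun a _ => ?_)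
  rw [IE_symm]
  refine (IE_biUnion_left S' C _).trans (Finset.sum_le_sum fun b _ => ?_)
  rw [IE_symm]

/-! ### Heat kernel bounds -/

lemma path_one {d : ℕ} (x : Zd d) (u : ℕ → Stp d) : path x u 1 = x + stp (u 0) := by
  have := path_succ x u 0
  rw [path_zero'] at this
  simpa using this

lemma lint_first {d : ℕ} [NeZero d] (F : Stp d → ℝ≥0∞) :
    ∫⁻ u, F (u 0) ∂(walkLaw d) = ((2 * d : ℕ) : ℝ≥0∞)⁻¹ * ∑ e, F e := by
  have h := (measurePreserving_eval_infinitePi (fun _ : ℕ => stepLaw d) 0).lintegral_comp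
    (measurable_of_countable F)
  unfold walkLaw
  rw [show ∫⁻ u, F (u 0) ∂(Measure.infinitePi fun _ : ℕ => stepLaw d) = ∫⁻ e, F e ∂(stepLaw d)
    from h]
  unfold stepLaw
  rw [lintegral_smul_measure, lintegral_count, tsum_fintype, smul_eq_mul]

lemma pk_succ {d : ℕ} [NeZero d] (t : ℕ) (x y : Zd d) :
    pk (t + 1) x y = ((2 * d : ℕ) : ℝ≥0∞)⁻¹ * ∑ e, pk t (x + stp e) y := by
  rw [add_comm, pk_add]
  simp only [path_one]
  exact lint_first (fun e => pk t (x + stp e) y)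

lemma pk_zero {d : ℕ} [NeZero d] (x y : Zd d) : pk 0 x y = if x = y then 1 else 0 := by
  unfold pk
  simp only [path_zero']
  split_ifs with h <;> simp [h]

lemma pk_le_one {d : ℕ} [NeZero d] (t : ℕ) (x y : Zd d) : pk t x y ≤ 1 := prob_le_one

/-- One-dimensional simple random walk probabilities. -/
def bw : ℕ → ℤ → ℝ
  | 0, k => if k = 0 then 1 else 0
  | n + 1, k => (bw n (k - 1) + bw n (k + 1)) / 2

lemma bw_formula (n : ℕ) : (∀ j : ℕ, bw n (2 * j - n) * 2 ^ n = n.choose j) ∧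
    ∀ k : ℤ, (∀ j : ℕ, k ≠ 2 * j - n) → bw n k = 0 := by
  induction n with
  | zero =>
    refine ⟨fun j => ?_, fun k hk => ?_⟩
    · rcases j with _ | j
      · simp [bw]
      · have : (2 * ((j : ℤ) + 1)) ≠ 0 := by omega
        simp [bw]; omega
    · have := hk 0
      simp at this
      simp [bw, this]
  | succ n ih =>
    refine ⟨fun j => ?_, fun k hk => ?_⟩
    · rcases j with _ | j
      · have h1 : bw n (2 * ((0 : ℕ) : ℤ) - ((n + 1 : ℕ) : ℤ) - 1) = 0 :=
          ih.2 _ fun j => by push_cast; omega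
        have h2 := ih.1 0
        have h3 : 2 * ((0 : ℕ) : ℤ) - ((n + 1 : ℕ) : ℤ) + 1 = 2 * ((0 : ℕ) : ℤ) - n := by
          push_cast; ring
        simp only [bw, h1, h3, Nat.choose_zero_right] at h2 ⊢
        rw [pow_succ, ← h2]
        ring
      · have h1 := ih.1 j
        have h2 := ih.1 (j + 1)
        have e1 : 2 * ((j + 1 : ℕ) : ℤ) - ((n + 1 : ℕ) : ℤ) - 1 = 2 * (j : ℤ) - n := by
          push_cast; ring
        have e2 : 2 * ((j + 1 : ℕ) : ℤ) - ((n + 1 : ℕ) : ℤ) + 1 = 2 * ((j + 1 : ℕ) : ℤ) - n := by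
          push_cast; ring
        simp only [bw, e1, e2]
        rw [Nat.choose_succ_succ', Nat.cast_add (n.choose j), ← h1, ← h2, pow_succ]
        ring
    · have h1 : bw n (k - 1) = 0 := ih.2 _ fun j hj => hk (j + 1) (by push_cast; omega)
      have h2 : bw n (k + 1) = 0 := ih.2 _ fun j hj => hk j (by push_cast; omega)
      simp [bw, h1, h2]

lemma bw_nonneg (n : ℕ) (k : ℤ) : 0 ≤ bw n k := by
  induction n generalizing k with
  | zero => simp only [bw]; split_ifs <;> norm_num
  | succ n ih => simp only [bw]; have := ih (k - 1); have := ih (k + 1); positivity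

lemma centralBinom_bound (m : ℕ) :
    ((m.centralBinom : ℝ)) ^ 2 * (2 * m + 1) ≤ (4 ^ m) ^ 2 := by
  induction m with
  | zero => simp
  | succ m ih =>
    have h : ((m : ℝ) + 1) * ((m + 1).centralBinom : ℝ) = 2 * (2 * m + 1) * m.centralBinom := by
      exact_mod_cast Nat.succ_mul_centralBinom_succ m
    have h1 : (((m + 1).centralBinom : ℝ)) ^ 2 * ((m : ℝ) + 1) ^ 2 =
        4 * (2 * m + 1) * ((m.centralBinom : ℝ) ^ 2 * (2 * m + 1)) := by
      rw [← mul_pow, mul_comm ((m + 1).centralBinom : ℝ), h]; ring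
    have hp : (0 : ℝ) < ((m : ℝ) + 1) ^ 2 := by positivity
    rw [← mul_le_mul_iff_left₀ hp]
    calc (((m + 1).centralBinom : ℝ)) ^ 2 * (2 * ((m + 1 : ℕ) : ℝ) + 1) * ((m : ℝ) + 1) ^ 2
        = (2 * (m : ℝ) + 3) * ((((m + 1).centralBinom : ℝ)) ^ 2 * ((m : ℝ) + 1) ^ 2) := by
          push_cast; ring
      _ = (2 * (m : ℝ) + 3) * (4 * (2 * m + 1)) * ((m.centralBinom : ℝ) ^ 2 * (2 * m + 1)) := by
          rw [h1]; ring
      _ ≤ (16 * ((m : ℝ) + 1) ^ 2) * (4 ^ m) ^ 2 := by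
          refine mul_le_mul ?_ ih (by positivity) (by positivity)
          nlinarith
      _ = (4 ^ (m + 1)) ^ 2 * ((m : ℝ) + 1) ^ 2 := by ring

lemma bw_le (n : ℕ) (k : ℤ) : bw n k ≤ (Real.sqrt (n + 1))⁻¹ := by
  have key : bw n k * 2 ^ n ≤ (n.choose (n / 2) : ℕ) := by
    by_cases h : ∃ j : ℕ, k = 2 * j - n
    · obtain ⟨j, rfl⟩ := h
      rw [(bw_formula n).1 j]
      exact_mod_cast Nat.choose_le_middle j n
    · push Not at h
      rw [(bw_formula n).2 k h]
      simp
  have key2 : ((n.choose (n / 2) : ℕ) : ℝ) ^ 2 * (n + 1) ≤ (2 ^ n) ^ 2 := by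
    rcases Nat.even_or_odd' n with ⟨m, rfl | rfl⟩
    · have := centralBinom_bound m
      rw [Nat.mul_div_cancel_left _ two_pos]
      unfold Nat.centralBinom at this
      rw [pow_mul]
      push_cast
      norm_num at this ⊢
      exact this
    · have := centralBinom_bound (m + 1)
      have h2 : (2 * m + 1) / 2 = m := by omega
      have h3 : (m + 1).centralBinom = 2 * (2 * m + 1).choose m := by
        rw [Nat.centralBinom, show 2 * (m + 1) = (2 * m + 1) + 1 by ring, Nat.choose_succ_succ,
          Nat.succ_eq_add_one]
        have : (2 * m + 1).choose (m + 1) = (2 * m + 1).choose m := by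
          rw [← Nat.choose_symm_of_eq_add]; ring
        omega
      rw [h2]
      rw [h3] at this
      push_cast at this ⊢
      have e : ((4 : ℝ) ^ (m + 1)) ^ 2 = 4 * (2 ^ (2 * m + 1)) ^ 2 := by
        rw [pow_succ 2 (2 * m), pow_mul, pow_succ]; norm_num; ring
      rw [e] at this
      have hc : (0 : ℝ) ≤ ((2 * m + 1).choose m : ℝ) ^ 2 := by positivity
      nlinarith
  have hs : 0 < Real.sqrt (n + 1) := Real.sqrt_pos.mpr (by positivity)
  rw [← one_div, le_div_iff₀ hs]
  have hb := bw_nonneg n k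
  have h2 : (0 : ℝ) < 2 ^ n := by positivity
  refine (pow_le_one_iff_of_nonneg (by positivity) two_ne_zero).mp ?_
  rw [mul_pow, Real.sq_sqrt (by positivity)]
  have h3 : (bw n k * 2 ^ n) ^ 2 * (n + 1) ≤ (2 ^ n) ^ 2 :=
    le_trans (by gcongr) key2
  have h4 : (0 : ℝ) < (2 ^ n) ^ 2 := by positivity
  rw [← mul_le_mul_iff_left₀ h4]
  calc _ = (bw n k * 2 ^ n) ^ 2 * (n + 1) := by ring
    _ ≤ _ := by rw [one_mul]; exact h3

/-- Averaging operator over coordinate choices. -/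
def Av {d : ℕ} : ℕ → ((Fin d → ℕ) → ℝ) → (Fin d → ℕ) → ℝ
  | 0, F => F
  | t + 1, F => Av t (fun n => (d : ℝ)⁻¹ * ∑ i, F (n + Pi.single i 1))

lemma Av_le {d : ℕ} (t : ℕ) (s : ℕ) (F H : (Fin d → ℕ) → ℝ)
    (h : ∀ n, ∑ i, n i = s + t → F n ≤ H n) (n : Fin d → ℕ) (hn : ∑ i, n i = s) :
    Av t F n ≤ Av t H n := by
  induction t generalizing F H with
  | zero => exact h n hn
  | succ t ih =>
    refine ih _ _ fun k hk => ?_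
    gcongr with i
    refine h _ ?_
    simp only [Pi.add_apply, Finset.sum_add_distrib, Finset.sum_pi_single', hk]
    simp [add_assoc]

lemma Av_smul {d : ℕ} (t : ℕ) (c : ℝ) (F : (Fin d → ℕ) → ℝ) (n : Fin d → ℕ) :
    Av t (fun k => c * F k) n = c * Av t F n := by
  induction t generalizing F with
  | zero => rfl
  | succ t ih =>
    simp only [Av]
    rw [← ih]
    congr 1
    funext k
    rw [← Finset.mul_sum]; ring

lemma Av_sum {d : ℕ} {ι : Type*} (S : Finset ι) (t : ℕ) (F : ι → (Fin d → ℕ) → ℝ)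
    (n : Fin d → ℕ) :
    Av t (fun k => ∑ e ∈ S, F e k) n = ∑ e ∈ S, Av t (F e) n := by
  induction t generalizing F with
  | zero => rfl
  | succ t ih =>
    simp only [Av]
    rw [← ih]
    congr 1
    funext k
    rw [Finset.sum_comm, Finset.mul_sum]

lemma prod_step {d : ℕ} (n : Fin d → ℕ) (x : Zd d) (i : Fin d) :
    ∏ j, bw ((n + Pi.single i 1 : Fin d → ℕ) j) (x j) =
      2⁻¹ * ∑ s : Bool, ∏ j, bw (n j) ((x + stp (i, s)) j) := by
  have h : ∀ (f g : Fin d → ℝ), (∀ j, j ≠ i → f j = g j) →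
      ∏ j, f j = f i * ∏ j ∈ Finset.univ.erase i, g j := by
    intro f g hfg
    rw [← Finset.mul_prod_erase _ _ (Finset.mem_univ i)]
    congr 1
    exact Finset.prod_congr rfl fun j hj => hfg j (Finset.ne_of_mem_erase hj)
  rw [h _ (fun j => bw (n j) (x j)) (fun j hj => by simp [hj]), Fintype.sum_bool,
    h _ (fun j => bw (n j) (x j)) (fun j hj => by simp [stp, hj]),
    h (fun j => bw (n j) ((x + stp (i, false)) j)) (fun j => bw (n j) (x j))
      (fun j hj => by simp [stp, hj])]
  simp [stp, bw]
  ring_nf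

lemma pk_eq_Av {d : ℕ} [NeZero d] (t : ℕ) (x : Zd d) :
    (pk t x 0).toReal = Av t (fun n => ∏ i, bw (n i) (x i)) 0 := by
  induction t generalizing x with
  | zero =>
    rw [pk_zero]
    simp only [Av, Pi.zero_apply, bw]
    split_ifs with h
    · simp [h]
    · obtain ⟨i, hi⟩ := Function.ne_iff.mp h
      rw [Finset.prod_eq_zero (Finset.mem_univ i)]
      · simp
      · simpa using hi
  | succ t ih =>
    rw [pk_succ, ENNReal.toReal_mul, ENNReal.toReal_sum
      (fun e _ => ne_top_of_le_ne_top ENNReal.one_ne_top (pk_le_one _ _ _))]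
    simp only [ih]
    rw [← Av_sum, ← Av_smul]
    simp only [Av]
    congr 1
    funext n
    simp only [prod_step, ← Finset.mul_sum]
    rw [Fintype.sum_prod_type]
    simp
    ring

/-- Weight dominating the product of one-dimensional heat kernels. -/
def Wt {d : ℕ} (n : Fin d → ℕ) : ℝ := ∏ i, (Real.sqrt ((n i : ℝ) + 1))⁻¹

lemma Wt_nonneg {d : ℕ} (n : Fin d → ℕ) : 0 ≤ Wt n :=
  Finset.prod_nonneg fun i _ => inv_nonneg.mpr (Real.sqrt_nonneg _)

lemma sqrt_ratio (a : ℝ) (ha : 0 ≤ a) :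
    (Real.sqrt (a + 1 + 1))⁻¹ ≤ (1 - 1 / (2 * (a + 2))) * (Real.sqrt (a + 1))⁻¹ := by
  have h1 : 0 < Real.sqrt (a + 1) := Real.sqrt_pos.mpr (by linarith)
  have h2 : 0 < Real.sqrt (a + 1 + 1) := Real.sqrt_pos.mpr (by linarith)
  rw [← div_eq_mul_inv, le_div_iff₀ h1, inv_mul_le_iff₀ h2]
  have h3 : 0 ≤ 1 - 1 / (2 * (a + 2)) := by
    rw [sub_nonneg, div_le_one (by linarith)]; linarith
  refine Real.sqrt_le_iff.mpr ⟨by positivity, ?_⟩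
  rw [mul_pow, Real.sq_sqrt (by linarith)]
  have h4 : (1 - 1 / (2 * (a + 2))) ^ 2 ≥ 1 - 1 / (a + 2) := by
    have : 1 / (a + 2) = 2 * (1 / (2 * (a + 2))) := by field_simp
    rw [this]; nlinarith [sq_nonneg (1 / (2 * (a + 2)))]
  calc a + 1 = (a + 1 + 1) * (1 - 1 / (a + 2)) := by field_simp; ring
    _ ≤ _ := by gcongr

lemma Wt_step {d : ℕ} (n : Fin d → ℕ) (i : Fin d) :
    Wt (n + Pi.single i 1) ≤ (1 - 1 / (2 * ((n i : ℝ) + 2))) * Wt n := by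
  unfold Wt
  rw [← Finset.mul_prod_erase _ _ (Finset.mem_univ i),
    ← Finset.mul_prod_erase Finset.univ (fun i => (Real.sqrt ((n i : ℝ) + 1))⁻¹)
      (Finset.mem_univ i), ← mul_assoc]
  have : ∏ j ∈ Finset.univ.erase i, (Real.sqrt ((((n + Pi.single i 1 : Fin d → ℕ) j : ℕ) : ℝ) + 1))⁻¹ =
      ∏ j ∈ Finset.univ.erase i, (Real.sqrt ((n j : ℝ) + 1))⁻¹ :=
    Finset.prod_congr rfl fun j hj => by simp [Finset.ne_of_mem_erase hj]
  rw [this]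
  refine mul_le_mul_of_nonneg_right ?_
    (Finset.prod_nonneg fun i _ => inv_nonneg.mpr (Real.sqrt_nonneg _))
  have := sqrt_ratio (n i) (by positivity)
  simpa using this

lemma Wt_avg {d : ℕ} [NeZero d] (n : Fin d → ℕ) (t : ℕ) (hn : ∑ i, n i = t) (α : ℝ) (hα : 1 ≤ α)
    (hd : 2 * α ≤ d) :
    (d : ℝ)⁻¹ * ∑ i, Wt (n + Pi.single i 1) ≤
      (((t : ℝ) + (4 * α - 1)) / ((t + 1 : ℕ) + (4 * α - 1))) ^ α * Wt n := by
  have hd0 : (0 : ℝ) < d := by linarith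
  have h1 : ∑ i, Wt (n + Pi.single i 1) ≤ ∑ i, (1 - 1 / (2 * ((n i : ℝ) + 2))) * Wt n :=
    Finset.sum_le_sum fun i _ => Wt_step n i
  have h2 : (d : ℝ) ^ 2 / (t + 2 * d) ≤ ∑ i, 1 / ((n i : ℝ) + 2) := by
    have := Finset.sq_sum_div_le_sum_sq_div Finset.univ (fun _ : Fin d => (1 : ℝ))
      (g := fun i => (n i : ℝ) + 2) (fun i _ => by positivity)
    simp only [one_pow, Finset.sum_const, Finset.card_univ, Fintype.card_fin, nsmul_eq_mul, mul_one,
      Finset.sum_add_distrib] at this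
    rw [← Nat.cast_sum, hn, mul_comm (d : ℝ) 2] at this
    exact this
  have h3 : ∑ i : Fin d, (1 - 1 / (2 * ((n i : ℝ) + 2))) =
      d - 1 / 2 * ∑ i, 1 / ((n i : ℝ) + 2) := by
    rw [Finset.sum_sub_distrib, Finset.mul_sum]
    simp
    refine Finset.sum_congr rfl fun i _ => ?_
    ring
  have ht : (0 : ℝ) ≤ t := by positivity
  have h4 : (d : ℝ)⁻¹ * (d - 1 / 2 * ∑ i, 1 / ((n i : ℝ) + 2)) ≤
      (((t : ℝ) + (4 * α - 1)) / ((t + 1 : ℕ) + (4 * α - 1))) ^ α := by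
    have hb := one_add_mul_self_le_rpow_one_add (s := -(1 / ((t : ℝ) + 4 * α))) (p := α)
      (by rw [neg_le_neg_iff, div_le_one (by linarith)]; linarith) hα
    have e1 : 1 + -(1 / ((t : ℝ) + 4 * α)) =
        ((t : ℝ) + (4 * α - 1)) / ((t + 1 : ℕ) + (4 * α - 1)) := by
      have : (t : ℝ) + 4 * α ≠ 0 := by linarith
      have e : ((t + 1 : ℕ) : ℝ) + (4 * α - 1) = t + 4 * α := by push_cast; ring
      rw [e]; field_simp; ring
    rw [e1] at hb
    refine le_trans ?_ hb
    calc (d : ℝ)⁻¹ * (d - 1 / 2 * ∑ i, 1 / ((n i : ℝ) + 2))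
        ≤ (d : ℝ)⁻¹ * (d - 1 / 2 * ((d : ℝ) ^ 2 / (t + 2 * d))) := by gcongr
      _ = 1 - d / (2 * (t + 2 * d)) := by field_simp
      _ ≤ 1 + α * -(1 / ((t : ℝ) + 4 * α)) := by
          have : α * (1 / ((t : ℝ) + 4 * α)) ≤ d / (2 * (t + 2 * d)) := by
            rw [mul_one_div, div_le_div_iff₀ (by linarith) (by linarith)]
            nlinarith
          linarith
  calc (d : ℝ)⁻¹ * ∑ i, Wt (n + Pi.single i 1)
      ≤ (d : ℝ)⁻¹ * ∑ i, (1 - 1 / (2 * ((n i : ℝ) + 2))) * Wt n := by gcongr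
    _ = ((d : ℝ)⁻¹ * (d - 1 / 2 * ∑ i, 1 / ((n i : ℝ) + 2))) * Wt n := by
        rw [← Finset.sum_mul, h3, mul_assoc]
    _ ≤ _ := mul_le_mul_of_nonneg_right h4 (Wt_nonneg n)

lemma Av_Wt {d : ℕ} [NeZero d] (t : ℕ) (α : ℝ) (hα : 1 ≤ α) (hd : 2 * α ≤ d) :
    Av t (Wt (d := d)) 0 ≤ ((4 * α - 1) / ((t : ℝ) + (4 * α - 1))) ^ α := by
  induction t with
  | zero => 
    simp only [Av, Wt]
    rw [Nat.cast_zero, zero_add, div_self (by linarith)]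
    simp
  | succ t ih =>
    have ha : 0 < 4 * α - 1 := by linarith
    simp only [Av]
    calc Av t (fun n => (d : ℝ)⁻¹ * ∑ i, Wt (n + Pi.single i 1)) 0
        ≤ Av t (fun n => (((t : ℝ) + (4 * α - 1)) / ((t + 1 : ℕ) + (4 * α - 1))) ^ α * Wt n) 0 :=
          Av_le t 0 _ _ (fun n hn => Wt_avg n t (by simpa using hn) α hα hd) 0 (by simp)
      _ = (((t : ℝ) + (4 * α - 1)) / ((t + 1 : ℕ) + (4 * α - 1))) ^ α * Av t Wt 0 := Av_smul _ _ _ _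
      _ ≤ (((t : ℝ) + (4 * α - 1)) / ((t + 1 : ℕ) + (4 * α - 1))) ^ α *
          ((4 * α - 1) / ((t : ℝ) + (4 * α - 1))) ^ α := by gcongr
      _ = ((4 * α - 1) / ((t + 1 : ℕ) + (4 * α - 1))) ^ α := by
          rw [← Real.mul_rpow (by positivity) (by positivity)]
          congr 1
          field_simp

lemma pk_bound {d : ℕ} [NeZero d] (α : ℝ) (hα : 1 ≤ α) (hd : 2 * α ≤ d) (t : ℕ) (x y : Zd d) :
    pk t x y ≤ ENNReal.ofReal ((4 * α - 1) ^ α * ((t : ℝ) + 1) ^ (-α)) := by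
  have h0 : pk t x y = pk t (x - y) 0 := by
    have := pk_translate t (x - y) 0 y
    rw [sub_add_cancel, zero_add] at this
    exact this
  have ha : 0 < 4 * α - 1 := by linarith
  rw [h0, ← ENNReal.ofReal_toReal (ne_top_of_le_ne_top ENNReal.one_ne_top (pk_le_one t (x - y) 0)),
    pk_eq_Av]
  refine ENNReal.ofReal_le_ofReal ?_
  calc Av t (fun n => ∏ i, bw (n i) ((x - y) i)) 0 ≤ Av t Wt 0 :=
        Av_le t 0 _ _ (fun n _ => Finset.prod_le_prod (fun i _ => bw_nonneg _ _)
          fun i _ => bw_le _ _) 0 (by simp)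
    _ ≤ ((4 * α - 1) / ((t : ℝ) + (4 * α - 1))) ^ α := Av_Wt t α hα hd
    _ ≤ ((4 * α - 1) / ((t : ℝ) + 1)) ^ α := by
        gcongr
        linarith
    _ = _ := by
        rw [Real.div_rpow (by linarith) (by positivity), Real.rpow_neg (by positivity)]
        rfl

lemma rpow_tel (β : ℝ) (hβ : 1 ≤ β) (s : ℝ) (hs : 1 ≤ s) :
    s ^ (-(β + 1)) ≤ 2 ^ (β + 1) * (s ^ (-β) - (s + 1) ^ (-β)) := by
  have hs0 : 0 < s := by linarith
  have hb := one_add_mul_self_le_rpow_one_add (s := 1 / s) (p := β)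
    (by have : 0 < 1 / s := by positivity
        linarith) hβ
  have e1 : 1 + 1 / s = (s + 1) / s := by field_simp
  rw [e1, Real.div_rpow (by linarith) hs0.le] at hb
  have h1 : s ^ (-β) - (s + 1) ^ (-β) ≥ (1 / s) * (s + 1) ^ (-β) := by
    rw [Real.rpow_neg hs0.le, Real.rpow_neg (by linarith : (0 : ℝ) ≤ s + 1)]
    have p1 : 0 < s ^ β := by positivity
    have p2 : 0 < (s + 1) ^ β := by positivity
    have h2 : (s ^ β)⁻¹ = ((s + 1) ^ β / s ^ β) * ((s + 1) ^ β)⁻¹ := by field_simp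
    rw [h2]
    have : 1 + 1 / s ≤ (s + 1) ^ β / s ^ β := by
      refine le_trans ?_ hb
      have : 0 < 1 / s := by positivity
      nlinarith
    have h3 := mul_le_mul_of_nonneg_right this (inv_pos.mpr p2).le
    nlinarith
  refine le_trans ?_ (mul_le_mul_of_nonneg_left h1 (by positivity))
  have h5 : (2 * s) ^ (-β) ≤ (s + 1) ^ (-β) :=
    Real.rpow_le_rpow_of_nonpos (by linarith) (by linarith) (by linarith)
  calc s ^ (-(β + 1)) = 2 ^ β * (1 / s * (2 * s) ^ (-β)) := by
        rw [Real.mul_rpow two_pos.le hs0.le, neg_add, Real.rpow_add hs0, Real.rpow_neg_one,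
          Real.rpow_neg two_pos.le]
        field_simp
    _ ≤ 2 ^ (β + 1) * (1 / s * (s + 1) ^ (-β)) := by
        gcongr
        · norm_num
        · linarith

lemma heat_tail {d : ℕ} [NeZero d] (β : ℝ) (hβ : 1 ≤ β) (hd : 2 * (β + 1) ≤ d) :
    ∃ C : ℝ, 0 < C ∧ ∀ n (x y : Zd d),
      ∑' t, pk (n + t) x y ≤ ENNReal.ofReal (C * ((n : ℝ) + 1) ^ (-β)) := by
  set c := (4 * (β + 1) - 1) ^ (β + 1) with hc
  have hc0 : 0 < c := Real.rpow_pos_of_pos (by linarith) _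
  refine ⟨c * 2 ^ (β + 1), by positivity, fun n x y => ?_⟩
  refine ENNReal.tsum_le_of_sum_range_le fun N => ?_
  set f : ℕ → ℝ := fun t => c * 2 ^ (β + 1) * ((n : ℝ) + t + 1) ^ (-β) with hf
  have hpk : ∀ t, pk (n + t) x y ≤ ENNReal.ofReal (f t - f (t + 1)) := by
    intro t
    refine (pk_bound (β + 1) (by linarith) hd (n + t) x y).trans (ENNReal.ofReal_le_ofReal ?_)
    have := rpow_tel β hβ ((n : ℝ) + t + 1) (by
      have : (0 : ℝ) ≤ (n : ℝ) + t := by positivity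
      linarith)
    rw [← hc]
    simp only [hf]
    push_cast
    have h2 := mul_le_mul_of_nonneg_left this hc0.le
    rw [← add_assoc (n : ℝ) (t : ℝ) 1]
    linarith
  have hfd : ∀ t, 0 ≤ f t - f (t + 1) := by
    intro t
    have := rpow_tel β hβ ((n : ℝ) + t + 1) (by
      have : (0 : ℝ) ≤ (n : ℝ) + t := by positivity
      linarith)
    have h2 := mul_le_mul_of_nonneg_left this hc0.le
    have h3 : 0 ≤ c * ((n : ℝ) + t + 1) ^ (-(β + 1)) := by positivity
    simp only [hf]
    push_cast
    rw [← add_assoc (n : ℝ) (t : ℝ) 1]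
    linarith
  calc ∑ t ∈ Finset.range N, pk (n + t) x y
      ≤ ∑ t ∈ Finset.range N, ENNReal.ofReal (f t - f (t + 1)) := Finset.sum_le_sum fun t _ => hpk t
    _ = ENNReal.ofReal (f 0 - f N) := by
        rw [← ENNReal.ofReal_sum_of_nonneg (fun t _ => hfd t), Finset.sum_range_sub']
    _ ≤ _ := by
        refine ENNReal.ofReal_le_ofReal ?_
        have : 0 ≤ f N := by simp only [hf]; positivity
        have h0 : f 0 = c * 2 ^ (β + 1) * ((n : ℝ) + 1) ^ (-β) := by simp [hf]
        linarith

/-! ### Truncated capacities -/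

/-- Truncated escape probability. -/
def eT {d : ℕ} [NeZero d] (n : ℕ) (A : Set (Zd d)) (x : Zd d) : ℝ≥0∞ :=
  walkLaw d {u | ∀ t, 0 < t → t ≤ n → path x u t ∉ A}

/-- Truncated capacity. -/
def capT {d : ℕ} [NeZero d] (n : ℕ) (A : Finset (Zd d)) : ℝ≥0∞ := ∑ x ∈ A, eT n (↑A) x

lemma eT_le_one {d : ℕ} [NeZero d] (n : ℕ) (A : Set (Zd d)) (x : Zd d) : eT n A x ≤ 1 :=
  prob_le_one

lemma eT_anti {d : ℕ} [NeZero d] (n : ℕ) {A B : Set (Zd d)} (h : A ⊆ B) (x : Zd d) :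
    eT n B x ≤ eT n A x :=
  measure_mono fun _ hu t h0 hn ha => hu t h0 hn (h ha)

lemma eE_le_eT {d : ℕ} [NeZero d] (n : ℕ) (A : Set (Zd d)) (x : Zd d) : eE A x ≤ eT n A x :=
  measure_mono fun _ hu t h0 _ => hu t h0

lemma capE_le_capT {d : ℕ} [NeZero d] (n : ℕ) (A : Finset (Zd d)) : capE A ≤ capT n A :=
  Finset.sum_le_sum fun x _ => eE_le_eT n _ x

lemma capT_le_card {d : ℕ} [NeZero d] (n : ℕ) (A : Finset (Zd d)) : capT n A ≤ A.card := by
  calc capT n A ≤ ∑ x ∈ A, 1 := Finset.sum_le_sum fun x _ => eT_le_one n _ x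
    _ = A.card := by simp

lemma eT_le {d : ℕ} [NeZero d] {G : ℕ → ℝ≥0∞}
    (hG : ∀ n (x y : Zd d), ∑' t, pk (n + t) x y ≤ G n) (n : ℕ) (A : Finset (Zd d)) (x : Zd d) :
    eT n (↑A) x ≤ eE (↑A) x + A.card * G n := by
  have hsub : {u | ∀ t, 0 < t → t ≤ n → path x u t ∉ (↑A : Set (Zd d))} ⊆
      {u | ∀ t, 0 < t → path x u t ∉ (↑A : Set (Zd d))} ∪
        ⋃ y ∈ A, ⋃ t : ℕ, {u | path x u (n + t) = y} := by
    intro u hu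
    by_cases h : ∀ t, 0 < t → path x u t ∉ (↑A : Set (Zd d))
    · exact Or.inl h
    · right
      push Not at h
      obtain ⟨t, h0, ht⟩ := h
      have hn : n < t := by
        by_contra hc
        exact hu t h0 (by omega) ht
      simp only [Set.mem_iUnion]
      refine ⟨path x u t, ht, t - n, ?_⟩
      show path x u (n + (t - n)) = path x u t
      rw [Nat.add_sub_cancel' hn.le]
  calc eT n (↑A) x ≤ _ := measure_mono hsub
    _ ≤ eE (↑A) x + walkLaw d (⋃ y ∈ A, ⋃ t : ℕ, {u | path x u (n + t) = y}) := measure_union_le _ _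
    _ ≤ eE (↑A) x + ∑ y ∈ A, ∑' t, pk (n + t) x y := by
        gcongr
        refine (measure_biUnion_finset_le _ _).trans (Finset.sum_le_sum fun y _ => ?_)
        exact measure_iUnion_le _
    _ ≤ eE (↑A) x + ∑ y ∈ A, G n := by
        gcongr with y
        exact hG n x y
    _ = _ := by rw [Finset.sum_const, nsmul_eq_mul]

lemma capT_le {d : ℕ} [NeZero d] {G : ℕ → ℝ≥0∞}
    (hG : ∀ n (x y : Zd d), ∑' t, pk (n + t) x y ≤ G n) (n : ℕ) (A : Finset (Zd d)) :
    capT n A ≤ capE A + (A.card : ℝ≥0∞) ^ 2 * G n := by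
  calc capT n A ≤ ∑ x ∈ A, (eE (↑A) x + A.card * G n) :=
        Finset.sum_le_sum fun x _ => eT_le hG n A x
    _ = _ := by
        rw [Finset.sum_add_distrib, Finset.sum_const, nsmul_eq_mul, sq, mul_assoc]; rfl

lemma capT_sub {d : ℕ} [NeZero d] (n K : ℕ) (B : ℕ → Finset (Zd d)) (R A : Finset (Zd d))
    (hB : ∀ i < K, B i ⊆ A) (hA : ∀ x ∈ A, x ∈ R ∨ ∃ i < K, x ∈ B i) :
    capT n A ≤ ∑ i ∈ Finset.range K, capT n (B i) + R.card := by
  calc capT n A ≤ ∑ x ∈ A, (∑ i ∈ Finset.range K, (if x ∈ B i then eT n (↑(B i)) x else 0) +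
        (if x ∈ R then 1 else 0)) := by
        refine Finset.sum_le_sum fun x hx => ?_
        rcases hA x hx with h | ⟨i, hi, h⟩
        · rw [if_pos h]
          exact (eT_le_one _ _ _).trans le_add_self
        · refine le_trans ?_ le_self_add
          refine le_trans ?_ (Finset.single_le_sum (fun _ _ => zero_le) (Finset.mem_range.mpr hi))
          rw [if_pos h]
          exact eT_anti n (by exact_mod_cast hB i hi) x
    _ ≤ _ := by
        rw [Finset.sum_add_distrib, Finset.sum_comm]
        refine add_le_add (Finset.sum_le_sum fun i hi => ?_) ?_
        · rw [← Finset.sum_filter, Finset.filter_mem_eq_inter,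
            Finset.inter_eq_right.mpr (hB i (Finset.mem_range.mp hi))]
          rfl
        · rw [← Finset.sum_filter, Finset.filter_mem_eq_inter, Finset.sum_const, nsmul_one]
          exact_mod_cast Finset.card_le_card Finset.inter_subset_right

lemma mem_wr {d : ℕ} (x : Zd d) (u : ℕ → Stp d) (a b : ℕ) (y : Zd d) :
    y ∈ wr x u a b ↔ ∃ t, (a ≤ t ∧ t ≤ b) ∧ path x u t = y := by
  simp [wr, walkRange]

lemma wr_mono {d : ℕ} (x : Zd d) (u : ℕ → Stp d) {a b a' b' : ℕ} (h : a' ≤ a) (h' : b ≤ b') :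
    wr x u a b ⊆ wr x u a' b' := by
  intro y
  simp only [mem_wr]
  rintro ⟨t, ⟨h1, h2⟩, rfl⟩
  exact ⟨t, ⟨by omega, by omega⟩, rfl⟩

/-- Sum of the capacities of the blocks. -/
def Zs {d : ℕ} [NeZero d] (K L : ℕ) (u : ℕ → Stp d) : ℝ≥0∞ :=
  ∑ i ∈ Finset.range K, capE (wr (0 : Zd d) u (i * L) (i * L + L))

/-- Sum of the mutual energies of the blocks. -/
def Ns {d : ℕ} [NeZero d] (K L : ℕ) (u : ℕ → Stp d) : ℝ≥0∞ :=
  ∑ j ∈ Finset.range K, ∑ i ∈ (Finset.range K).erase j,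
    IE (wr (0 : Zd d) u (j * L) (j * L + L)) (wr (0 : Zd d) u (i * L) (i * L + L))

lemma block_le {K L i T : ℕ} (hi : i < K) (hT : K * L ≤ T) : i * L + L ≤ T := by
  have : (i + 1) * L ≤ K * L := Nat.mul_le_mul_right _ hi
  nlinarith

lemma capT_upper {d : ℕ} [NeZero d] {G : ℕ → ℝ≥0∞}
    (hG : ∀ n (x y : Zd d), ∑' t, pk (n + t) x y ≤ G n) (n K L T : ℕ) (hL : 0 < L)
    (hT : K * L ≤ T) (u : ℕ → Stp d) :
    capT n (wr (0 : Zd d) u 0 T) ≤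
      Zs (d := d) K L u + (K * ((L : ℝ≥0∞) + 1) ^ 2 * G n + ((T - K * L : ℕ) + 1)) := by
  calc capT n (wr (0 : Zd d) u 0 T) ≤
      ∑ i ∈ Finset.range K, capT n (wr (0 : Zd d) u (i * L) (i * L + L)) +
        (wr (0 : Zd d) u (K * L) T).card := by
        refine capT_sub n K _ _ _ (fun i hi => ?_) (fun x hx => ?_)
        · exact wr_mono _ _ (Nat.zero_le _) (block_le hi hT)
        · rw [mem_wr] at hx
          obtain ⟨t, ⟨-, ht⟩, rfl⟩ := hx
          rcases le_or_gt (K * L) t with h | h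
          · left
            rw [mem_wr]; exact ⟨t, ⟨h, ht⟩, rfl⟩
          · right
            refine ⟨t / L, (Nat.div_lt_iff_lt_mul hL).mpr h, ?_⟩
            rw [mem_wr]
            refine ⟨t, ⟨Nat.div_mul_le_self t L, ?_⟩, rfl⟩
            have := Nat.div_add_mod t L
            have h2 := Nat.mod_lt t hL
            nlinarith
    _ ≤ ∑ i ∈ Finset.range K, (capE (wr (0 : Zd d) u (i * L) (i * L + L)) +
          ((L : ℝ≥0∞) + 1) ^ 2 * G n) + ((T - K * L : ℕ) + 1) := by
        refine add_le_add (Finset.sum_le_sum fun i _ => ?_) ?_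
        · refine (capT_le hG n _).trans ?_
          gcongr
          exact_mod_cast card_wr_le (0 : Zd d) u (i * L) L
        · have := card_wr_le (0 : Zd d) u (K * L) (T - K * L)
          rw [Nat.add_sub_cancel' hT] at this
          exact_mod_cast this
    _ = _ := by
        rw [Finset.sum_add_distrib, Finset.sum_const, Finset.card_range, nsmul_eq_mul, Zs]
        ring

lemma capT_lower {d : ℕ} [NeZero d] (hg : ∀ x y : Zd d, gE x y ≠ ⊤) (n K L T : ℕ)
    (hT : K * L ≤ T) (u : ℕ → Stp d) :
    Zs (d := d) K L u ≤ capT n (wr (0 : Zd d) u 0 T) + Ns (d := d) K L u := by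
  refine (capE_super hg K (fun i => wr (0 : Zd d) u (i * L) (i * L + L))).trans ?_
  refine add_le_add (le_trans ?_ (capE_le_capT n _)) le_rfl
  refine capE_mono hg ?_
  intro x hx
  obtain ⟨i, hi, h⟩ := Finset.mem_biUnion.mp hx
  exact wr_mono _ _ (Nat.zero_le _) (block_le (Finset.mem_range.mp hi) hT) h

/-! ### Expected mutual energy of the blocks -/

lemma wr_blocks {d : ℕ} (x : Zd d) (u : ℕ → Stp d) (s M m : ℕ) (hM : 0 < M) (hm : 0 < m) :
    wr x u (s * (M * m)) (s * (M * m) + M * m) =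
      (Finset.Ico (s * M) (s * M + M)).biUnion (fun a => wr x u (a * m) (a * m + m)) := by
  ext y
  simp only [Finset.mem_biUnion, mem_wr, Finset.mem_Ico]
  constructor
  · rintro ⟨t, ⟨h1, h2⟩, rfl⟩
    rcases Nat.lt_or_ge t (s * (M * m) + M * m) with h | h
    · refine ⟨t / m, ⟨?_, ?_⟩, t, ⟨Nat.div_mul_le_self t m, ?_⟩, rfl⟩
      · rw [Nat.le_div_iff_mul_le hm]; rw [mul_assoc]; exact h1
      · rw [Nat.div_lt_iff_lt_mul hm]; nlinarith
      · have := Nat.div_add_mod t m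
        have h2 := Nat.mod_lt t hm
        nlinarith
    · have ht : t = s * (M * m) + M * m := le_antisymm h2 h
      obtain ⟨M', rfl⟩ : ∃ M', M = M' + 1 := ⟨M - 1, by omega⟩
      refine ⟨s * (M' + 1) + M', ⟨by omega, by omega⟩, t, ⟨?_, ?_⟩, rfl⟩
      · rw [ht]; nlinarith
      · rw [ht]; apply le_of_eq; ring
  · rintro ⟨a, ⟨h1, h2⟩, t, ⟨h3, h4⟩, rfl⟩
    refine ⟨t, ⟨?_, ?_⟩, rfl⟩
    · have := Nat.mul_le_mul_right m h1
      rw [mul_assoc] at this; omega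
    · have : (a + 1) * m ≤ (s * M + M) * m := Nat.mul_le_mul_right m h2
      nlinarith

/-- Bound for the expected mutual energy of sub-blocks. -/
def hh (d : ℕ) [NeZero d] (G : ℕ → ℝ≥0∞) (m v : ℕ) : ℝ≥0∞ :=
  if v = 0 then (m : ℝ≥0∞) + 1 else expE d m * (expE d m * G (v * m))

lemma lint_pair {d : ℕ} [NeZero d] {G : ℕ → ℝ≥0∞}
    (hG : ∀ n (x y : Zd d), ∑' t, pk (n + t) x y ≤ G n) (m a v : ℕ) :
    ∫⁻ u, IE (wr (0 : Zd d) u (a * m) (a * m + m))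
      (wr (0 : Zd d) u ((a + 1 + v) * m) ((a + 1 + v) * m + m)) ∂(walkLaw d) ≤ hh d G m v := by
  unfold hh
  split_ifs with h
  · calc _ ≤ ∫⁻ u, ((m : ℝ≥0∞) + 1) ∂(walkLaw d) := by
          refine lintegral_mono fun u => (IE_le_capE _ _).trans ((capE_le_card _).trans ?_)
          exact_mod_cast card_wr_le (0 : Zd d) u (a * m) m
      _ = _ := by simp
  · have := lint_IE hG (a * m) m (v * m) (0 : Zd d)
    have e : (a + 1 + v) * m = a * m + m + v * m := by ring
    rw [e]
    exact this

/-- Symmetrised version of `hh`. -/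
def hd2 (d : ℕ) [NeZero d] (G : ℕ → ℝ≥0∞) (m a b : ℕ) : ℝ≥0∞ :=
  if a < b then hh d G m (b - a - 1) else hh d G m (a - b - 1)

lemma lint_pair2 {d : ℕ} [NeZero d] {G : ℕ → ℝ≥0∞}
    (hG : ∀ n (x y : Zd d), ∑' t, pk (n + t) x y ≤ G n) (m a b : ℕ) (hab : a ≠ b) :
    ∫⁻ u, IE (wr (0 : Zd d) u (a * m) (a * m + m))
      (wr (0 : Zd d) u (b * m) (b * m + m)) ∂(walkLaw d) ≤ hd2 d G m a b := by
  unfold hd2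
  split_ifs with h
  · have := lint_pair hG m a (b - a - 1)
    rwa [show a + 1 + (b - a - 1) = b by omega] at this
  · have := lint_pair hG m b (a - b - 1)
    rw [show b + 1 + (a - b - 1) = a by omega] at this
    simp only [IE_symm (wr (0 : Zd d) _ (a * m) (a * m + m))]
    exact this

lemma sum_blocks {R : Type*} [AddCommMonoid R] (f : ℕ → R) (M J : ℕ) :
    ∑ i ∈ Finset.range J, ∑ q ∈ Finset.range M, f (i * M + q) = ∑ b ∈ Finset.range (J * M), f b := by
  induction J with
  | zero => simp
  | succ J ih =>
    rw [Finset.sum_range_succ, ih, Nat.succ_mul, Finset.sum_range_add]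

lemma sum_tri (h : ℕ → ℝ≥0∞) (M Q : ℕ) :
    ∑ p ∈ Finset.range M, ∑ w ∈ Finset.range Q, h (p + w) ≤
      ∑ v ∈ Finset.range (M + Q), (min M (v + 1) : ℕ) * h v := by
  calc ∑ p ∈ Finset.range M, ∑ w ∈ Finset.range Q, h (p + w)
      ≤ ∑ p ∈ Finset.range M, ∑ v ∈ Finset.range (M + Q), if p ≤ v then h v else 0 := by
        refine Finset.sum_le_sum fun p hp => ?_
        rw [← Finset.sum_filter]
        have : ∑ w ∈ Finset.range Q, h (p + w) = ∑ v ∈ Finset.Ico p (p + Q), h v := by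
          rw [Finset.sum_Ico_eq_sum_range]; simp
        rw [this]
        refine Finset.sum_le_sum_of_subset fun v hv => ?_
        have := Finset.mem_range.mp hp
        simp only [Finset.mem_Ico, Finset.mem_filter, Finset.mem_range] at hv ⊢
        omega
    _ = ∑ v ∈ Finset.range (M + Q), (min M (v + 1) : ℕ) * h v := by
        rw [Finset.sum_comm]
        refine Finset.sum_congr rfl fun v _ => ?_
        rw [← Finset.sum_filter, Finset.sum_const, nsmul_eq_mul]
        congr 2
        have : (Finset.range M).filter (fun p => p ≤ v) = Finset.range (min M (v + 1)) := by
          ext p; simp only [Finset.mem_filter, Finset.mem_range]; omega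
        rw [this, Finset.card_range]

lemma row_bound (h : ℕ → ℝ≥0∞) (f : ℕ → ℕ → ℝ≥0∞)
    (hf : ∀ a b, f a b = if a < b then h (b - a - 1) else h (a - b - 1)) (K M j : ℕ) (hj : j < K) :
    ∑ i ∈ (Finset.range K).erase j, ∑ p ∈ Finset.range M, ∑ q ∈ Finset.range M,
      f (j * M + p) (i * M + q) ≤
      2 * ∑ p ∈ Finset.range M, ∑ w ∈ Finset.range (K * M), h (p + w) := by
  have hsplit : (Finset.range K).erase j = Finset.range j ∪ Finset.Ico (j + 1) K := by
    ext i; simp only [Finset.mem_erase, Finset.mem_range, Finset.mem_union, Finset.mem_Ico]; omega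
  have hdisj : Disjoint (Finset.range j) (Finset.Ico (j + 1) K) := by
    rw [Finset.disjoint_left]; intro i; simp only [Finset.mem_range, Finset.mem_Ico]; omega
  rw [hsplit, Finset.sum_union hdisj, two_mul]
  refine add_le_add ?_ ?_
  · rw [Finset.sum_comm]
    refine Finset.sum_le_sum fun p _ => ?_
    rw [sum_blocks (fun b => f (j * M + p) b) M j, ← Finset.sum_range_reflect]
    calc _ = ∑ w ∈ Finset.range (j * M), h (p + w) := by
          refine Finset.sum_congr rfl fun w hw => ?_
          have := Finset.mem_range.mp hw
          rw [hf, if_neg (by omega)]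
          congr 1; omega
      _ ≤ _ := Finset.sum_le_sum_of_subset (Finset.range_mono (Nat.mul_le_mul_right M hj.le))
  · rw [Finset.sum_Ico_eq_sum_range, Finset.sum_comm, ← Finset.sum_range_reflect]
    refine Finset.sum_le_sum fun p hp => ?_
    have hp' := Finset.mem_range.mp hp
    calc _ = ∑ k ∈ Finset.range (K - (j + 1)), ∑ q ∈ Finset.range M,
          (fun w => h (p + w)) (k * M + q) := by
          refine Finset.sum_congr rfl fun k _ => Finset.sum_congr rfl fun q _ => ?_
          have e : (j + 1 + k) * M + q = j * M + M + (k * M + q) := by ring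
          rw [hf, e, if_pos (by omega)]
          simp only []
          congr 1; omega
      _ = ∑ w ∈ Finset.range ((K - (j + 1)) * M), h (p + w) :=
          sum_blocks (fun w => h (p + w)) M (K - (j + 1))
      _ ≤ _ := Finset.sum_le_sum_of_subset
          (Finset.range_mono (Nat.mul_le_mul_right M (by omega)))

lemma measurable_IEwr {d : ℕ} [NeZero d] (a b a' b' : ℕ) :
    Measurable (fun u => IE (wr (0 : Zd d) u a b) (wr (0 : Zd d) u a' b')) :=
  measurable_disc2 IE (measurable_wr 0 _ _) (measurable_wr 0 _ _)

lemma lint_Ns {d : ℕ} [NeZero d] {G : ℕ → ℝ≥0∞}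
    (hG : ∀ n (x y : Zd d), ∑' t, pk (n + t) x y ≤ G n) (K M m : ℕ) (hM : 0 < M) (hm : 0 < m) :
    ∫⁻ u, Ns (d := d) K (M * m) u ∂(walkLaw d) ≤
      2 * K * ∑ v ∈ Finset.range (M + K * M), (min M (v + 1) : ℕ) * hh d G m v := by
  have h1 : ∀ u, Ns (d := d) K (M * m) u ≤
      ∑ j ∈ Finset.range K, ∑ i ∈ (Finset.range K).erase j, ∑ p ∈ Finset.range M,
        ∑ q ∈ Finset.range M,
        IE (wr (0 : Zd d) u ((j * M + p) * m) ((j * M + p) * m + m))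
          (wr (0 : Zd d) u ((i * M + q) * m) ((i * M + q) * m + m)) := by
    intro u
    refine Finset.sum_le_sum fun j _ => Finset.sum_le_sum fun i _ => ?_
    rw [wr_blocks _ _ j M m hM hm, wr_blocks _ _ i M m hM hm]
    refine (IE_biUnion _ _ _).trans (le_of_eq ?_)
    rw [Finset.sum_Ico_eq_sum_range]
    simp only [Nat.add_sub_cancel_left]
    refine Finset.sum_congr rfl fun p _ => ?_
    rw [Finset.sum_Ico_eq_sum_range]
    simp only [Nat.add_sub_cancel_left]
  refine (lintegral_mono h1).trans ?_
  rw [lintegral_finset_sum _ (fun j _ => Finset.measurable_sum _ fun i _ =>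
    Finset.measurable_sum _ fun p _ => Finset.measurable_sum _ fun q _ => measurable_IEwr _ _ _ _)]
  calc _ ≤ ∑ j ∈ Finset.range K, 2 * ∑ p ∈ Finset.range M, ∑ w ∈ Finset.range (K * M),
        hh d G m (p + w) := by
        refine Finset.sum_le_sum fun j hj => ?_
        refine le_trans ?_ (row_bound (hh d G m) (hd2 d G m) (fun a b => rfl) K M j
          (Finset.mem_range.mp hj))
        rw [lintegral_finset_sum _ (fun i _ => Finset.measurable_sum _ fun p _ =>
          Finset.measurable_sum _ fun q _ => measurable_IEwr _ _ _ _)]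
        refine Finset.sum_le_sum fun i hi => ?_
        rw [lintegral_finset_sum _ (fun p _ => Finset.measurable_sum _ fun q _ =>
          measurable_IEwr _ _ _ _)]
        refine Finset.sum_le_sum fun p hp => ?_
        rw [lintegral_finset_sum _ (fun q _ => measurable_IEwr _ _ _ _)]
        refine Finset.sum_le_sum fun q hq => ?_
        refine lint_pair2 hG m _ _ ?_
        have hp' := Finset.mem_range.mp hp
        have hq' := Finset.mem_range.mp hq
        have hij := (Finset.mem_erase.mp hi).1
        intro heq
        apply hij
        have e1 : (i * M + q) / M = i := by
          rw [mul_comm, Nat.mul_add_div hM, Nat.div_eq_of_lt hq', add_zero]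
        have e2 : (j * M + p) / M = j := by
          rw [mul_comm, Nat.mul_add_div hM, Nat.div_eq_of_lt hp', add_zero]
        rw [← e1, ← e2, heq]
    _ ≤ ∑ j ∈ Finset.range K, 2 * ∑ v ∈ Finset.range (M + K * M),
          (min M (v + 1) : ℕ) * hh d G m v := by
        refine Finset.sum_le_sum fun j _ => ?_
        gcongr
        exact sum_tri _ _ _
    _ = _ := by
        rw [Finset.sum_const, Finset.card_range, nsmul_eq_mul]; ring

/-! ### Real-valued versions and the second moment -/

/-- Real-valued expected capacity. -/
def aR (d : ℕ) [NeZero d] (L : ℕ) : ℝ := (expE d L).toReal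

/-- Real-valued capacity of a block. -/
def blk {d : ℕ} [NeZero d] (a b : ℕ) (u : ℕ → Stp d) : ℝ := (capE (wr (0 : Zd d) u a b)).toReal

lemma capE_ne_top {d : ℕ} [NeZero d] (A : Finset (Zd d)) : capE A ≠ ⊤ :=
  ne_top_of_le_ne_top (ENNReal.natCast_ne_top _) (capE_le_card A)

lemma capT_ne_top {d : ℕ} [NeZero d] (n : ℕ) (A : Finset (Zd d)) : capT n A ≠ ⊤ :=
  ne_top_of_le_ne_top (ENNReal.natCast_ne_top _) (capT_le_card n A)

lemma expE_ne_top {d : ℕ} [NeZero d] (m : ℕ) : expE d m ≠ ⊤ :=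
  ne_top_of_le_ne_top (by exact_mod_cast ENNReal.natCast_ne_top (m + 1)) (expE_le m)

lemma aR_nonneg {d : ℕ} [NeZero d] (L : ℕ) : 0 ≤ aR d L := ENNReal.toReal_nonneg

lemma aR_le {d : ℕ} [NeZero d] (L : ℕ) : aR d L ≤ L + 1 := by
  have := ENNReal.toReal_mono (by exact_mod_cast ENNReal.natCast_ne_top (L + 1)) (expE_le (d := d) L)
  refine this.trans (le_of_eq ?_)
  exact_mod_cast ENNReal.toReal_natCast (L + 1)

lemma measurable_blk {d : ℕ} [NeZero d] (a b : ℕ) : Measurable (blk (d := d) a b) := by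
  have h : Measurable (fun u => capE (wr (0 : Zd d) u a b)) :=
    (Measurable.of_discrete (f := capE)).comp (measurable_wr 0 a b)
  exact h.ennreal_toReal

lemma blk_nonneg {d : ℕ} [NeZero d] (a b : ℕ) (u : ℕ → Stp d) : 0 ≤ blk a b u :=
  ENNReal.toReal_nonneg

lemma blk_le {d : ℕ} [NeZero d] (a L : ℕ) (u : ℕ → Stp d) : blk a (a + L) u ≤ L + 1 := by
  have h : capE (wr (0 : Zd d) u a (a + L)) ≤ ((L + 1 : ℕ) : ℝ≥0∞) :=
    (capE_le_card _).trans (by exact_mod_cast card_wr_le (0 : Zd d) u a L)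
  have := ENNReal.toReal_mono (ENNReal.natCast_ne_top (L + 1)) h
  rw [ENNReal.toReal_natCast] at this
  exact_mod_cast this

lemma integral_blk {d : ℕ} [NeZero d] (a L : ℕ) :
    ∫ u, blk a (a + L) u ∂(walkLaw d) = aR d L := by
  have h : Measurable (fun u => capE (wr (0 : Zd d) u a (a + L))) :=
    (Measurable.of_discrete (f := capE)).comp (measurable_wr 0 a (a + L))
  unfold blk
  rw [integral_toReal h.aemeasurable (Eventually.of_forall fun u => (capE_ne_top _).lt_top),
    lint_block, aR]

/-- Centered sum of block capacities. -/
def Sc {d : ℕ} [NeZero d] (K L : ℕ) (u : ℕ → Stp d) : ℝ :=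
  ∑ i ∈ Finset.range K, (blk (i * L) (i * L + L) u - aR d L)

lemma measurable_Sc {d : ℕ} [NeZero d] (K L : ℕ) : Measurable (Sc (d := d) K L) :=
  Finset.measurable_sum _ fun i _ => (measurable_blk _ _).sub_const _

lemma blk_dev {d : ℕ} [NeZero d] (a L : ℕ) (u : ℕ → Stp d) :
    |blk a (a + L) u - aR d L| ≤ L + 1 := by
  rw [abs_le]
  have h1 := blk_le a L u
  have h2 := blk_nonneg a (a + L) u
  have h3 := aR_le (d := d) L
  have h4 := aR_nonneg (d := d) L
  constructor <;> linarith

lemma Sc_bdd {d : ℕ} [NeZero d] (K L : ℕ) (u : ℕ → Stp d) : |Sc K L u| ≤ K * (L + 1) := by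
  calc |Sc K L u| ≤ ∑ i ∈ Finset.range K, |blk (i * L) (i * L + L) u - aR d L| :=
        Finset.abs_sum_le_sum_abs _ _
    _ ≤ ∑ i ∈ Finset.range K, ((L : ℝ) + 1) := Finset.sum_le_sum fun i _ => blk_dev _ _ _
    _ = _ := by rw [Finset.sum_const, Finset.card_range, nsmul_eq_mul]

lemma integrable_bdd {Ω : Type*} [MeasurableSpace Ω] {μ : Measure Ω} [IsFiniteMeasure μ]
    {f : Ω → ℝ} (hf : Measurable f) (C : ℝ) (h : ∀ x, |f x| ≤ C) : Integrable f μ :=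
  Integrable.of_bound hf.aestronglyMeasurable C (Eventually.of_forall h)

lemma integrable_blk {d : ℕ} [NeZero d] (a L : ℕ) : Integrable (blk a (a + L)) (walkLaw d) :=
  integrable_bdd (measurable_blk _ _) (L + 1) fun u => by
    rw [abs_of_nonneg (blk_nonneg _ _ _)]; exact blk_le _ _ _

lemma integral_Sc {d : ℕ} [NeZero d] (K L : ℕ) : ∫ u, Sc K L u ∂(walkLaw d) = 0 := by
  have hi : ∀ i : ℕ, Integrable (fun u => blk (i * L) (i * L + L) u - aR d L) (walkLaw d) :=
    fun i => (integrable_blk _ _).sub (integrable_const _)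
  unfold Sc
  rw [integral_finset_sum _ (fun i _ => hi i)]
  refine Finset.sum_eq_zero fun i _ => ?_
  rw [integral_sub (integrable_blk _ _) (integrable_const _), integral_blk]
  simp

lemma Sc_conc {d : ℕ} [NeZero d] (K L : ℕ) (v u : ℕ → Stp d) :
    Sc (d := d) (K + 1) L (conc L (v, u)) = (blk 0 (0 + L) v - aR d L) + Sc K L u := by
  unfold Sc
  rw [Finset.sum_range_succ', add_comm]
  congr 1
  · unfold blk
    rw [zero_mul, zero_add, wr_conc_le _ _ _ _ le_rfl]
  · refine Finset.sum_congr rfl fun i _ => ?_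
    unfold blk
    have e : (i + 1) * L = L + i * L := by ring
    rw [e, add_assoc L, wr_conc_add, capE_wr]

lemma integral_Sc_sq {d : ℕ} [NeZero d] (K L : ℕ) :
    ∫ u, (Sc K L u) ^ 2 ∂(walkLaw d) ≤ K * ((L : ℝ) + 1) ^ 2 := by
  induction K with
  | zero => simp [Sc]
  | succ K ih =>
    set ψ : (ℕ → Stp d) → ℝ := fun v => blk 0 (0 + L) v - aR d L with hψ
    have mψ : Measurable ψ := (measurable_blk _ _).sub_const _
    have mS := measurable_Sc (d := d) K L
    have mS' := measurable_Sc (d := d) (K + 1) L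
    have bψ : ∀ v, |ψ v| ≤ L + 1 := fun v => blk_dev _ _ _
    have bS := Sc_bdd (d := d) K L
    have h1 : ∫ u, (Sc (K + 1) L u) ^ 2 ∂(walkLaw d) =
        ∫ p, (ψ p.1 + Sc K L p.2) ^ 2 ∂((walkLaw d).prod (walkLaw d)) := by
      have hm : ∫ u, (fun u => (Sc (K + 1) L u) ^ 2) u
            ∂(((walkLaw d).prod (walkLaw d)).map (conc L)) =
          ∫ p, (fun u => (Sc (K + 1) L u) ^ 2) (conc L p) ∂((walkLaw d).prod (walkLaw d)) :=
        integral_map (measurable_conc L).aemeasurable (mS'.pow_const 2).aestronglyMeasurable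
      rw [(mp_conc d L).map_eq] at hm
      refine hm.trans ?_
      refine integral_congr_ae (Eventually.of_forall fun p => ?_)
      show Sc (K + 1) L (conc L (p.1, p.2)) ^ 2 = _
      rw [Sc_conc]
    have i1 : Integrable (fun p : (ℕ → Stp d) × (ℕ → Stp d) => ψ p.1 ^ 2)
        ((walkLaw d).prod (walkLaw d)) :=
      integrable_bdd ((mψ.comp measurable_fst).pow_const 2) ((L + 1) ^ 2) fun p => by
        rw [abs_pow]; exact pow_le_pow_left₀ (abs_nonneg _) (bψ _) 2
    have i2 : Integrable (fun p : (ℕ → Stp d) × (ℕ → Stp d) => 2 * (ψ p.1 * Sc K L p.2))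
        ((walkLaw d).prod (walkLaw d)) :=
      Integrable.const_mul (integrable_bdd ((mψ.comp measurable_fst).mul (mS.comp measurable_snd))
        ((L + 1) * (K * (L + 1))) fun p => by
          simp only [Pi.mul_apply, Function.comp, abs_mul]
          exact mul_le_mul (bψ _) (bS _) (abs_nonneg _) (by positivity)) 2
    have i3 : Integrable (fun p : (ℕ → Stp d) × (ℕ → Stp d) => Sc K L p.2 ^ 2)
        ((walkLaw d).prod (walkLaw d)) :=
      integrable_bdd ((mS.comp measurable_snd).pow_const 2) ((K * (L + 1)) ^ 2) fun p => by
        rw [abs_pow]; exact pow_le_pow_left₀ (abs_nonneg _) (bS _) 2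
    have h2 : ∫ p, (ψ p.1 + Sc K L p.2) ^ 2 ∂((walkLaw d).prod (walkLaw d)) =
        ∫ v, ψ v ^ 2 ∂(walkLaw d) + ∫ u, (Sc K L u) ^ 2 ∂(walkLaw d) := by
      have e : (fun p : (ℕ → Stp d) × (ℕ → Stp d) => (ψ p.1 + Sc K L p.2) ^ 2) =
          fun p => (ψ p.1 ^ 2 + 2 * (ψ p.1 * Sc K L p.2)) + Sc K L p.2 ^ 2 := by
        funext p; ring
      have i12 : Integrable (fun p : (ℕ → Stp d) × (ℕ → Stp d) =>
          ψ p.1 ^ 2 + 2 * (ψ p.1 * Sc K L p.2)) ((walkLaw d).prod (walkLaw d)) := i1.add i2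
      rw [e, integral_add i12 i3, integral_add i1 i2, integral_const_mul,
        integral_prod_mul, integral_Sc, mul_zero, mul_zero, add_zero]
      have e1 := integral_fun_fst (μ := walkLaw d) (ν := walkLaw d) (fun v => ψ v ^ 2)
      have e2 := integral_fun_snd (μ := walkLaw d) (ν := walkLaw d) (fun u => Sc K L u ^ 2)
      simp only [probReal_univ, one_smul] at e1 e2
      rw [e1, e2]
    have h3 : ∫ v, ψ v ^ 2 ∂(walkLaw d) ≤ ((L : ℝ) + 1) ^ 2 := by
      calc ∫ v, ψ v ^ 2 ∂(walkLaw d) ≤ ∫ v, ((L : ℝ) + 1) ^ 2 ∂(walkLaw d) := by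
            refine integral_mono (integrable_bdd (mψ.pow_const 2) ((L + 1) ^ 2) fun p => by
              rw [abs_pow]; exact pow_le_pow_left₀ (abs_nonneg _) (bψ _) 2) (integrable_const _) ?_
            intro v
            show ψ v ^ 2 ≤ _
            rw [← sq_abs]
            exact pow_le_pow_left₀ (abs_nonneg _) (bψ _) 2
        _ = _ := by simp
    rw [h1, h2]
    push_cast
    linarith

lemma Zs_toReal {d : ℕ} [NeZero d] (K L : ℕ) (u : ℕ → Stp d) :
    (Zs (d := d) K L u).toReal = Sc K L u + K * aR d L := by
  unfold Zs Sc blk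
  rw [ENNReal.toReal_sum fun i _ => capE_ne_top _, Finset.sum_sub_distrib]
  simp

lemma Zs_ne_top {d : ℕ} [NeZero d] (K L : ℕ) (u : ℕ → Stp d) : Zs (d := d) K L u ≠ ⊤ :=
  ENNReal.sum_ne_top.mpr fun i _ => capE_ne_top _

lemma Ns_ne_top {d : ℕ} [NeZero d] (K L : ℕ) (u : ℕ → Stp d) : Ns (d := d) K L u ≠ ⊤ :=
  ENNReal.sum_ne_top.mpr fun i _ => ENNReal.sum_ne_top.mpr fun i _ =>
    ne_top_of_le_ne_top (capE_ne_top _) (IE_le_capE _ _)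

lemma measurable_Ns {d : ℕ} [NeZero d] (K L : ℕ) : Measurable (Ns (d := d) K L) :=
  Finset.measurable_sum _ fun i _ => Finset.measurable_sum _ fun j _ => measurable_IEwr _ _ _ _

/-- Truncated capacity of the range, as a real random variable. -/
def XR {d : ℕ} [NeZero d] (n T : ℕ) (u : ℕ → Stp d) : ℝ := (capT n (wr (0 : Zd d) u 0 T)).toReal

lemma measurable_XR {d : ℕ} [NeZero d] (n T : ℕ) : Measurable (XR (d := d) n T) := by
  have h : Measurable (fun u => capT n (wr (0 : Zd d) u 0 T)) :=
    (Measurable.of_discrete (f := capT n)).comp (measurable_wr 0 0 T)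
  exact h.ennreal_toReal

lemma integrable_XR {d : ℕ} [NeZero d] (n T : ℕ) : Integrable (XR n T) (walkLaw d) :=
  integrable_bdd (measurable_XR _ _) (T + 1) fun u => by
    rw [abs_of_nonneg (show 0 ≤ XR n T u from ENNReal.toReal_nonneg)]
    have h : capT n (wr (0 : Zd d) u 0 T) ≤ ((T + 1 : ℕ) : ℝ≥0∞) := by
      refine (capT_le_card n _).trans ?_
      have := card_wr_le (0 : Zd d) u 0 T
      rw [zero_add] at this
      exact_mod_cast this
    have := ENNReal.toReal_mono (ENNReal.natCast_ne_top (T + 1)) h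
    rw [ENNReal.toReal_natCast] at this
    exact_mod_cast this

/-- The deterministic error term. -/
def Dr (C β : ℝ) (n K L T : ℕ) : ℝ :=
  K * ((L : ℝ) + 1) ^ 2 * (C * ((n : ℝ) + 1) ^ (-β)) + ((T : ℝ) - K * L + 1)

lemma XR_upper {d : ℕ} [NeZero d] {C β : ℝ} (hC : 0 < C)
    (hG : ∀ n (x y : Zd d), ∑' t, pk (n + t) x y ≤ ENNReal.ofReal (C * ((n : ℝ) + 1) ^ (-β)))
    (n K L T : ℕ) (hL : 0 < L) (hT : K * L ≤ T) (u : ℕ → Stp d) :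
    XR n T u ≤ Sc K L u + K * aR d L + Dr C β n K L T := by
  have h := capT_upper hG n K L T hL hT u
  have hpos : 0 ≤ C * ((n : ℝ) + 1) ^ (-β) := by positivity
  have e : (K * ((L : ℝ≥0∞) + 1) ^ 2 * ENNReal.ofReal (C * ((n : ℝ) + 1) ^ (-β)) +
      ((T - K * L : ℕ) + 1)) = ENNReal.ofReal (Dr C β n K L T) := by
    unfold Dr
    have hTr : (T : ℝ) - K * L = ((T - K * L : ℕ) : ℝ) := by
      rw [Nat.cast_sub hT]; push_cast; ring
    rw [hTr]
    generalize C * ((n : ℝ) + 1) ^ (-β) = g at hpos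
    rw [ENNReal.ofReal_add (by positivity) (by positivity), ENNReal.ofReal_mul (by positivity),
      ENNReal.ofReal_mul (by positivity), ENNReal.ofReal_pow (by positivity),
      ENNReal.ofReal_add (by positivity) (by positivity),
      ENNReal.ofReal_add (by positivity) (by positivity)]
    simp
  have hD : 0 ≤ Dr C β n K L T := by
    unfold Dr
    have : ((K * L : ℕ) : ℝ) ≤ T := by exact_mod_cast hT
    push_cast at this
    have h2 : 0 ≤ K * ((L : ℝ) + 1) ^ 2 * (C * ((n : ℝ) + 1) ^ (-β)) := by positivity
    linarith
  rw [e] at h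
  have h3 := ENNReal.toReal_mono
    (ENNReal.add_ne_top.mpr ⟨Zs_ne_top K L u, ENNReal.ofReal_ne_top⟩) h
  rw [ENNReal.toReal_add (Zs_ne_top K L u) ENNReal.ofReal_ne_top, ENNReal.toReal_ofReal hD,
    Zs_toReal] at h3
  exact h3

lemma XR_lower {d : ℕ} [NeZero d] (hg : ∀ x y : Zd d, gE x y ≠ ⊤) (n K L T : ℕ)
    (hT : K * L ≤ T) (u : ℕ → Stp d) :
    Sc K L u + K * aR d L ≤ XR n T u + (Ns (d := d) K L u).toReal := by
  have h := ENNReal.toReal_mono (ENNReal.add_ne_top.mpr ⟨capT_ne_top _ _, Ns_ne_top K L u⟩)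
    (capT_lower hg n K L T hT u)
  rwa [ENNReal.toReal_add (capT_ne_top _ _) (Ns_ne_top K L u), Zs_toReal] at h

lemma integral_XR_bounds {d : ℕ} [NeZero d] {C β : ℝ} (hC : 0 < C)
    (hG : ∀ n (x y : Zd d), ∑' t, pk (n + t) x y ≤ ENNReal.ofReal (C * ((n : ℝ) + 1) ^ (-β)))
    (n K L T : ℕ) (hL : 0 < L) (hT : K * L ≤ T) :
    aR d T ≤ ∫ u, XR n T u ∂(walkLaw d) ∧
      ∫ u, XR n T u ∂(walkLaw d) ≤ K * aR d L + Dr C β n K L T := by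
  constructor
  · have := integral_blk (d := d) 0 T
    rw [← this]
    refine integral_mono (integrable_blk _ _) (integrable_XR _ _) fun u => ?_
    unfold blk XR
    rw [zero_add]
    exact ENNReal.toReal_mono (capT_ne_top _ _) (capE_le_capT _ _)
  · have iS : Integrable (Sc (d := d) K L) (walkLaw d) :=
      integrable_bdd (measurable_Sc K L) _ (Sc_bdd K L)
    calc ∫ u, XR n T u ∂(walkLaw d) ≤
        ∫ u, (Sc K L u + (K * aR d L + Dr C β n K L T)) ∂(walkLaw d) := by
          refine integral_mono (integrable_XR _ _) (iS.add (integrable_const _)) fun u => ?_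
          have := XR_upper hC hG n K L T hL hT u
          show XR n T u ≤ Sc K L u + (K * aR d L + Dr C β n K L T)
          linarith
      _ = _ := by
          rw [integral_add iS (integrable_const _), integral_Sc]
          simp

lemma prob_dev {d : ℕ} [NeZero d] {C β : ℝ} (hC : 0 < C)
    (hG : ∀ n (x y : Zd d), ∑' t, pk (n + t) x y ≤ ENNReal.ofReal (C * ((n : ℝ) + 1) ^ (-β)))
    (hg : ∀ x y : Zd d, gE x y ≠ ⊤)
    (n K L T : ℕ) (hL : 0 < L) (hT : K * L ≤ T) (δ : ℝ) (hδ : 0 < δ) (ha : 0 < aR d T)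
    (hdev : |K * aR d L - aR d T| + Dr C β n K L T ≤ δ / 2 * aR d T)
    (E : ℝ) (hE0 : 0 ≤ E)
    (hE : ∫⁻ u, Ns (d := d) K L u ∂(walkLaw d) ≤ ENNReal.ofReal E) :
    ((walkLaw d) {u | δ * aR d T < |XR n T u - aR d T|}).toReal ≤
      16 * (K * ((L : ℝ) + 1) ^ 2) / (δ * aR d T) ^ 2 + 4 * E / (δ * aR d T) := by
  set a := aR d T with hadef
  have hδa : 0 < δ * a := mul_pos hδ ha
  have hsub : {u | δ * a < |XR n T u - a|} ⊆
      {u | (δ * a / 4) ^ 2 ≤ Sc (d := d) K L u ^ 2} ∪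
        {u | ENNReal.ofReal (δ * a / 4) ≤ Ns (d := d) K L u} := by
    intro u hu
    by_contra hcon
    simp only [Set.mem_union, Set.mem_ofPred_eq, not_or, not_le] at hcon
    obtain ⟨c1, c2⟩ := hcon
    have c1' : |Sc K L u| < δ * a / 4 := by
      have := sq_lt_sq.mp c1
      rwa [abs_of_pos (by positivity : 0 < δ * a / 4)] at this
    have c2' : (Ns (d := d) K L u).toReal < δ * a / 4 :=
      (ENNReal.lt_ofReal_iff_toReal_lt (Ns_ne_top K L u)).mp c2
    have h1 := XR_upper hC hG n K L T hL hT u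
    have h2 := XR_lower hg n K L T hT u
    have h3 := abs_lt.mp c1'
    have h4 := abs_le.mp (le_refl |K * aR d L - a|)
    have h5 : 0 ≤ |K * aR d L - a| := abs_nonneg _
    have hD : 0 ≤ Dr C β n K L T := by
      unfold Dr
      have : ((K * L : ℕ) : ℝ) ≤ T := by exact_mod_cast hT
      push_cast at this
      have h2 : 0 ≤ K * ((L : ℝ) + 1) ^ 2 * (C * ((n : ℝ) + 1) ^ (-β)) := by positivity
      linarith
    have hu' : δ * a < |XR n T u - a| := hu
    rcases lt_abs.mp hu' with h | h
    · linarith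
    · linarith
  have p1 : ((walkLaw d) {u | (δ * a / 4) ^ 2 ≤ Sc (d := d) K L u ^ 2}).toReal ≤
      16 * (K * ((L : ℝ) + 1) ^ 2) / (δ * a) ^ 2 := by
    have iS2 : Integrable (fun u => Sc (d := d) K L u ^ 2) (walkLaw d) :=
      integrable_bdd ((measurable_Sc K L).pow_const 2) ((K * (L + 1)) ^ 2) fun p => by
        rw [abs_pow]; exact pow_le_pow_left₀ (abs_nonneg _) (Sc_bdd K L _) 2
    have := mul_meas_ge_le_integral_of_nonneg (Eventually.of_forall fun u => sq_nonneg (Sc (d := d) K L u)) iS2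
      ((δ * a / 4) ^ 2)
    have h2 := this.trans (integral_Sc_sq K L)
    rw [le_div_iff₀ (by positivity)]
    simp only [measureReal_def] at h2
    nlinarith
  have p2 : ((walkLaw d) {u | ENNReal.ofReal (δ * a / 4) ≤ Ns (d := d) K L u}).toReal ≤
      4 * E / (δ * a) := by
    have := mul_meas_ge_le_lintegral (μ := walkLaw d) (measurable_Ns (d := d) K L)
      (ENNReal.ofReal (δ * a / 4))
    have h2 := ENNReal.toReal_mono ENNReal.ofReal_ne_top (this.trans hE)
    rw [ENNReal.toReal_mul, ENNReal.toReal_ofReal (by positivity), ENNReal.toReal_ofReal hE0] at h2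
    rw [le_div_iff₀ hδa]
    linarith
  calc _ ≤ ((walkLaw d) {u | (δ * a / 4) ^ 2 ≤ Sc (d := d) K L u ^ 2} +
        (walkLaw d) {u | ENNReal.ofReal (δ * a / 4) ≤ Ns (d := d) K L u}).toReal :=
        ENNReal.toReal_mono (ENNReal.add_ne_top.mpr ⟨measure_ne_top _ _, measure_ne_top _ _⟩)
          ((measure_mono hsub).trans (measure_union_le _ _))
    _ = _ := ENNReal.toReal_add (measure_ne_top _ _) (measure_ne_top _ _)
    _ ≤ _ := add_le_add p1 p2

/-! ### Conversion to the statement's definitions -/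

lemma measurableSet_NoReturn {d : ℕ} (A : Set (Zd d)) : MeasurableSet (NoReturn A) := by
  have : NoReturn A = ⋂ (t : ℕ) (_ : 0 < t), (fun ω : ℕ → Zd d => ω t) ⁻¹' Aᶜ := by
    ext ω; simp [NoReturn]
  rw [this]
  exact MeasurableSet.iInter fun t => MeasurableSet.iInter fun _ =>
    measurable_pi_apply t (MeasurableSet.of_discrete (s := Aᶜ))

lemma measurableSet_NoReturnUpTo {d : ℕ} (A : Set (Zd d)) (s : ℝ) :
    MeasurableSet (NoReturnUpTo A s) := by
  have : NoReturnUpTo A s =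
      ⋂ (t : ℕ) (_ : 0 < t) (_ : (t : ℝ) ≤ s), (fun ω : ℕ → Zd d => ω t) ⁻¹' Aᶜ := by
    ext ω; simp [NoReturnUpTo]
  rw [this]
  exact MeasurableSet.iInter fun t => MeasurableSet.iInter fun _ => MeasurableSet.iInter fun _ =>
    measurable_pi_apply t (MeasurableSet.of_discrete (s := Aᶜ))

/-- The truncation time. -/
def sT (r : ℝ) (T : ℕ) : ℝ := r * T / (Real.log (r * T)) ^ (10 : ℕ)

lemma sT_nonneg {r : ℝ} (hr : 0 < r) (T : ℕ) : 0 ≤ sT r T := by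
  unfold sT
  refine div_nonneg (by positivity) ?_
  have : (Real.log (r * T)) ^ (10 : ℕ) = ((Real.log (r * T)) ^ 5) ^ 2 := by ring
  rw [this]; positivity

lemma capacity_eq {d : ℕ} [NeZero d] {Pw : Zd d → Measure (ℕ → Zd d)} (hPw : IsSRWFamily d Pw)
    (A : Finset (Zd d)) : capacity Pw A = (capE A).toReal := by
  unfold capacity capE
  rw [ENNReal.toReal_sum fun x _ => ne_top_of_le_ne_top ENNReal.one_ne_top (show eE (↑A) x ≤ 1 from prob_le_one)]
  refine Finset.sum_congr rfl fun x hx => ?_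
  unfold equil
  rw [if_pos (by exact_mod_cast hx), srw_eq_map (hPw x),
    Measure.map_apply (measurable_path x) (measurableSet_NoReturn _)]
  rfl

lemma capTrunc_eq {d : ℕ} [NeZero d] {Pw : Zd d → Measure (ℕ → Zd d)} (hPw : IsSRWFamily d Pw)
    {r : ℝ} (hr : 0 < r) (T : ℕ) (A : Finset (Zd d)) :
    capTrunc Pw A (r * T) = (capT ⌊sT r T⌋₊ A).toReal := by
  unfold capTrunc capT
  rw [ENNReal.toReal_sum fun x _ => ne_top_of_le_ne_top ENNReal.one_ne_top (eT_le_one ⌊sT r T⌋₊ (↑A) x)]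
  refine Finset.sum_congr rfl fun x hx => ?_
  rw [srw_eq_map (hPw x),
    Measure.map_apply (measurable_path x) (measurableSet_NoReturnUpTo _ _)]
  unfold eT NoReturnUpTo
  congr 2
  ext u
  have : ∀ t : ℕ, (t : ℝ) ≤ r * T / (Real.log (r * T)) ^ (10 : ℕ) ↔ t ≤ ⌊sT r T⌋₊ := fun t =>
    (Nat.le_floor_iff (sT_nonneg hr T)).symm
  simp [this]

lemma capExpect_eq {d : ℕ} [NeZero d] {Pw : Zd d → Measure (ℕ → Zd d)} (hPw : IsSRWFamily d Pw)
    (T : ℕ) : capExpect Pw T = aR d T := by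
  have e : ∀ ω : ℕ → Zd d, capacity Pw (walkRange ω 0 T) = (capE (walkRange ω 0 T)).toReal :=
    fun ω => capacity_eq hPw _
  have h : Measurable (fun ω : ℕ → Zd d => (capE (walkRange ω 0 T)).toReal) := by
    have : Measurable (fun ω : ℕ → Zd d => capE (walkRange ω 0 T)) :=
      (Measurable.of_discrete (f := capE)).comp (measurable_walkRange 0 T)
    exact this.ennreal_toReal
  unfold capExpect
  simp only [e]
  rw [srw_eq_map (hPw 0), integral_map (measurable_path 0).aemeasurable h.aestronglyMeasurable]
  have := integral_blk (d := d) 0 T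
  rw [zero_add] at this
  exact this

lemma intTrunc_eq {d : ℕ} [NeZero d] {Pw : Zd d → Measure (ℕ → Zd d)} (hPw : IsSRWFamily d Pw)
    {r : ℝ} (hr : 0 < r) (T : ℕ) :
    ∫ ω, capTrunc Pw (walkRange ω 0 T) (r * T) ∂ (Pw 0) =
      ∫ u, XR ⌊sT r T⌋₊ T u ∂(walkLaw d) := by
  have h : Measurable (fun ω : ℕ → Zd d => (capT ⌊sT r T⌋₊ (walkRange ω 0 T)).toReal) := by
    have : Measurable (fun ω : ℕ → Zd d => capT ⌊sT r T⌋₊ (walkRange ω 0 T)) :=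
      (Measurable.of_discrete (f := capT ⌊sT r T⌋₊)).comp (measurable_walkRange 0 T)
    exact this.ennreal_toReal
  simp only [capTrunc_eq hPw hr T]
  rw [srw_eq_map (hPw 0), integral_map (measurable_path 0).aemeasurable h.aestronglyMeasurable]
  rfl

lemma probTrunc_eq {d : ℕ} [NeZero d] {Pw : Zd d → Measure (ℕ → Zd d)} (hPw : IsSRWFamily d Pw)
    {r : ℝ} (hr : 0 < r) (T : ℕ) (δ : ℝ) :
    (Pw 0) {ω | δ * capExpect Pw T <
          |capTrunc Pw (walkRange ω 0 T) (r * T) - capExpect Pw T|} =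
      (walkLaw d) {u | δ * aR d T < |XR ⌊sT r T⌋₊ T u - aR d T|} := by
  have h : Measurable (fun ω : ℕ → Zd d => (capT ⌊sT r T⌋₊ (walkRange ω 0 T)).toReal) := by
    have : Measurable (fun ω : ℕ → Zd d => capT ⌊sT r T⌋₊ (walkRange ω 0 T)) :=
      (Measurable.of_discrete (f := capT ⌊sT r T⌋₊)).comp (measurable_walkRange 0 T)
    exact this.ennreal_toReal
  have h2 : Measurable (fun ω : ℕ → Zd d =>
      |(capT ⌊sT r T⌋₊ (walkRange ω 0 T)).toReal - aR d T|) := by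
    have h3 : Measurable (fun ω : ℕ → Zd d =>
      (capT ⌊sT r T⌋₊ (walkRange ω 0 T)).toReal - aR d T) := h.sub_const _
    simpa [Real.norm_eq_abs] using h3.norm
  simp only [capTrunc_eq hPw hr T, capExpect_eq hPw]
  rw [srw_eq_map (hPw 0), Measure.map_apply (measurable_path 0)
    (measurableSet_lt measurable_const h2)]
  rfl

/-! ### Estimates for the mean interaction between blocks -/

lemma expE_eq {d : ℕ} [NeZero d] (m : ℕ) : expE d m = ENNReal.ofReal (aR d m) :=
  (ENNReal.ofReal_toReal (expE_ne_top m)).symm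

lemma lint_Ns_real {d : ℕ} [NeZero d] {C β : ℝ} (hC : 0 < C) (hβ : 0 ≤ β)
    (hG : ∀ n (x y : Zd d), ∑' t, pk (n + t) x y ≤ ENNReal.ofReal (C * ((n : ℝ) + 1) ^ (-β)))
    (K M m : ℕ) (hM : 0 < M) (hm : 0 < m) :
    ∫⁻ u, Ns (d := d) K (M * m) u ∂(walkLaw d) ≤
      ENNReal.ofReal (2 * K * ((m + 1) + (aR d m) ^ 2 * (C * (m : ℝ) ^ (-β)) *
        ∑ v ∈ Finset.range (M + K * M), ((min M (v + 2) : ℕ) : ℝ) * ((v : ℝ) + 1) ^ (-β))) := by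
  refine (lint_Ns hG K M m hM hm).trans ?_
  have ha := aR_nonneg (d := d) m
  have key : ∑ v ∈ Finset.range (M + K * M), ((min M (v + 1) : ℕ) : ℝ≥0∞) *
        hh d (fun n => ENNReal.ofReal (C * ((n : ℝ) + 1) ^ (-β))) m v ≤
      ENNReal.ofReal ((m + 1) + (aR d m) ^ 2 * (C * (m : ℝ) ^ (-β)) *
        ∑ v ∈ Finset.range (M + K * M), ((min M (v + 2) : ℕ) : ℝ) * ((v : ℝ) + 1) ^ (-β)) := by
    calc _ ≤ ∑ v ∈ Finset.range (M + K * M + 1), ((min M (v + 1) : ℕ) : ℝ≥0∞) *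
        hh d (fun n => ENNReal.ofReal (C * ((n : ℝ) + 1) ^ (-β))) m v :=
          Finset.sum_le_sum_of_subset (Finset.range_mono (Nat.le_succ _))
      _ = ∑ v ∈ Finset.range (M + K * M), ((min M (v + 1 + 1) : ℕ) : ℝ≥0∞) *
          hh d (fun n => ENNReal.ofReal (C * ((n : ℝ) + 1) ^ (-β))) m (v + 1) +
          ((min M (0 + 1) : ℕ) : ℝ≥0∞) *
            hh d (fun n => ENNReal.ofReal (C * ((n : ℝ) + 1) ^ (-β))) m 0 :=
          Finset.sum_range_succ' _ _
      _ ≤ ∑ v ∈ Finset.range (M + K * M), ENNReal.ofReal ((aR d m) ^ 2 * (C * (m : ℝ) ^ (-β)) *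
          (((min M (v + 2) : ℕ) : ℝ) * ((v : ℝ) + 1) ^ (-β))) + ENNReal.ofReal (m + 1) := by
          refine add_le_add (Finset.sum_le_sum fun v _ => ?_) ?_
          · unfold hh
            rw [if_neg (Nat.succ_ne_zero v), expE_eq, ← ENNReal.ofReal_mul ha,
              ← ENNReal.ofReal_mul ha, ← ENNReal.ofReal_natCast,
              ← ENNReal.ofReal_mul (by positivity)]
            refine ENNReal.ofReal_le_ofReal ?_
            have hmr : (0 : ℝ) < m := by exact_mod_cast hm
            have h1 : ((((v + 1) * m : ℕ) : ℝ) + 1) ^ (-β) ≤ ((v : ℝ) + 1) ^ (-β) * (m : ℝ) ^ (-β) := by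
              rw [← Real.mul_rpow (by positivity) hmr.le]
              refine Real.rpow_le_rpow_of_nonpos (by positivity) ?_ (by linarith)
              push_cast; linarith
            calc _ ≤ ((min M (v + 1 + 1) : ℕ) : ℝ) * (aR d m * (aR d m * (C *
                  (((v : ℝ) + 1) ^ (-β) * (m : ℝ) ^ (-β))))) := by gcongr
              _ = _ := by ring
          · unfold hh
            rw [if_pos rfl]
            have : ((min M (0 + 1) : ℕ) : ℝ≥0∞) ≤ 1 := by
              exact_mod_cast (min_le_right M (0 + 1))
            calc _ ≤ 1 * ((m : ℝ≥0∞) + 1) := by gcongr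
              _ = _ := by
                rw [one_mul, ENNReal.ofReal_add (by positivity) (by positivity)]; simp
      _ = _ := by
          rw [← ENNReal.ofReal_sum_of_nonneg fun v _ => by positivity, add_comm,
            ← ENNReal.ofReal_add (by positivity) (Finset.sum_nonneg fun v _ => by positivity),
            Finset.mul_sum]
  rw [ENNReal.ofReal_mul (by positivity)]
  refine mul_le_mul' (le_of_eq ?_) key
  rw [ENNReal.ofReal_mul (by norm_num)]; simp

lemma sum_w_one (M j : ℕ) (hM : 0 < M) :
    ∑ v ∈ Finset.range (M + j), ((min M (v + 2) : ℕ) : ℝ) * ((v : ℝ) + 1) ^ (-(1 : ℝ)) ≤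
      2 * M + M * (Real.log ((M : ℝ) + j) - Real.log M) := by
  induction j with
  | zero =>
    simp only [add_zero, Nat.cast_zero, sub_self, mul_zero]
    calc _ ≤ ∑ v ∈ Finset.range M, (2 : ℝ) := by
          refine Finset.sum_le_sum fun v _ => ?_
          rw [Real.rpow_neg_one, ← div_eq_mul_inv, div_le_iff₀ (by positivity)]
          have : ((min M (v + 2) : ℕ) : ℝ) ≤ (v : ℝ) + 2 := by exact_mod_cast min_le_right _ _
          have hv : (0 : ℝ) ≤ v := by positivity
          linarith
      _ = _ := by simp [mul_comm]
  | succ j ih =>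
    rw [← add_assoc, Finset.sum_range_succ]
    have h1 : ((min M (M + j + 2) : ℕ) : ℝ) = M := by
      rw [min_eq_left (by omega)]
    rw [h1, Real.rpow_neg_one]
    push_cast at ih ⊢
    have hp : (0 : ℝ) < (M : ℝ) + j := by
      have : (0 : ℝ) < M := by exact_mod_cast hM
      positivity
    have h2 : ((M : ℝ) + j + 1)⁻¹ ≤ Real.log ((M : ℝ) + j + 1) - Real.log ((M : ℝ) + j) := by
      have := Real.one_sub_inv_le_log_of_pos (x := ((M : ℝ) + j + 1) / ((M : ℝ) + j)) (by positivity)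
      rw [Real.log_div (by positivity) (by positivity)] at this
      refine le_trans (le_of_eq ?_) this
      field_simp
      ring
    have h3 : (M : ℝ) * ((M : ℝ) + j + 1)⁻¹ ≤
        M * (Real.log ((M : ℝ) + j + 1) - Real.log ((M : ℝ) + j)) := by gcongr
    rw [← add_assoc]
    linarith

lemma sqrt_step (v : ℝ) (hv : 0 ≤ v) : 1 / (2 * √(v + 1)) ≤ √(v + 1) - √v := by
  have h1 : √v ≤ √(v + 1) := Real.sqrt_le_sqrt (by linarith)
  have h0 : 0 ≤ √v := Real.sqrt_nonneg _
  have h2 : √(v + 1) ^ 2 = v + 1 := Real.sq_sqrt (by linarith)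
  have h3 : √v ^ 2 = v := Real.sq_sqrt hv
  have h4 : 0 < √(v + 1) := Real.sqrt_pos.mpr (by linarith)
  rw [div_le_iff₀ (by positivity)]
  nlinarith

lemma rpow_three_half (v : ℝ) (hv : 0 ≤ v) : (v + 1) ^ (-(3 / 2 : ℝ)) = 1 / ((v + 1) * √(v + 1)) := by
  rw [Real.rpow_neg (by linarith), one_div, show (3 / 2 : ℝ) = 1 + 1 / 2 by norm_num,
    Real.rpow_add (by linarith), Real.rpow_one, Real.sqrt_eq_rpow]

lemma sum_w_three_half (M j : ℕ) (hM : 0 < M) :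
    ∑ v ∈ Finset.range (M + j), ((min M (v + 2) : ℕ) : ℝ) * ((v : ℝ) + 1) ^ (-(3 / 2 : ℝ)) ≤
      4 * √M + 2 * M * (1 / √M - 1 / √((M : ℝ) + j)) := by
  induction j with
  | zero =>
    simp only [add_zero, Nat.cast_zero, sub_self, mul_zero]
    have key : ∀ n : ℕ, ∑ v ∈ Finset.range n,
        ((min M (v + 2) : ℕ) : ℝ) * ((v : ℝ) + 1) ^ (-(3 / 2 : ℝ)) ≤ 4 * √n := by
      intro n
      induction n with
      | zero => simp
      | succ n ih =>
        rw [Finset.sum_range_succ]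
        have hn : (0 : ℝ) ≤ n := by positivity
        have h1 : ((min M (n + 2) : ℕ) : ℝ) ≤ 2 * ((n : ℝ) + 1) := by
          have : ((min M (n + 2) : ℕ) : ℝ) ≤ (n : ℝ) + 2 := by exact_mod_cast min_le_right _ _
          linarith
        have hs : 0 < √((n : ℝ) + 1) := Real.sqrt_pos.mpr (by linarith)
        have h2 : ((min M (n + 2) : ℕ) : ℝ) * ((n : ℝ) + 1) ^ (-(3 / 2 : ℝ)) ≤
            4 * (1 / (2 * √((n : ℝ) + 1))) := by
          rw [rpow_three_half _ hn]
          calc _ ≤ 2 * ((n : ℝ) + 1) * (1 / (((n : ℝ) + 1) * √((n : ℝ) + 1))) := by gcongr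
            _ = _ := by field_simp; ring
        have h3 := sqrt_step n hn
        push_cast at ih h2 ⊢
        linarith
    exact key M
  | succ j ih =>
    rw [← add_assoc, Finset.sum_range_succ]
    have h1 : ((min M (M + j + 2) : ℕ) : ℝ) = M := by
      rw [min_eq_left (by omega)]
    rw [h1]
    have hM' : (0 : ℝ) < M := by exact_mod_cast hM
    have hp : (0 : ℝ) < ((M + j : ℕ) : ℝ) := by positivity
    rw [rpow_three_half _ hp.le]
    have e : ((M : ℝ) + ((j + 1 : ℕ) : ℝ)) = ((M + j : ℕ) : ℝ) + 1 := by push_cast; ring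
    have e' : ((M : ℝ) + (j : ℝ)) = ((M + j : ℕ) : ℝ) := by push_cast; ring
    rw [e]
    rw [e'] at ih
    generalize ((M + j : ℕ) : ℝ) = w at *
    have hs := sqrt_step w hp.le
    have s0 : 0 < √w := Real.sqrt_pos.mpr hp
    have s1 : 0 < √(w + 1) := Real.sqrt_pos.mpr (by linarith)
    have s2 : √w ≤ √(w + 1) := Real.sqrt_le_sqrt (by linarith)
    have h2 : √(w + 1) ^ 2 = w + 1 := Real.sq_sqrt (by linarith)
    have h3 : 1 / ((w + 1) * √(w + 1)) ≤ 2 * (1 / √w - 1 / √(w + 1)) := by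
      rw [div_sub_div _ _ s0.ne' s1.ne', one_mul, mul_one]
      calc 1 / ((w + 1) * √(w + 1)) = 2 * ((1 / (2 * √(w + 1))) / (√(w + 1) * √(w + 1))) := by
            rw [← sq √(w + 1), h2]; field_simp
        _ ≤ 2 * ((√(w + 1) - √w) / (√w * √(w + 1))) := by
            gcongr
    have h4 : (M : ℝ) * (1 / ((w + 1) * √(w + 1))) ≤ M * (2 * (1 / √w - 1 / √(w + 1))) := by gcongr
    linarith

lemma EN_four {d : ℕ} [NeZero d] {C : ℝ} (hC : 0 < C)
    (hG : ∀ n (x y : Zd d), ∑' t, pk (n + t) x y ≤ ENNReal.ofReal (C * ((n : ℝ) + 1) ^ (-(1 : ℝ))))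
    (K M m : ℕ) (hM : 0 < M) (hm : 0 < m) :
    ∫⁻ u, Ns (d := d) K (M * m) u ∂(walkLaw d) ≤
      ENNReal.ofReal (2 * K * ((m + 1) + (aR d m) ^ 2 * (C / m) *
        (M * (2 + Real.log (1 + K))))) := by
  refine (lint_Ns_real hC zero_le_one hG K M m hM hm).trans (ENNReal.ofReal_le_ofReal ?_)
  have h := sum_w_one M (K * M) hM
  have hM' : (0 : ℝ) < M := by exact_mod_cast hM
  have e : (M : ℝ) + ((K * M : ℕ) : ℝ) = M * (1 + K) := by push_cast; ring
  rw [e, Real.log_mul hM'.ne' (by positivity)] at h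
  have h' : ∑ v ∈ Finset.range (M + K * M), ((min M (v + 2) : ℕ) : ℝ) * ((v : ℝ) + 1) ^ (-(1 : ℝ))
      ≤ M * (2 + Real.log (1 + K)) := by linarith
  rw [Real.rpow_neg_one, ← div_eq_mul_inv]
  gcongr

lemma EN_five {d : ℕ} [NeZero d] {C : ℝ} (hC : 0 < C)
    (hG : ∀ n (x y : Zd d), ∑' t, pk (n + t) x y ≤
      ENNReal.ofReal (C * ((n : ℝ) + 1) ^ (-(3 / 2 : ℝ))))
    (q : ℕ) (hq : 0 < q) :
    ∫⁻ u, Ns (d := d) q (q ^ 2 * q) u ∂(walkLaw d) ≤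
      ENNReal.ofReal ((4 + 48 * C) * q ^ 3) := by
  refine (lint_Ns_real hC (by norm_num) hG q (q ^ 2) q (by positivity) hq).trans
    (ENNReal.ofReal_le_ofReal ?_)
  have h := sum_w_three_half (q ^ 2) (q * q ^ 2) (by positivity)
  have hq' : (1 : ℝ) ≤ q := by exact_mod_cast hq
  have e : √((q ^ 2 : ℕ) : ℝ) = q := by
    push_cast; exact Real.sqrt_sq (by positivity)
  rw [e] at h
  have h' : ∑ v ∈ Finset.range (q ^ 2 + q * q ^ 2),
      ((min (q ^ 2) (v + 2) : ℕ) : ℝ) * ((v : ℝ) + 1) ^ (-(3 / 2 : ℝ)) ≤ 6 * q := by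
    refine h.trans ?_
    have : (0 : ℝ) ≤ 1 / √(((q ^ 2 : ℕ) : ℝ) + ((q * q ^ 2 : ℕ) : ℝ)) := by positivity
    have h2 : 2 * ((q ^ 2 : ℕ) : ℝ) * (1 / (q : ℝ) - 1 / √(((q ^ 2 : ℕ) : ℝ) + ((q * q ^ 2 : ℕ) : ℝ)))
        ≤ 2 * ((q ^ 2 : ℕ) : ℝ) * (1 / (q : ℝ)) := by
      gcongr; linarith
    have h3 : 2 * ((q ^ 2 : ℕ) : ℝ) * (1 / (q : ℝ)) = 2 * q := by push_cast; field_simp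
    linarith
  have ha : aR d q ≤ 2 * q := (aR_le q).trans (by linarith)
  have ha0 := aR_nonneg (d := d) q
  have hr : (q : ℝ) ^ (-(3 / 2 : ℝ)) = 1 / (q * √q) := by
    rw [Real.rpow_neg (by linarith), one_div, show (3 / 2 : ℝ) = 1 + 1 / 2 by norm_num,
      Real.rpow_add (by linarith), Real.rpow_one, Real.sqrt_eq_rpow]
  have hs : √(q : ℝ) * √(q : ℝ) = q := Real.mul_self_sqrt (by linarith)
  have hs1 : 0 < √(q : ℝ) := Real.sqrt_pos.mpr (by linarith)
  have hsq : √(q : ℝ) ≤ q := by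
    rw [Real.sqrt_le_left (by linarith)]; nlinarith
  rw [hr]
  have hS0 : 0 ≤ ∑ v ∈ Finset.range (q ^ 2 + q * q ^ 2),
      ((min (q ^ 2) (v + 2) : ℕ) : ℝ) * ((v : ℝ) + 1) ^ (-(3 / 2 : ℝ)) :=
    Finset.sum_nonneg fun v _ => by positivity
  calc _ ≤ 2 * (q : ℝ) * (((q : ℝ) + 1) + (2 * q) ^ 2 * (C * (1 / (q * √q))) * (6 * q)) := by gcongr
    _ = 2 * (q : ℝ) * (((q : ℝ) + 1) + 24 * C * q * √q) := by
        congr 2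
        rw [mul_one_div, mul_div_assoc', div_mul_eq_mul_div, div_eq_iff (by positivity)]
        linear_combination (-24) * C * q ^ 2 * hs
    _ ≤ 2 * (q : ℝ) * ((q * q + q * q) + 24 * C * q * q) := by gcongr <;> nlinarith
    _ = _ := by ring

/-! ### Abstract asymptotics -/

lemma trunc_pow_le {β r : ℝ} (hβ : 1 ≤ β) (hr : 0 < r) :
    ∀ᶠ T : ℕ in atTop, ((⌊sT r T⌋₊ : ℝ) + 1) ^ (-β) ≤ (Real.log (r * T)) ^ 10 / (r * T) := by
  have h1 : Tendsto (fun T : ℕ => r * (T : ℝ)) atTop atTop :=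
    tendsto_natCast_atTop_atTop.const_mul_atTop hr
  filter_upwards [h1.eventually_gt_atTop 1] with T hT
  have hlog : 0 < Real.log (r * T) := Real.log_pos hT
  have hs : 0 < sT r T := by unfold sT; positivity
  calc ((⌊sT r T⌋₊ : ℝ) + 1) ^ (-β) ≤ ((⌊sT r T⌋₊ : ℝ) + 1) ^ (-(1 : ℝ)) :=
        Real.rpow_le_rpow_of_exponent_le (by linarith [Nat.cast_nonneg (α := ℝ) ⌊sT r T⌋₊])
          (by linarith)
    _ = ((⌊sT r T⌋₊ : ℝ) + 1)⁻¹ := Real.rpow_neg_one _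
    _ ≤ (sT r T)⁻¹ := inv_anti₀ hs (Nat.lt_floor_add_one _).le
    _ = _ := by unfold sT; rw [inv_div]

lemma Dr_nonneg {C β : ℝ} (hC : 0 < C) (n K L T : ℕ) (hT : K * L ≤ T) : 0 ≤ Dr C β n K L T := by
  unfold Dr
  have : ((K * L : ℕ) : ℝ) ≤ T := by exact_mod_cast hT
  push_cast at this
  have h2 : 0 ≤ K * ((L : ℝ) + 1) ^ 2 * (C * ((n : ℝ) + 1) ^ (-β)) := by positivity
  linarith

lemma KL_sq {K L T : ℕ} (hK : 0 < K) (hL : 0 < L) (hT : K * L ≤ T) :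
    (K : ℝ) * ((L : ℝ) + 1) ^ 2 ≤ 4 * (T : ℝ) ^ 2 / K := by
  have hK' : (0 : ℝ) < K := by exact_mod_cast hK
  have hL' : (1 : ℝ) ≤ L := by exact_mod_cast hL
  have hT' : (K : ℝ) * L ≤ T := by exact_mod_cast hT
  rw [le_div_iff₀ hK']
  calc (K : ℝ) * ((L : ℝ) + 1) ^ 2 * K ≤ (K : ℝ) * ((L : ℝ) + L) ^ 2 * K := by gcongr
    _ = 4 * ((K : ℝ) * L) ^ 2 := by ring
    _ ≤ 4 * (T : ℝ) ^ 2 := by gcongr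

lemma main_abs {d : ℕ} [NeZero d] {C β : ℝ} (hC : 0 < C) (hβ : 1 ≤ β)
    (hG : ∀ n (x y : Zd d), ∑' t, pk (n + t) x y ≤ ENNReal.ofReal (C * ((n : ℝ) + 1) ^ (-β)))
    (hg : ∀ x y : Zd d, gE x y ≠ ⊤) (r : ℝ) (hr : 0 < r) (ε : ℝ) (hε : 0 < ε) (f : ℕ → ℝ)
    (hf : ∀ᶠ T in atTop, 1 ≤ f T)
    (hlim : Tendsto (fun T : ℕ => aR d T * f T / T) atTop (𝓝 ε)) (K L : ℕ → ℕ)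
    (hpos : ∀ᶠ T in atTop, 0 < K T ∧ 0 < L T ∧ K T * L T ≤ T)
    (hL : Tendsto L atTop atTop)
    (hR : Tendsto (fun T : ℕ => ((T : ℝ) - K T * L T + 1) * f T / T) atTop (𝓝 0))
    (hK : Tendsto (fun T : ℕ => (Real.log (r * T)) ^ 10 * f T / K T) atTop (𝓝 0))
    (hfL : Tendsto (fun T : ℕ => f T / f (L T)) atTop (𝓝 1)) :
    Tendsto (fun T : ℕ => (∫ u, XR ⌊sT r T⌋₊ T u ∂(walkLaw d)) * f T / T) atTop (𝓝 ε) ∧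
    ∀ δ : ℝ, 0 < δ → ∀ᶠ T : ℕ in atTop, ∀ E : ℝ, 0 ≤ E →
      ∫⁻ u, Ns (d := d) (K T) (L T) u ∂(walkLaw d) ≤ ENNReal.ofReal E →
      ((walkLaw d) {u | δ * aR d T < |XR ⌊sT r T⌋₊ T u - aR d T|}).toReal ≤
        256 / (δ * ε) ^ 2 * (f T ^ 2 / K T) + 8 / (δ * ε) * (E * f T / T) := by
  have hKL : Tendsto (fun T : ℕ => (K T : ℝ) * L T / T) atTop (𝓝 1) := by
    have h0 : Tendsto (fun T : ℕ => 1 - ((T : ℝ) - K T * L T + 1) * f T / T) atTop (𝓝 1) := by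
      simpa using hR.const_sub 1
    refine tendsto_of_tendsto_of_tendsto_of_le_of_le' h0 tendsto_const_nhds ?_ ?_
    · filter_upwards [hpos, hf, eventually_gt_atTop 0] with T ⟨_, _, h3⟩ h4 h5
      have hT : (0 : ℝ) < T := by exact_mod_cast h5
      have h3' : (K T : ℝ) * L T ≤ T := by exact_mod_cast h3
      rw [sub_le_iff_le_add, ← add_div, le_div_iff₀ hT]
      have := le_mul_of_one_le_right (by linarith : (0 : ℝ) ≤ (T : ℝ) - K T * L T + 1) h4
      linarith
    · filter_upwards [hpos, eventually_gt_atTop 0] with T ⟨_, _, h3⟩ h5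
      have hT : (0 : ℝ) < T := by exact_mod_cast h5
      have h3' : (K T : ℝ) * L T ≤ T := by exact_mod_cast h3
      rw [div_le_one hT]; exact h3'
  have hA : Tendsto (fun T : ℕ => K T * aR d (L T) * f T / T) atTop (𝓝 ε) := by
    have h0 := ((hlim.comp hL).mul hKL).mul hfL
    simp only [mul_one] at h0
    refine h0.congr' ?_
    filter_upwards [hpos, hL.eventually hf, eventually_gt_atTop 0] with T ⟨_, h2, h3⟩ h4 h5
    have hT : (0 : ℝ) < T := by exact_mod_cast h5
    have hL' : (0 : ℝ) < L T := by exact_mod_cast h2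
    simp only [Function.comp]
    have : f (L T) ≠ 0 := by linarith
    field_simp
  set D : ℕ → ℝ := fun T => Dr C β ⌊sT r T⌋₊ (K T) (L T) T with hDdef
  have hD0 : ∀ᶠ T in atTop, 0 ≤ D T := by
    filter_upwards [hpos] with T ⟨_, _, h3⟩
    exact Dr_nonneg hC _ _ _ _ h3
  have hD : Tendsto (fun T : ℕ => D T * f T / T) atTop (𝓝 0) := by
    have h0 : Tendsto (fun T : ℕ => 4 * C / r * ((Real.log (r * T)) ^ 10 * f T / K T) +
        ((T : ℝ) - K T * L T + 1) * f T / T) atTop (𝓝 0) := by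
      simpa using (hK.const_mul (4 * C / r)).add hR
    refine tendsto_of_tendsto_of_tendsto_of_le_of_le' tendsto_const_nhds h0 ?_ ?_
    · filter_upwards [hD0, hf] with T h1 h2
      positivity
    · filter_upwards [hpos, hf, eventually_gt_atTop 0, trunc_pow_le hβ hr] with T ⟨h1, h2, h3⟩ h4 h5 h6
      have hT : (0 : ℝ) < T := by exact_mod_cast h5
      have hK' : (0 : ℝ) < K T := by exact_mod_cast h1
      have h7 := KL_sq h1 h2 h3
      simp only [hDdef, Dr]
      rw [add_mul, add_div]
      refine add_le_add_left ?_ _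
      calc (K T : ℝ) * ((L T : ℝ) + 1) ^ 2 * (C * ((⌊sT r T⌋₊ : ℝ) + 1) ^ (-β)) * f T / T
          ≤ (4 * (T : ℝ) ^ 2 / K T) * (C * ((Real.log (r * T)) ^ 10 / (r * T))) * f T / T := by
            gcongr
        _ = _ := by field_simp
  have hup : Tendsto (fun T : ℕ => (K T * aR d (L T) + D T) * f T / T) atTop (𝓝 ε) := by
    have := hA.add hD
    rw [add_zero] at this
    exact this.congr fun T => by ring
  refine ⟨?_, ?_⟩
  · refine tendsto_of_tendsto_of_tendsto_of_le_of_le' hlim hup ?_ ?_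
    · filter_upwards [hpos, hf] with T ⟨h1, h2, h3⟩ h4
      have := (integral_XR_bounds hC hG ⌊sT r T⌋₊ (K T) (L T) T h2 h3).1
      gcongr
    · filter_upwards [hpos, hf] with T ⟨h1, h2, h3⟩ h4
      have := (integral_XR_bounds hC hG ⌊sT r T⌋₊ (K T) (L T) T h2 h3).2
      gcongr
  · intro δ hδ
    have hdiff : Tendsto (fun T : ℕ => |K T * aR d (L T) * f T / T - aR d T * f T / T| +
        D T * f T / T) atTop (𝓝 0) := by
      have := (hA.sub hlim).abs.add hD
      simpa using this
    have hsmall : 0 < δ / 2 * (ε / 2) := by positivity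
    filter_upwards [hpos, hf, eventually_gt_atTop 0, hdiff.eventually_lt_const hsmall,
      hlim.eventually_const_lt (show ε / 2 < ε by linarith)] with T ⟨h1, h2, h3⟩ h4 h5 h6 h7 E hE0 hE
    have hT : (0 : ℝ) < T := by exact_mod_cast h5
    have hK' : (0 : ℝ) < K T := by exact_mod_cast h1
    have hfT : 0 < f T := by linarith
    have ha : ε / 2 * (T / f T) ≤ aR d T := by
      rw [lt_div_iff₀ hT] at h7
      rw [mul_div_assoc', div_le_iff₀ hfT]
      exact h7.le
    have ha0 : 0 < aR d T := lt_of_lt_of_le (by positivity) ha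
    have hdev : |K T * aR d (L T) - aR d T| + D T ≤ δ / 2 * aR d T := by
      have e : |K T * aR d (L T) * f T / T - aR d T * f T / T| + D T * f T / T =
          (|K T * aR d (L T) - aR d T| + D T) * (f T / T) := by
        have : K T * aR d (L T) * f T / T - aR d T * f T / T =
          (K T * aR d (L T) - aR d T) * (f T / T) := by ring
        rw [this, abs_mul, abs_of_pos (by positivity : 0 < f T / T)]
        ring
      rw [e, ← lt_div_iff₀ (by positivity)] at h6
      refine h6.le.trans ?_
      calc δ / 2 * (ε / 2) / (f T / T) = δ / 2 * (ε / 2 * (T / f T)) := by field_simp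
        _ ≤ _ := by gcongr
    have h8 := prob_dev hC hG hg ⌊sT r T⌋₊ (K T) (L T) T h2 h3 δ hδ ha0 hdev E hE0 hE
    refine h8.trans ?_
    have h9 := KL_sq h1 h2 h3
    refine add_le_add ?_ ?_
    · calc 16 * ((K T : ℝ) * ((L T : ℝ) + 1) ^ 2) / (δ * aR d T) ^ 2
          ≤ 16 * (4 * (T : ℝ) ^ 2 / K T) / (δ * (ε / 2 * (T / f T))) ^ 2 := by gcongr
        _ = _ := by field_simp; ring
    · calc 4 * E / (δ * aR d T) ≤ 4 * E / (δ * (ε / 2 * (T / f T))) := by gcongr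
        _ = _ := by field_simp; ring

/-! ### Dimension at least five -/

/-- Integer fourth root. -/
def qr (T : ℕ) : ℕ := Nat.sqrt (Nat.sqrt T)

lemma qr_le (T : ℕ) : qr T ^ 4 ≤ T := by
  unfold qr
  have h1 := Nat.sqrt_le' (Nat.sqrt T)
  have h2 := Nat.sqrt_le' T
  calc (Nat.sqrt (Nat.sqrt T)) ^ 4 = ((Nat.sqrt (Nat.sqrt T)) ^ 2) ^ 2 := by ring
    _ ≤ (Nat.sqrt T) ^ 2 := Nat.pow_le_pow_left h1 2
    _ ≤ T := h2

lemma lt_qr (T : ℕ) : T < (qr T + 1) ^ 4 := by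
  unfold qr
  have h1 := Nat.lt_succ_sqrt' (Nat.sqrt T)
  have h2 := Nat.lt_succ_sqrt' T
  calc T < (Nat.sqrt T + 1) ^ 2 := h2
    _ ≤ ((Nat.sqrt (Nat.sqrt T) + 1) ^ 2) ^ 2 := Nat.pow_le_pow_left h1 2
    _ = _ := by ring

lemma tendsto_sqrt_nat : Tendsto Nat.sqrt atTop atTop := by
  refine tendsto_atTop_atTop.mpr fun b => ⟨b ^ 2, fun a ha => ?_⟩
  exact Nat.le_sqrt'.mpr ha

lemma tendsto_qr : Tendsto qr atTop atTop := tendsto_sqrt_nat.comp tendsto_sqrt_nat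

lemma qr_inv_le {T : ℕ} (hT : 0 < qr T) : 1 / (qr T : ℝ) ≤ 2 * (T : ℝ) ^ (-(1 : ℝ) / 4) := by
  have hq : (1 : ℝ) ≤ qr T := by exact_mod_cast hT
  have h1 : (T : ℝ) ≤ ((qr T : ℝ) + 1) ^ 4 := by exact_mod_cast (lt_qr T).le
  have hT0 : (0 : ℝ) < T := by
    have : (qr T : ℝ) ^ 4 ≤ T := by exact_mod_cast qr_le T
    have : (0 : ℝ) < (qr T : ℝ) ^ 4 := by positivity
    linarith
  have h2 : (T : ℝ) ^ ((1 : ℝ) / 4) ≤ qr T + 1 := by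
    calc (T : ℝ) ^ ((1 : ℝ) / 4) ≤ (((qr T : ℝ) + 1) ^ (4 : ℕ)) ^ ((1 : ℝ) / 4) := by gcongr
      _ = _ := by
        rw [← Real.rpow_natCast, ← Real.rpow_mul (by positivity)]
        norm_num
  rw [neg_div, Real.rpow_neg hT0.le, ← div_eq_mul_inv]
  rw [div_le_div_iff₀ (by linarith) (by positivity)]
  linarith

lemma log_pow_small (r : ℝ) (hr : 0 < r) :
    Tendsto (fun T : ℕ => (Real.log (r * T)) ^ 10 * (T : ℝ) ^ (-(1 : ℝ) / 4)) atTop (𝓝 0) := by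
  have h1 : Tendsto (fun T : ℕ => r * (T : ℝ)) atTop atTop :=
    tendsto_natCast_atTop_atTop.const_mul_atTop hr
  have h2 : Tendsto (fun x : ℝ => (Real.log x) ^ 10 / x ^ ((1 : ℝ) / 4)) atTop (𝓝 0) := by
    have := (isLittleO_log_rpow_rpow_atTop 10 (show (0 : ℝ) < 1 / 4 by norm_num)).tendsto_div_nhds_zero
    refine this.congr fun x => ?_
    norm_cast
  have h3 := ((h2.comp h1).mul_const (r ^ ((1 : ℝ) / 4)))
  rw [zero_mul] at h3
  refine h3.congr' ?_
  filter_upwards [eventually_gt_atTop 0] with T hT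
  have hT' : (0 : ℝ) < T := by exact_mod_cast hT
  simp only [Function.comp]
  rw [Real.mul_rpow hr.le hT'.le, neg_div, Real.rpow_neg hT'.le]
  have : r ^ ((1 : ℝ) / 4) ≠ 0 := by positivity
  field_simp

lemma case_five {d : ℕ} [NeZero d] (hd : 5 ≤ d) (r : ℝ) (hr : 0 < r) (ε : ℝ) (hε : 0 < ε)
    (hlim : Tendsto (fun T : ℕ => aR d T * 1 / T) atTop (𝓝 ε)) :
    Tendsto (fun T : ℕ => (∫ u, XR ⌊sT r T⌋₊ T u ∂(walkLaw d)) * 1 / T) atTop (𝓝 ε) ∧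
    ∀ δ : ℝ, 0 < δ → ∃ C : ℝ, 0 < C ∧ ∀ᶠ T : ℕ in atTop,
      ((walkLaw d) {u | δ * aR d T < |XR ⌊sT r T⌋₊ T u - aR d T|}).toReal <
        C * (T : ℝ) ^ (-(1 : ℝ) / 4) := by
  obtain ⟨C, hC, hG⟩ := heat_tail (d := d) (3 / 2) (by norm_num) (by
    have : (5 : ℝ) ≤ d := by exact_mod_cast hd
    linarith)
  have hg : ∀ x y : Zd d, gE x y ≠ ⊤ := fun x y => by
    have := hG 0 x y
    simp only [zero_add] at this
    exact ne_top_of_le_ne_top ENNReal.ofReal_ne_top this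
  have hq0 : ∀ᶠ T in atTop, 0 < qr T := tendsto_qr.eventually_gt_atTop 0
  have hpos : ∀ᶠ T in atTop, 0 < qr T ∧ 0 < qr T ^ 2 * qr T ∧ qr T * (qr T ^ 2 * qr T) ≤ T := by
    filter_upwards [hq0] with T hT
    refine ⟨hT, by positivity, le_trans (le_of_eq (by ring)) (qr_le T)⟩
  have hL : Tendsto (fun T => qr T ^ 2 * qr T) atTop atTop := by
    refine tendsto_atTop_mono' _ ?_ tendsto_qr
    filter_upwards [hq0] with T hT
    exact Nat.le_mul_of_pos_left _ (by positivity)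
  have hqr : Tendsto (fun T => 1 / (qr T : ℝ)) atTop (𝓝 0) :=
    tendsto_one_div_atTop_nhds_zero_nat.comp tendsto_qr
  have hR : Tendsto (fun T : ℕ => ((T : ℝ) - (qr T : ℕ) * ((qr T ^ 2 * qr T : ℕ) : ℝ) + 1) *
      (fun _ : ℕ => (1 : ℝ)) T / T) atTop (𝓝 0) := by
    have h0 : Tendsto (fun T => 16 * (1 / (qr T : ℝ))) atTop (𝓝 0) := by
      simpa using hqr.const_mul 16
    refine tendsto_of_tendsto_of_tendsto_of_le_of_le' tendsto_const_nhds h0 ?_ ?_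
    · filter_upwards [hpos] with T ⟨_, _, h3⟩
      have h3' : (qr T : ℝ) * ((qr T ^ 2 * qr T : ℕ) : ℝ) ≤ T := by exact_mod_cast h3
      have : 0 ≤ (T : ℝ) - (qr T : ℕ) * ((qr T ^ 2 * qr T : ℕ) : ℝ) + 1 := by linarith
      positivity
    · filter_upwards [hq0] with T hT
      have hq : (1 : ℝ) ≤ qr T := by exact_mod_cast hT
      have h1 : (T : ℝ) + 1 ≤ ((qr T : ℝ) + 1) ^ 4 := by exact_mod_cast (lt_qr T)
      have h2 : (qr T : ℝ) ^ 4 ≤ T := by exact_mod_cast qr_le T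
      have hT0 : (0 : ℝ) < (qr T : ℝ) ^ 4 := by positivity
      push_cast
      rw [mul_one]
      have h3 : (T : ℝ) - (qr T : ℝ) * ((qr T : ℝ) ^ 2 * qr T) + 1 ≤ 15 * (qr T : ℝ) ^ 3 := by
        nlinarith [mul_nonneg (mul_nonneg (sub_nonneg.mpr hq) (sub_nonneg.mpr hq)) (sub_nonneg.mpr hq),
          mul_nonneg (sub_nonneg.mpr hq) (sub_nonneg.mpr hq), sq_nonneg (qr T : ℝ),
          mul_nonneg (sq_nonneg (qr T : ℝ)) (sub_nonneg.mpr hq)]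
      calc ((T : ℝ) - (qr T : ℝ) * ((qr T : ℝ) ^ 2 * qr T) + 1) / T
          ≤ 15 * (qr T : ℝ) ^ 3 / T := by gcongr
        _ ≤ 15 * (qr T : ℝ) ^ 3 / (qr T : ℝ) ^ 4 := by gcongr
        _ = 15 * (1 / (qr T : ℝ)) := by field_simp
        _ ≤ _ := by gcongr; norm_num
  have hK : Tendsto (fun T : ℕ => (Real.log (r * T)) ^ 10 * (fun _ : ℕ => (1 : ℝ)) T / qr T)
      atTop (𝓝 0) := by
    have h0 : Tendsto (fun T : ℕ => 2 * ((Real.log (r * T)) ^ 10 * (T : ℝ) ^ (-(1 : ℝ) / 4)))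
        atTop (𝓝 0) := by
      simpa using (log_pow_small r hr).const_mul 2
    have hev : ∀ x : ℝ, 0 ≤ x ^ 10 := fun x => by
      rw [show x ^ 10 = (x ^ 5) ^ 2 by ring]; positivity
    refine tendsto_of_tendsto_of_tendsto_of_le_of_le' tendsto_const_nhds h0 ?_ ?_
    · refine Eventually.of_forall fun T => ?_
      have := hev (Real.log (r * T))
      positivity
    · filter_upwards [hq0] with T hT
      have := qr_inv_le hT
      calc (Real.log (r * T)) ^ 10 * 1 / qr T = (Real.log (r * T)) ^ 10 * (1 / qr T) := by ring
        _ ≤ (Real.log (r * T)) ^ 10 * (2 * (T : ℝ) ^ (-(1 : ℝ) / 4)) :=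
            mul_le_mul_of_nonneg_left this (hev _)
        _ = _ := by ring
  have main := main_abs hC (by norm_num) hG hg r hr ε hε (fun _ => 1)
    (Eventually.of_forall fun _ => le_rfl) hlim qr (fun T => qr T ^ 2 * qr T) hpos hL hR hK
    (by simp)
  refine ⟨main.1, fun δ hδ => ?_⟩
  refine ⟨256 / (δ * ε) ^ 2 * 2 + 8 / (δ * ε) * ((4 + 48 * C) * 2) + 1, by positivity, ?_⟩
  filter_upwards [main.2 δ hδ, hq0, eventually_gt_atTop 0] with T h1 h2 h3
  have h4 := h1 ((4 + 48 * C) * qr T ^ 3) (by positivity) (EN_five hC hG (qr T) h2)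
  refine lt_of_le_of_lt h4 ?_
  have hq : (0 : ℝ) < qr T := by exact_mod_cast h2
  have h5 : (qr T : ℝ) ^ 4 ≤ T := by exact_mod_cast qr_le T
  have h6 := qr_inv_le h2
  have hTp : (0 : ℝ) < (T : ℝ) ^ (-(1 : ℝ) / 4) := by
    have : (0 : ℝ) < T := by exact_mod_cast h3
    positivity
  have h7 : (4 + 48 * C) * (qr T : ℝ) ^ 3 * 1 / T ≤ (4 + 48 * C) * (2 * (T : ℝ) ^ (-(1 : ℝ) / 4)) := by
    calc (4 + 48 * C) * (qr T : ℝ) ^ 3 * 1 / T ≤ (4 + 48 * C) * (qr T : ℝ) ^ 3 * 1 / (qr T : ℝ) ^ 4 := by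
          gcongr
      _ = (4 + 48 * C) * (1 / qr T) := by field_simp
      _ ≤ _ := by gcongr
  calc 256 / (δ * ε) ^ 2 * (1 ^ 2 / (qr T : ℝ)) + 8 / (δ * ε) * ((4 + 48 * C) * (qr T : ℝ) ^ 3 * 1 / T)
      ≤ 256 / (δ * ε) ^ 2 * (2 * (T : ℝ) ^ (-(1 : ℝ) / 4)) +
        8 / (δ * ε) * ((4 + 48 * C) * (2 * (T : ℝ) ^ (-(1 : ℝ) / 4))) := by
        rw [one_pow]; gcongr
    _ < _ := by
        have e : (256 / (δ * ε) ^ 2 * 2 + 8 / (δ * ε) * ((4 + 48 * C) * 2) + 1) *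
          (T : ℝ) ^ (-(1 : ℝ) / 4) = 256 / (δ * ε) ^ 2 * (2 * (T : ℝ) ^ (-(1 : ℝ) / 4)) +
          8 / (δ * ε) * ((4 + 48 * C) * (2 * (T : ℝ) ^ (-(1 : ℝ) / 4))) +
          (T : ℝ) ^ (-(1 : ℝ) / 4) := by ring
        rw [e]; linarith

/-! ### Dimension four -/

/-- Scale `√(log T)`. -/
def yy (T : ℕ) : ℝ := √(Real.log T)

/-- Number of blocks. -/
def KK (T : ℕ) : ℕ := ⌊Real.exp (yy T)⌋₊

/-- Number of sub-blocks per block. -/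
def MM (T : ℕ) : ℕ := T / (KK T * Nat.sqrt T)

lemma tendsto_yy : Tendsto yy atTop atTop :=
  Real.tendsto_sqrt_atTop.comp (Real.tendsto_log_atTop.comp tendsto_natCast_atTop_atTop)

lemma yy_pow_small (c : ℝ) (n : ℕ) :
    Tendsto (fun T : ℕ => c * (yy T ^ n / Real.exp (yy T))) atTop (𝓝 0) := by
  have h := ((Real.tendsto_pow_mul_exp_neg_atTop_nhds_zero n).comp tendsto_yy).const_mul c
  rw [mul_zero] at h
  refine h.congr fun T => ?_
  simp only [Function.comp, Real.exp_neg]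
  rfl

lemma facts_four : ∀ᶠ T : ℕ in atTop, 4 ≤ yy T ∧ Real.log T = yy T ^ 2 ∧
    (T : ℝ) = Real.exp (yy T ^ 2) ∧ 0 < KK T ∧ (KK T : ℝ) ≤ Real.exp (yy T) ∧
    Real.exp (yy T) ≤ 2 * KK T ∧ 0 < Nat.sqrt T ∧ (Nat.sqrt T : ℝ) ≤ Real.exp (yy T ^ 2 / 2) ∧
    Real.exp (yy T ^ 2 / 2) ≤ 2 * Nat.sqrt T := by
  filter_upwards [tendsto_yy.eventually_ge_atTop 4, eventually_gt_atTop 0] with T h1 h2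
  have hT : (1 : ℝ) ≤ T := by exact_mod_cast h2
  have hlog : Real.log T = yy T ^ 2 := (Real.sq_sqrt (Real.log_nonneg hT)).symm
  have hTe : (T : ℝ) = Real.exp (yy T ^ 2) := by rw [← hlog, Real.exp_log (by linarith)]
  have he1 : 1 ≤ Real.exp (yy T) := Real.one_le_exp (by linarith)
  have hK0 : 0 < KK T := Nat.floor_pos.mpr he1
  have hK1 : (1 : ℝ) ≤ KK T := by exact_mod_cast hK0
  have hm0 : 0 < Nat.sqrt T := Nat.sqrt_pos.mpr h2
  have hm1 : (1 : ℝ) ≤ Nat.sqrt T := by exact_mod_cast hm0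
  have hsq : Real.exp (yy T ^ 2 / 2) ^ 2 = T := by
    rw [hTe, ← Real.exp_nat_mul]; congr 1; push_cast; ring
  refine ⟨h1, hlog, hTe, hK0, Nat.floor_le (by positivity), ?_, hm0, ?_, ?_⟩
  · have := (Nat.lt_floor_add_one (Real.exp (yy T))).le
    have e : ((⌊Real.exp (yy T)⌋₊ : ℕ) : ℝ) = KK T := rfl
    rw [e] at this
    linarith
  · refine le_of_sq_le_sq ?_ (Real.exp_pos _).le
    rw [hsq]
    exact_mod_cast Nat.sqrt_le' T
  · refine le_of_sq_le_sq ?_ (by positivity)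
    rw [hsq]
    have : (T : ℝ) ≤ ((Nat.sqrt T : ℝ) + 1) ^ 2 := by exact_mod_cast (Nat.lt_succ_sqrt' T).le
    nlinarith

lemma Km_small : ∀ᶠ T : ℕ in atTop,
    (KK T : ℝ) * Nat.sqrt T * (1 + Real.log T) / T ≤ 2 * (yy T ^ 2 / Real.exp (yy T)) := by
  filter_upwards [facts_four] with T ⟨hy, hlog, hT, hK0, hK1, hK2, hm0, hm1, hm2⟩
  set y := yy T
  rw [hlog, hT]
  calc (KK T : ℝ) * Nat.sqrt T * (1 + y ^ 2) / Real.exp (y ^ 2)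
      ≤ Real.exp y * Real.exp (y ^ 2 / 2) * (2 * y ^ 2) / Real.exp (y ^ 2) := by
        gcongr
        nlinarith
    _ = 2 * y ^ 2 * Real.exp (y + y ^ 2 / 2 - y ^ 2) := by
        rw [Real.exp_sub, Real.exp_add]; ring
    _ ≤ 2 * y ^ 2 * Real.exp (-y) := by
        gcongr
        nlinarith
    _ = _ := by rw [Real.exp_neg]; ring

lemma Km_le : ∀ᶠ T : ℕ in atTop, 2 * (KK T * Nat.sqrt T) ≤ T := by
  filter_upwards [facts_four, Km_small,
    (yy_pow_small 2 2).eventually_lt_const (show (0 : ℝ) < 1 / 2 by norm_num)]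
    with T ⟨hy, hlog, hT, hK0, hK1, hK2, hm0, hm1, hm2⟩ h1 h2
  have h3 := h1.trans h2.le
  have hT0 : (0 : ℝ) < T := by rw [hT]; positivity
  rw [div_le_iff₀ hT0] at h3
  have : (KK T : ℝ) * Nat.sqrt T ≤ (KK T : ℝ) * Nat.sqrt T * (1 + Real.log T) := by
    refine le_mul_of_one_le_right (by positivity) ?_
    rw [hlog]; nlinarith [sq_nonneg (yy T)]
  have h4 : 2 * ((KK T : ℝ) * Nat.sqrt T) ≤ T := by linarith
  exact_mod_cast h4

lemma rem_le {T : ℕ} (h : 0 < KK T * Nat.sqrt T) :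
    KK T * (MM T * Nat.sqrt T) ≤ T ∧ T + 1 ≤ KK T * (MM T * Nat.sqrt T) + KK T * Nat.sqrt T := by
  have h1 := Nat.div_add_mod T (KK T * Nat.sqrt T)
  have h2 := Nat.mod_lt T h
  have e : KK T * (MM T * Nat.sqrt T) = KK T * Nat.sqrt T * (T / (KK T * Nat.sqrt T)) := by
    unfold MM; ring
  rw [e]
  omega

lemma pos_four : ∀ᶠ T : ℕ in atTop, 0 < KK T ∧ 0 < MM T * Nat.sqrt T ∧
    KK T * (MM T * Nat.sqrt T) ≤ T := by
  filter_upwards [facts_four, Km_le] with T ⟨hy, hlog, hT, hK0, hK1, hK2, hm0, hm1, hm2⟩ h1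
  have hM : 0 < MM T := Nat.div_pos (by omega) (by positivity)
  exact ⟨hK0, by positivity, (rem_le (by positivity)).1⟩

lemma log_lower_four : ∀ᶠ T : ℕ in atTop,
    Real.log T - (1 + yy T) ≤ Real.log ((MM T * Nat.sqrt T : ℕ) : ℝ) ∧
      Real.log ((MM T * Nat.sqrt T : ℕ) : ℝ) ≤ Real.log T := by
  filter_upwards [facts_four, Km_le, pos_four] with
    T ⟨hy, hlog, hT, hK0, hK1, hK2, hm0, hm1, hm2⟩ h1 ⟨_, h2, h3⟩
  have hr := (rem_le (T := T) (by positivity)).2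
  set L := MM T * Nat.sqrt T
  have hL : (0 : ℝ) < L := by exact_mod_cast h2
  have hKp : (0 : ℝ) < KK T := by exact_mod_cast hK0
  have hT0 : (0 : ℝ) < T := by rw [hT]; positivity
  constructor
  · have h4 : T ≤ 2 * (KK T * L) := by omega
    have h5 : (T : ℝ) ≤ 2 * (KK T * L) := by exact_mod_cast h4
    have h6 := Real.log_le_log hT0 h5
    rw [Real.log_mul (by norm_num) (by positivity), Real.log_mul (by positivity) (by positivity)] at h6
    have h7 : Real.log (KK T) ≤ yy T := by
      rw [← Real.log_exp (yy T)]; exact Real.log_le_log hKp hK1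
    have h8 : Real.log 2 ≤ 1 := by linarith [Real.log_two_lt_d9]
    linarith
  · refine Real.log_le_log hL ?_
    have : L ≤ T := le_trans (Nat.le_mul_of_pos_left L hK0) h3
    exact_mod_cast this

set_option maxHeartbeats 1000000 in
lemma case_four {d : ℕ} [NeZero d] (hd : d = 4) (r : ℝ) (hr : 0 < r) (ε : ℝ) (hε : 0 < ε)
    (hlim : Tendsto (fun T : ℕ => aR d T * (1 + Real.log T) / T) atTop (𝓝 ε)) :
    Tendsto (fun T : ℕ => (∫ u, XR ⌊sT r T⌋₊ T u ∂(walkLaw d)) * (1 + Real.log T) / T)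
      atTop (𝓝 ε) ∧
    ∀ δ : ℝ, 0 < δ → ∃ C : ℝ, 0 < C ∧ ∀ᶠ T : ℕ in atTop,
      ((walkLaw d) {u | δ * aR d T < |XR ⌊sT r T⌋₊ T u - aR d T|}).toReal <
        C / √(Real.log T) := by
  obtain ⟨C, hC, hG⟩ := heat_tail (d := d) 1 le_rfl (by subst hd; norm_num)
  have hg : ∀ x y : Zd d, gE x y ≠ ⊤ := fun x y => by
    have := hG 0 x y
    simp only [zero_add] at this
    exact ne_top_of_le_ne_top ENNReal.ofReal_ne_top this
  have hf : ∀ᶠ T : ℕ in atTop, 1 ≤ 1 + Real.log T := by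
    filter_upwards [facts_four] with T ⟨hy, hlog, _⟩
    rw [hlog]; nlinarith
  have hL : Tendsto (fun T => MM T * Nat.sqrt T) atTop atTop := by
    refine tendsto_atTop_mono' _ ?_ tendsto_sqrt_nat
    filter_upwards [pos_four] with T ⟨_, h2, _⟩
    exact Nat.le_mul_of_pos_left _ (Nat.pos_of_mul_pos_right h2)
  have hR : Tendsto (fun T : ℕ => ((T : ℝ) - (KK T : ℕ) * ((MM T * Nat.sqrt T : ℕ) : ℝ) + 1) *
      (1 + Real.log T) / T) atTop (𝓝 0) := by
    refine tendsto_of_tendsto_of_tendsto_of_le_of_le' tendsto_const_nhds (yy_pow_small 2 2) ?_ ?_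
    · filter_upwards [pos_four, hf] with T ⟨_, _, h3⟩ h4
      have h3' : (KK T : ℝ) * ((MM T * Nat.sqrt T : ℕ) : ℝ) ≤ T := by exact_mod_cast h3
      have : 0 ≤ (T : ℝ) - (KK T : ℕ) * ((MM T * Nat.sqrt T : ℕ) : ℝ) + 1 := by linarith
      positivity
    · filter_upwards [facts_four, Km_small, hf] with
        T ⟨hy, hlog, hT, hK0, hK1, hK2, hm0, hm1, hm2⟩ h1 h4
      refine le_trans ?_ h1
      have h2 := (rem_le (T := T) (by positivity)).2
      have h3 : (T : ℝ) + 1 ≤ KK T * ((MM T * Nat.sqrt T : ℕ) : ℝ) + KK T * Nat.sqrt T := by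
        exact_mod_cast h2
      gcongr
      linarith
  have hK : Tendsto (fun T : ℕ => (Real.log (r * T)) ^ 10 * (1 + Real.log T) / KK T)
      atTop (𝓝 0) := by
    have hev : ∀ x : ℝ, 0 ≤ x ^ 10 := fun x => by
      rw [show x ^ 10 = (x ^ 5) ^ 2 by ring]; positivity
    refine tendsto_of_tendsto_of_tendsto_of_le_of_le' tendsto_const_nhds (yy_pow_small 4096 22) ?_ ?_
    · filter_upwards [hf] with T h4
      have := hev (Real.log (r * T))
      positivity
    · filter_upwards [facts_four, tendsto_yy.eventually_ge_atTop |Real.log r|] with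
        T ⟨hy, hlog, hT, hK0, hK1, hK2, hm0, hm1, hm2⟩ h1
      have hT0 : (0 : ℝ) < T := by rw [hT]; positivity
      have hKp : (0 : ℝ) < KK T := by exact_mod_cast hK0
      rw [Real.log_mul hr.ne' hT0.ne', hlog]
      set y := yy T
      have h2 : |Real.log r + y ^ 2| ≤ 2 * y ^ 2 := by
        have := abs_add_le (Real.log r) (y ^ 2)
        rw [abs_of_nonneg (sq_nonneg y)] at this
        nlinarith
      have h3 : (Real.log r + y ^ 2) ^ 10 ≤ (2 * y ^ 2) ^ 10 := by
        have e : (Real.log r + y ^ 2) ^ 10 = |Real.log r + y ^ 2| ^ 10 := by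
          rw [show (10 : ℕ) = 2 * 5 by norm_num, pow_mul, pow_mul, sq_abs]
        rw [e]
        exact pow_le_pow_left₀ (abs_nonneg _) h2 10
      have h4 : (KK T : ℝ)⁻¹ ≤ 2 * (Real.exp y)⁻¹ := by
        rw [← div_eq_mul_inv, le_div_iff₀ (Real.exp_pos _), ← div_eq_inv_mul,
          div_le_iff₀ hKp]
        exact hK2
      calc (Real.log r + y ^ 2) ^ 10 * (1 + y ^ 2) / KK T
          = (Real.log r + y ^ 2) ^ 10 * (1 + y ^ 2) * (KK T : ℝ)⁻¹ := by rw [div_eq_mul_inv]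
        _ ≤ (2 * y ^ 2) ^ 10 * (2 * y ^ 2) * (2 * (Real.exp y)⁻¹) := by
            gcongr
            nlinarith
        _ = _ := by ring
  have hfL : Tendsto (fun T : ℕ => (1 + Real.log T) / (1 + Real.log ((MM T * Nat.sqrt T : ℕ) : ℝ)))
      atTop (𝓝 1) := by
    have h0 : Tendsto (fun T : ℕ => (1 + Real.log ((MM T * Nat.sqrt T : ℕ) : ℝ)) / (1 + Real.log T))
        atTop (𝓝 1) := by
      have hinv : Tendsto (fun T : ℕ => 1 - 2 * (yy T)⁻¹) atTop (𝓝 1) := by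
        have := (tendsto_inv_atTop_zero.comp tendsto_yy).const_mul (2 : ℝ)
        simpa using this.const_sub 1
      refine tendsto_of_tendsto_of_tendsto_of_le_of_le' hinv tendsto_const_nhds ?_ ?_
      · filter_upwards [facts_four, log_lower_four] with T ⟨hy, hlog, _⟩ ⟨h1, h2⟩
        rw [hlog] at *
        set y := yy T
        have hy0 : 0 < y := by linarith
        rw [le_div_iff₀ (by positivity)]
        have : (1 - 2 * y⁻¹) * (1 + y ^ 2) = 1 + y ^ 2 - 2 * y⁻¹ - 2 * y := by
          field_simp; ring
        have h3 : 0 < y⁻¹ := by positivity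
        linarith
      · filter_upwards [facts_four, log_lower_four] with T ⟨hy, hlog, _⟩ ⟨h1, h2⟩
        rw [hlog] at *
        rw [div_le_one (by positivity)]
        linarith
    have := h0.inv₀ one_ne_zero
    rw [inv_one] at this
    exact this.congr fun T => inv_div _ _
  have main := main_abs hC le_rfl hG hg r hr ε hε (fun T => 1 + Real.log T)
    hf hlim KK (fun T => MM T * Nat.sqrt T) pos_four hL hR hK hfL
  refine ⟨main.1, fun δ hδ => ?_⟩
  refine ⟨256 / (δ * ε) ^ 2 + 8 / (δ * ε) * (8 + 512 * ε ^ 2 * C) + 1, by positivity, ?_⟩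
  have hlm := (hlim.comp tendsto_sqrt_nat).eventually_lt_const (show ε < 2 * ε by linarith)
  filter_upwards [main.2 δ hδ, facts_four, Km_small, pos_four, hlm,
    (yy_pow_small 8 5).eventually_lt_const zero_lt_one,
    (yy_pow_small 1 3).eventually_lt_const zero_lt_one] with
    T h1 ⟨hy, hlog, hT, hK0, hK1, hK2, hm0, hm1, hm2⟩ h2 ⟨_, h3, h3'⟩ h4 h5 h6
  have hM : 0 < MM T := Nat.pos_of_mul_pos_right h3
  have hlogK0 : 0 ≤ Real.log (1 + KK T) := Real.log_nonneg (by
    have : (0 : ℝ) ≤ KK T := by positivity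
    linarith)
  have h7 := h1 _ (by positivity) (EN_four hC hG (KK T) (MM T) (Nat.sqrt T) hM hm0)
  refine lt_of_le_of_lt h7 ?_
  have hyy : √(Real.log T) = yy T := rfl
  simp only [Function.comp] at h4
  rw [hyy]
  rw [hlog] at h2 ⊢
  have hKp : (1 : ℝ) ≤ KK T := by exact_mod_cast hK0
  have hmp : (1 : ℝ) ≤ Nat.sqrt T := by exact_mod_cast hm0
  have hT0 : (0 : ℝ) < T := by rw [hT]; positivity
  have hKMm : (KK T : ℝ) * (MM T * Nat.sqrt T) ≤ T := by exact_mod_cast h3'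
  -- the logarithm of `m`
  have hlm' : (1 + yy T ^ 2) / 4 ≤ 1 + Real.log (Nat.sqrt T) := by
    have := Real.log_le_log (Real.exp_pos _) hm2
    rw [Real.log_exp, Real.log_mul (by norm_num) (by positivity)] at this
    have h8 := Real.log_two_lt_d9
    nlinarith
  set y := yy T with hydef
  set m := Nat.sqrt T with hmdef
  set M := MM T with hMdef
  set k := KK T with hkdef
  have hy0 : 0 < y := by linarith
  have ha0 := aR_nonneg (d := d) m
  have ham : aR d m * (1 + y ^ 2) ≤ 8 * ε * m := by
    rw [div_lt_iff₀ (by linarith)] at h4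
    have : aR d m * ((1 + y ^ 2) / 4) ≤ aR d m * (1 + Real.log m) := by gcongr
    linarith
  have hlogK : 2 + Real.log (1 + k) ≤ 4 * y := by
    have h8 : Real.log (1 + k) ≤ Real.log (2 * Real.exp y) :=
      Real.log_le_log (by linarith) (by linarith)
    rw [Real.log_mul (by norm_num) (by positivity), Real.log_exp] at h8
    have h9 := Real.log_two_lt_d9
    linarith
  have t1 : (1 + y ^ 2) ^ 2 / (k : ℝ) ≤ 1 / y := by
    rw [div_le_div_iff₀ (by linarith) hy0]
    rw [mul_div_assoc', div_lt_one (Real.exp_pos _)] at h5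
    have : (1 + y ^ 2) ^ 2 * y ≤ (2 * y ^ 2) ^ 2 * y := by gcongr; nlinarith
    have e5 : (2 * y ^ 2) ^ 2 * y * 2 = 8 * y ^ 5 := by ring
    linarith
  have t2 : (k : ℝ) * m * (1 + y ^ 2) / T ≤ 2 / y := by
    refine h2.trans ?_
    rw [one_mul, div_lt_one (Real.exp_pos _)] at h6
    rw [mul_div_assoc', div_le_div_iff₀ (Real.exp_pos _) hy0]
    have e3 : 2 * y ^ 2 * y = 2 * y ^ 3 := by ring
    linarith
  have t3 : 2 * (k : ℝ) * ((m + 1) + (aR d m) ^ 2 * (C / m) * (M * (2 + Real.log (1 + k)))) *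
      (1 + y ^ 2) / T ≤ (8 + 512 * ε ^ 2 * C) / y := by
    have e : 2 * (k : ℝ) * ((m + 1) + (aR d m) ^ 2 * (C / m) * (M * (2 + Real.log (1 + k)))) *
      (1 + y ^ 2) / T = 2 * (k * (m + 1) * (1 + y ^ 2) / T) +
        2 * C * ((aR d m * (1 + y ^ 2)) ^ 2 * (k * M / m) * (2 + Real.log (1 + k)) /
          ((1 + y ^ 2) * T)) := by
      field_simp
    rw [e]
    have p1 : 2 * ((k : ℝ) * (m + 1) * (1 + y ^ 2) / T) ≤ 8 / y := by
      calc 2 * ((k : ℝ) * (m + 1) * (1 + y ^ 2) / T) ≤ 2 * ((k : ℝ) * (m + m) * (1 + y ^ 2) / T) := by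
            gcongr
        _ = 4 * ((k : ℝ) * m * (1 + y ^ 2) / T) := by ring
        _ ≤ 4 * (2 / y) := by gcongr
        _ = _ := by ring
    have p2 : (aR d m * (1 + y ^ 2)) ^ 2 * (k * M / m) * (2 + Real.log (1 + k)) /
          ((1 + y ^ 2) * T) ≤ 256 * ε ^ 2 / y := by
      calc (aR d m * (1 + y ^ 2)) ^ 2 * (k * M / m) * (2 + Real.log (1 + k)) / ((1 + y ^ 2) * T)
          ≤ (8 * ε * m) ^ 2 * (k * M / m) * (4 * y) / (y ^ 2 * T) := by
            gcongr
            linarith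
        _ = 256 * ε ^ 2 / y * (k * (M * m) / T) := by field_simp; ring
        _ ≤ 256 * ε ^ 2 / y * 1 := by
            gcongr
            rw [div_le_one hT0]; exact hKMm
        _ = _ := mul_one _
    calc _ ≤ 8 / y + 2 * C * (256 * ε ^ 2 / y) := by gcongr
      _ = _ := by ring
  calc _ ≤ 256 / (δ * ε) ^ 2 * (1 / y) + 8 / (δ * ε) * ((8 + 512 * ε ^ 2 * C) / y) := by
        gcongr
    _ < _ := by
        have e : (256 / (δ * ε) ^ 2 + 8 / (δ * ε) * (8 + 512 * ε ^ 2 * C) + 1) / y =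
          256 / (δ * ε) ^ 2 * (1 / y) + 8 / (δ * ε) * ((8 + 512 * ε ^ 2 * C) / y) + 1 / y := by ring
        rw [e]
        have : 0 < 1 / y := by positivity
        linarith

/-- **Proposition 2.4.** For `d ≥ 4` and `r > 0`:
(i) `E^0[cap(X[0,T], rT)] = (1+o(1))·ε_d·T·(1+log T·1_{d=4})^{-1}`;
(ii) for every `δ > 0` there is `C` such that for large `T` the deviation
probability of `cap(X[0,T],rT)` from `E^0[cap(X[0,T])]` is at most
`C·(log T)^{-1/2}` for `d = 4` resp. `C·T^{-1/4}` for `d ≥ 5`. -/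
theorem truncated_capacity_asymptotics
    (d : ℕ) (hd : 4 ≤ d)
    (Pw : Zd d → Measure (ℕ → Zd d)) (hPw : IsSRWFamily d Pw)
    (εd : ℝ) (hεd : IsCapLimit d Pw εd) (r : ℝ) (hr : 0 < r) :
    Tendsto (fun T : ℕ =>
        (∫ ω, capTrunc Pw (walkRange ω 0 T) (r * T) ∂ (Pw 0)) * logFour d T / (T : ℝ))
      atTop (𝓝 εd) ∧
    ∀ δ : ℝ, 0 < δ → ∃ C : ℝ, 0 < C ∧ ∀ᶠ T : ℕ in atTop,
      ((Pw 0) {ω | δ * capExpect Pw T <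
          |capTrunc Pw (walkRange ω 0 T) (r * T) - capExpect Pw T|}).toReal <
        if d = 4 then C / Real.sqrt (Real.log T)
        else C * (T : ℝ) ^ (-(1 : ℝ) / 4) := by
  haveI : NeZero d := ⟨by omega⟩
  obtain ⟨hε, hlim⟩ := hεd
  simp only [probTrunc_eq hPw hr, intTrunc_eq hPw hr]
  simp only [capExpect_eq hPw] at hlim
  by_cases h4 : d = 4
  · have e : ∀ x, logFour d x = 1 + Real.log x := fun x => by simp [logFour, h4]
    simp only [e] at hlim ⊢
    simp only [if_pos h4]
    exact case_four h4 r hr εd hε hlim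
  · have e : ∀ x, logFour d x = 1 := fun x => by simp [logFour, h4]
    simp only [e] at hlim ⊢
    simp only [if_neg h4]
    exact case_five (by omega) r hr εd hε hlim

end FRIPaper
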